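/- Let 1 ≤ p < 2 and let Ω ⊂ ℝ² be a bounded simply connected domain. Then Ω is a local Sobolev–Poincaré imbedding domain of order p — i.e. there exist constants C ≥ 1 and λ ≥ 1 such that for every locally Lipschitz function u : Ω → ℝ, every x ∈ Ω and every 0 < r < diam(Ω), inf_{c∈ℝ} (∫_{B(x,r)∩Ω} |u(y) − c|^{2p/(2−p)} dy)^{(2−p)/(2p)} ≤ C (∫_{B(x,λr)∩Ω} |∇u(y)|^p dy)^{1/p} — if and only if Ω is a uniform domain. -/

import Mathlib

open Set Metric MeasureTheory ENNReal NNReal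

noncomputable section

/-- Euclidean space `ℝⁿ`. -/
abbrev Euc (n : ℕ) : Type := EuclideanSpace ℝ (Fin n)

/-- `u` is locally Lipschitz on the set `Ω`. -/
def LocallyLipschitzOnSet {n : ℕ} (u : Euc n → ℝ) (Ω : Set (Euc n)) : Prop :=
  ∀ x ∈ Ω, ∃ K : ℝ≥0, ∃ s ∈ nhdsWithin x Ω, LipschitzOnWith K u s

/-- `x` and `y` are joined by a (continuous) curve lying in `S`. -/
def JoinedByCurveIn {n : ℕ} (S : Set (Euc n)) (x y : Euc n) : Prop :=
  ∃ γ : ℝ → Euc n, ContinuousOn γ (Icc 0 1) ∧ γ 0 = x ∧ γ 1 = y ∧ MapsTo γ (Icc 0 1) S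

/-- `γ` is parametrized by arclength on `[0, L]`. -/
def ArclengthOn {n : ℕ} (γ : ℝ → Euc n) (L : ℝ) : Prop :=
  ∀ s t : ℝ, 0 ≤ s → s ≤ t → t ≤ L → eVariationOn γ (Icc s t) = ENNReal.ofReal (t - s)

/-- `Ω` is an `ε₀`-uniform domain. -/
def IsUniformWith {n : ℕ} (Ω : Set (Euc n)) (ε₀ : ℝ) : Prop :=
  ∀ x ∈ Ω, ∀ y ∈ Ω, ∃ γ : ℝ → Euc n,
    ContinuousOn γ (Icc 0 1) ∧ γ 0 = x ∧ γ 1 = y ∧ MapsTo γ (Icc 0 1) Ω ∧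
    eVariationOn γ (Icc 0 1) ≤ ENNReal.ofReal (dist x y / ε₀) ∧
    ∀ t ∈ Icc (0:ℝ) 1,
      ε₀ * (dist x (γ t) * dist y (γ t)) / dist x y ≤ infDist (γ t) (frontier Ω)

/-- `Ω` is a uniform domain. -/
def IsUniformDomain {n : ℕ} (Ω : Set (Euc n)) : Prop :=
  ∃ ε₀ : ℝ, 0 < ε₀ ∧ ε₀ ≤ 1 ∧ IsUniformWith Ω ε₀

/-- `Ω` is an `α`-cigar domain: any two points can be joined by a rectifiable
(arclength-parametrized) curve in `Ω` along which
`∫_γ dist(z, ∂Ω)^(α-1) |dz| ≤ C |x - y|^α`. -/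
def IsCigarDomain {n : ℕ} (Ω : Set (Euc n)) (α : ℝ) : Prop :=
  ∃ C : ℝ, 0 < C ∧ ∀ x ∈ Ω, ∀ y ∈ Ω, ∃ L : ℝ, 0 ≤ L ∧ ∃ γ : ℝ → Euc n,
    γ 0 = x ∧ γ L = y ∧ MapsTo γ (Icc 0 L) Ω ∧ ArclengthOn γ L ∧
    (∫⁻ t in Icc (0:ℝ) L, ENNReal.ofReal (infDist (γ t) (frontier Ω) ^ (α - 1)) ∂volume)
      ≤ ENNReal.ofReal (C * dist x y ^ α)

/-- `Ω` is a `c₀`-John domain. -/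
def IsJohnDomain {n : ℕ} (Ω : Set (Euc n)) (c₀ : ℝ) : Prop :=
  ∃ x₀ ∈ Ω, ∀ x ∈ Ω, ∃ l : ℝ, 0 ≤ l ∧ ∃ γ : ℝ → Euc n,
    γ 0 = x ∧ γ l = x₀ ∧ MapsTo γ (Icc 0 l) Ω ∧ ArclengthOn γ l ∧
    ∀ t ∈ Icc (0:ℝ) l, c₀ * t ≤ infDist (γ t) (frontier Ω)

/-- `Ω` has the `C`-slice property with respect to `x₀`. -/
def HasSliceProperty {n : ℕ} (Ω : Set (Euc n)) (C : ℝ) (x₀ : Euc n) : Prop :=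
  ∀ x ∈ Ω, ∃ γ : ℝ → Euc n,
    ContinuousOn γ (Icc 0 1) ∧ γ 0 = x₀ ∧ γ 1 = x ∧ MapsTo γ (Icc 0 1) Ω ∧
    ∃ j : ℕ, ∃ U : Fin (j + 1) → Set (Euc n),
      (∀ i, IsOpen (U i) ∧ U i ⊆ Ω) ∧
      (Pairwise fun i₁ i₂ => Disjoint (U i₁) (U i₂)) ∧
      -- (1)
      x₀ ∈ U 0 ∧ x ∈ U (Fin.last j) ∧
      (∀ i : Fin (j + 1), 0 < (i : ℕ) → (i : ℕ) < j →
        x₀ ∈ Ω \ closure (U i) ∧ x ∈ Ω \ closure (U i) ∧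
        x ∉ connectedComponentIn (Ω \ closure (U i)) x₀) ∧
      -- (2)
      (∀ i : Fin (j + 1), 0 < (i : ℕ) → (i : ℕ) < j →
        ∀ γ' : ℝ → Euc n, ContinuousOn γ' (Icc 0 1) → MapsTo γ' (Icc 0 1) Ω →
          (∃ t ∈ Icc (0:ℝ) 1, γ' t = x) → (∃ t ∈ Icc (0:ℝ) 1, γ' t = x₀) →
          ENNReal.ofReal (diam (U i)) ≤
            ENNReal.ofReal C * eVariationOn γ' {t ∈ Icc (0:ℝ) 1 | γ' t ∈ U i}) ∧
      -- (3)
      (∀ t ∈ Icc (0:ℝ) 1,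
        ball (γ t) (infDist (γ t) (frontier Ω) / C) ⊆ ⋃ i, closure (U i)) ∧
      -- (4)
      (∀ i : Fin (j + 1), ∀ t ∈ Icc (0:ℝ) 1, γ t ∈ U i →
        diam (U i) ≤ C * infDist (γ t) (frontier Ω)) ∧
      (∀ i : Fin (j + 1), ∃ xi ∈ U i, (∃ t ∈ Icc (0:ℝ) 1, γ t = xi) ∧
        ((i : ℕ) = j → xi = x) ∧ ball xi (infDist xi (frontier Ω) / C) ⊆ U i)

/-- `Ω` satisfies the slice condition. -/
def SliceCondition {n : ℕ} (Ω : Set (Euc n)) : Prop :=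
  ∃ C : ℝ, 1 < C ∧ ∀ x₀ ∈ Ω, HasSliceProperty Ω C x₀

/-- `Ω` is LLC. -/
def IsLLC {n : ℕ} (Ω : Set (Euc n)) : Prop :=
  ∃ b : ℝ, 0 < b ∧ b ≤ 1 ∧ ∀ z : Euc n, ∀ r : ℝ, 0 < r →
    (∀ x ∈ Ω ∩ ball z r, ∀ y ∈ Ω ∩ ball z r, JoinedByCurveIn (Ω ∩ ball z (r / b)) x y) ∧
    (∀ x ∈ Ω \ ball z r, ∀ y ∈ Ω \ ball z r, JoinedByCurveIn (Ω \ ball z (b * r)) x y)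

/-- `Ω` is quasiconvex. -/
def IsQuasiconvex {n : ℕ} (Ω : Set (Euc n)) : Prop :=
  ∃ C : ℝ, 1 ≤ C ∧ ∀ x ∈ Ω, ∀ y ∈ Ω, ∃ γ : ℝ → Euc n,
    ContinuousOn γ (Icc 0 1) ∧ γ 0 = x ∧ γ 1 = y ∧ MapsTo γ (Icc 0 1) Ω ∧
    eVariationOn γ (Icc 0 1) ≤ ENNReal.ofReal (C * dist x y)

/-- The intrinsic (inner) metric of `Ω` (`∞` if there is no rectifiable curve). -/
def intrinsicDist {n : ℕ} (Ω : Set (Euc n)) (x y : Euc n) : ℝ≥0∞ :=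
  ⨅ (γ : ℝ → Euc n)
    (_ : ContinuousOn γ (Icc 0 1) ∧ γ 0 = x ∧ γ 1 = y ∧ MapsTo γ (Icc 0 1) Ω),
    eVariationOn γ (Icc 0 1)

/-- The intrinsic ball `B_Ω(x, r)`. -/
def intrinsicBall {n : ℕ} (Ω : Set (Euc n)) (x : Euc n) (r : ℝ) : Set (Euc n) :=
  {y ∈ Ω | intrinsicDist Ω x y < ENNReal.ofReal r}

/-- `Ω` is intrinsic Ahlfors `n`-regular. -/
def IntrinsicAhlforsRegular {n : ℕ} (Ω : Set (Euc n)) : Prop :=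
  ∃ c : ℝ, 0 < c ∧ c < 1 ∧ ∃ r₀ : ℝ, 0 < r₀ ∧ ∀ x ∈ Ω, ∀ r : ℝ, 0 < r → r < r₀ →
    ENNReal.ofReal c * volume (ball x r) ≤ volume (intrinsicBall Ω x r)

/-- `Ω` is a local Sobolev–Poincaré imbedding domain of order `p`, `1 ≤ p < n`. -/
def LocalSPLow (n : ℕ) (Ω : Set (Euc n)) (p : ℝ) : Prop :=
  ∃ C : ℝ, 1 ≤ C ∧ ∃ lam : ℝ, 1 ≤ lam ∧
    ∀ u : Euc n → ℝ, LocallyLipschitzOnSet u Ω →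
      ∀ x ∈ Ω, ∀ r : ℝ, 0 < r → r < diam Ω →
        (⨅ c : ℝ, (∫⁻ y in ball x r ∩ Ω,
            ENNReal.ofReal |u y - c| ^ ((n : ℝ) * p / ((n : ℝ) - p)) ∂volume)
              ^ (((n : ℝ) - p) / ((n : ℝ) * p)))
          ≤ ENNReal.ofReal C *
            (∫⁻ y in ball x (lam * r) ∩ Ω,
              ENNReal.ofReal ‖fderiv ℝ u y‖ ^ p ∂volume) ^ (1 / p)

/-- `Ω` is a local Sobolev–Poincaré imbedding domain of order `n`
(local Trudinger inequality). -/
def LocalSPn (n : ℕ) (Ω : Set (Euc n)) : Prop :=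
  ∃ C : ℝ, 1 ≤ C ∧ ∃ lam : ℝ, 1 ≤ lam ∧ ∃ A : ℝ, 0 < A ∧
    ∀ u : Euc n → ℝ, LocallyLipschitzOnSet u Ω →
      ∀ x ∈ Ω, ∀ r : ℝ, 0 < r → r < diam Ω →
        0 < (∫⁻ y in ball x (lam * r) ∩ Ω,
              ENNReal.ofReal ‖fderiv ℝ u y‖ ^ (n : ℝ) ∂volume) →
        (∫⁻ y in ball x (lam * r) ∩ Ω,
              ENNReal.ofReal ‖fderiv ℝ u y‖ ^ (n : ℝ) ∂volume) < ⊤ →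
        (⨅ c : ℝ, ∫⁻ y in ball x r ∩ Ω,
            ENNReal.ofReal (Real.exp ((A * |u y - c| /
              (∫⁻ z in ball x (lam * r) ∩ Ω,
                ENNReal.ofReal ‖fderiv ℝ u z‖ ^ (n : ℝ) ∂volume).toReal
                  ^ ((1 : ℝ) / (n : ℝ))) ^ ((n : ℝ) / ((n : ℝ) - 1)))) ∂volume)
          ≤ ENNReal.ofReal C * volume (ball x r)

/-- `Ω` is a local Sobolev–Poincaré imbedding domain of order `p`, `n < p < ∞`
(local Morrey inequality). -/
def LocalSPHigh (n : ℕ) (Ω : Set (Euc n)) (p : ℝ) : Prop :=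
  ∃ C : ℝ, 1 ≤ C ∧ ∃ lam : ℝ, 1 ≤ lam ∧
    ∀ u : Euc n → ℝ, LocallyLipschitzOnSet u Ω →
      ∀ x ∈ Ω, ∀ r : ℝ, 0 < r → r < diam Ω →
        ∀ x₁ ∈ ball x r ∩ Ω, ∀ x₂ ∈ ball x r ∩ Ω,
          ENNReal.ofReal |u x₁ - u x₂| ≤
            ENNReal.ofReal (C * dist x₁ x₂ ^ (1 - (n : ℝ) / p)) *
              (∫⁻ y in ball x (lam * r) ∩ Ω,
                ENNReal.ofReal ‖fderiv ℝ u y‖ ^ p ∂volume) ^ (1 / p)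

/-- `Ω` is a `p`-Poincaré domain. -/
def PoincareDomain (n : ℕ) (Ω : Set (Euc n)) (p : ℝ) : Prop :=
  ∃ C : ℝ, 1 ≤ C ∧ ∃ lam : ℝ, 1 ≤ lam ∧
    ∀ u : Euc n → ℝ, LocallyLipschitzOnSet u Ω →
      ∀ x ∈ Ω, ∀ r : ℝ, 0 < r → r < diam Ω →
        (volume (ball x r ∩ Ω))⁻¹ *
          (∫⁻ y in ball x r ∩ Ω,
            ENNReal.ofReal |u y - ⨍ z in ball x r ∩ Ω, u z ∂volume| ∂volume)
          ≤ ENNReal.ofReal (C * r) *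
            ((volume (ball x (lam * r) ∩ Ω))⁻¹ *
              ∫⁻ y in ball x (lam * r) ∩ Ω,
                ENNReal.ofReal ‖fderiv ℝ u y‖ ^ p ∂volume) ^ (1 / p)

lemma Complex.eq_zero_of_exp_eq_one {z : ℂ} (h : Complex.exp z = 1) (hz : ‖z‖ < 6) : z = 0 := by
  obtain ⟨n, rfl⟩ := Complex.exp_eq_one_iff.1 h
  have hpi := Real.pi_gt_three
  simp only [norm_mul, Complex.norm_intCast, Complex.norm_I, Complex.norm_real,
    Complex.norm_ofNat, Real.norm_eq_abs, abs_of_pos Real.pi_pos, mul_one] at hz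
  have : n = 0 := by
    by_contra hn
    have : (1 : ℝ) ≤ |(n : ℝ)| := by exact_mod_cast Int.one_le_abs hn
    nlinarith
  simp [this]

lemma IsPreconnected.eqOn_of_exp_eq_one {X : Type*} [TopologicalSpace X] {S : Set X}
    (hS : IsPreconnected S) {φ : X → ℂ} (hφ : ContinuousOn φ S)
    (h1 : ∀ x ∈ S, Complex.exp (φ x) = 1) {x y : X} (hx : x ∈ S) (hy : y ∈ S) : φ x = φ y := by
  refine hS.induction₂ (fun a b => φ a = φ b) (fun a ha => ?_) (fun _ _ _ _ _ _ => Eq.trans)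
    (fun _ _ _ _ => Eq.symm) hx hy
  have := (Metric.tendsto_nhds.1 (hφ a ha)) 6 (by norm_num)
  filter_upwards [this, self_mem_nhdsWithin] with b hb hbS
  have h0 : φ b - φ a = 0 := Complex.eq_zero_of_exp_eq_one
    (by rw [Complex.exp_sub, h1 b hbS, h1 a ha, div_one]) (by rwa [← dist_eq_norm])
  exact (sub_eq_zero.1 h0).symm

lemma IsOpen.frontier_connectedComponentIn_subset {X : Type*} [TopologicalSpace X]
    [LocallyConnectedSpace X] {U : Set X} (hU : IsOpen U) (x : X) :
    frontier (connectedComponentIn U x) ⊆ Uᶜ := by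
  intro a ha haU
  have hopen : IsOpen (connectedComponentIn U x) := hU.connectedComponentIn
  rw [hopen.frontier_eq] at ha
  obtain ⟨w, hw1, hw2⟩ := mem_closure_iff.1 ha.1 _ (hU.connectedComponentIn (x := a))
    (mem_connectedComponentIn haU)
  have e1 := connectedComponentIn_eq hw1
  have e2 := connectedComponentIn_eq hw2
  exact ha.2 (e2 ▸ e1 ▸ mem_connectedComponentIn haU)

lemma Complex.no_log_near_infinity (x : ℂ) {R : ℝ} (hR : 0 < R) (L : ℂ → ℂ) (hL : Continuous L)
    (h : ∀ a, ‖a - x‖ = R → Complex.exp (L a) = a - x) : False := by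
  set c : ℝ → ℂ := fun θ => x + R * Complex.exp (θ * Complex.I) with hc
  have hcn : ∀ θ, ‖c θ - x‖ = R := fun θ => by
    simp [hc, abs_of_pos hR, Complex.norm_exp_ofReal_mul_I]
  set φ : ℝ → ℂ := fun θ => L (c θ) - θ * Complex.I - Real.log R
  have hφ : Continuous φ := by fun_prop
  have h1 : ∀ θ ∈ (univ : Set ℝ), Complex.exp (φ θ) = 1 := by
    intro θ _
    simp only [φ]
    rw [Complex.exp_sub, Complex.exp_sub, h _ (hcn θ), ← Complex.ofReal_exp, Real.exp_log hR]
    have : (R : ℂ) ≠ 0 := by exact_mod_cast hR.ne'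
    simp only [hc, add_sub_cancel_left]
    rw [mul_div_assoc, div_self (Complex.exp_ne_zero _), mul_one, div_self this]
  have := isPreconnected_univ.eqOn_of_exp_eq_one hφ.continuousOn h1 (mem_univ 0)
    (mem_univ (2 * Real.pi))
  have hcc : c 0 = c (2 * Real.pi) := by
    simp [hc, Complex.exp_two_pi_mul_I]
  simp only [φ, hcc] at this
  have h3 : ((2 * Real.pi : ℝ) : ℂ) * Complex.I = 0 := by
    push_cast at this ⊢
    linear_combination this
  simp [Real.pi_ne_zero] at h3

/-- Borsuk's criterion: if `(a - x) / (a - y)` has a continuous logarithm on the closed set `F`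
with bounded complement, then `F` does not separate `x` from `y`. -/
lemma mem_connectedComponentIn_compl_of_log {F : Set ℂ} (hF : IsClosed F)
    (hb : Bornology.IsBounded Fᶜ) {x y : ℂ} (hx : x ∉ F) (hy : y ∉ F) {h : ℂ → ℂ}
    (hc : ContinuousOn h F) (he : ∀ a ∈ F, Complex.exp (h a) = (a - x) / (a - y)) :
    y ∈ connectedComponentIn Fᶜ x := by
  by_contra hyV
  set V := connectedComponentIn Fᶜ x with hV
  have hVo : IsOpen V := hF.isOpen_compl.connectedComponentIn
  have hxV : x ∈ V := mem_connectedComponentIn hx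
  have hfr : frontier V ⊆ F := by
    have := hF.isOpen_compl.frontier_connectedComponentIn_subset x
    rwa [compl_compl] at this
  obtain ⟨H, hH⟩ := ContinuousMap.exists_restrict_eq hF
    (⟨F.domRestrict h, continuousOn_iff_continuous_domRestrict.1 hc⟩ : C(F, ℂ))
  have hH' : ∀ a ∈ F, H a = h a := fun a ha => by
    have := congrArg (fun f : C(F, ℂ) => f ⟨a, ha⟩) hH
    simpa using this
  classical
  set g : ℂ → ℂ := fun a => if a ∈ V then (a - y) * Complex.exp (H a) else a - x with hg
  have hgc : Continuous g := by
    refine Continuous.if (fun a ha => ?_) (by fun_prop) (by fun_prop)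
    have haF := hfr ha
    rw [hH' a haF, he a haF, mul_div_cancel₀]
    exact sub_ne_zero.2 (fun e => hy (e ▸ haF))
  have hg0 : ∀ a, g a ≠ 0 := by
    intro a
    by_cases ha : a ∈ V
    · simp only [hg, ha, if_true]
      exact mul_ne_zero (sub_ne_zero.2 fun e => hyV (e ▸ ha)) (Complex.exp_ne_zero _)
    · simp only [hg, ha, if_false]
      exact sub_ne_zero.2 fun e => ha (e ▸ hxV)
  obtain ⟨L, hLc, hL⟩ := Complex.exists_continuousOn_eqOn_exp_comp (U := (univ : Set ℂ)) (g := g)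
    (by
      have : ContractibleSpace (univ : Set ℂ) := convex_univ.contractibleSpace univ_nonempty
      exact (inferInstance : SimplyConnectedSpace (univ : Set ℂ))) isOpen_univ hgc.continuousOn
    (by rintro ⟨a, -, ha⟩; exact hg0 a ha)
  obtain ⟨R, hR, hVR⟩ := (hb.subset (connectedComponentIn_subset _ _)).subset_ball_lt 0 x
  refine Complex.no_log_near_infinity x hR L (continuousOn_univ.1 hLc) (fun a ha => ?_)
  have haV : a ∉ V := fun h => by
    have := hVR h
    rw [mem_ball, dist_eq_norm] at this
    exact this.ne ha
  have := hL (mem_univ a)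
  simpa [hg, haV] using this

lemma Complex.norm_log_div_le_half {x a b : ℂ} (hx : 0 < ‖x - a‖) (h : 3 * ‖a - b‖ ≤ ‖x - a‖) :
    ‖Complex.log ((x - b) / (x - a))‖ ≤ 1 / 2 := by
  have hne : x - a ≠ 0 := norm_pos_iff.1 hx
  have e : (x - b) / (x - a) = 1 + (a - b) / (x - a) := by field_simp; ring
  have h1 : ‖(a - b) / (x - a)‖ ≤ 1 / 3 := by
    rw [norm_div, div_le_iff₀ hx]; linarith
  rw [e]
  have := Complex.norm_log_one_add_half_le_self (z := (a - b) / (x - a)) (by linarith)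
  linarith

lemma Complex.div_mem_slitPlane_of_norm_lt {x a b : ℂ} (h : ‖a - b‖ < ‖x - a‖) :
    (x - b) / (x - a) ∈ Complex.slitPlane := by
  have hx : 0 < ‖x - a‖ := (norm_nonneg _).trans_lt h
  have hne : x - a ≠ 0 := norm_pos_iff.1 hx
  have e : (x - b) / (x - a) = 1 + (a - b) / (x - a) := by field_simp; ring
  have h1 : ‖(a - b) / (x - a)‖ < 1 := by
    rwa [norm_div, div_lt_one hx]
  rw [e]
  exact Complex.mem_slitPlane_of_norm_lt_one h1

/-- Change of the increment of a logarithm between two nearby boundary points. -/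
lemma log_increment_eq {Ω Γ : Set ℂ} {x y a b : ℂ} {La Lb : ℂ → ℂ}
    (hLa : ContinuousOn La Ω) (hLb : ContinuousOn Lb Ω)
    (ha : ∀ w ∈ Ω, Complex.exp (La w) = w - a) (hb : ∀ w ∈ Ω, Complex.exp (Lb w) = w - b)
    (hΓ : IsPreconnected Γ) (hΓΩ : Γ ⊆ Ω) (hx : x ∈ Γ) (hy : y ∈ Γ)
    (hfar : ∀ w ∈ Γ, ‖a - b‖ < ‖w - a‖) :
    Lb x - Lb y = La x - La y + Complex.log ((x - b) / (x - a))
      - Complex.log ((y - b) / (y - a)) := by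
  have hslit : ∀ w ∈ Γ, (w - b) / (w - a) ∈ Complex.slitPlane := fun w hw =>
    Complex.div_mem_slitPlane_of_norm_lt (hfar w hw)
  have hne : ∀ w ∈ Γ, w - a ≠ 0 := fun w hw =>
    norm_pos_iff.1 ((norm_nonneg _).trans_lt (hfar w hw))
  have key := hΓ.eqOn_of_exp_eq_one
    (φ := fun w => Lb w - La w - Complex.log ((w - b) / (w - a)))
    (((hLb.mono hΓΩ).sub (hLa.mono hΓΩ)).sub (ContinuousOn.clog
      (ContinuousOn.div (by fun_prop) (by fun_prop) hne) hslit))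
    (fun w hw => by
      have h0 := Complex.slitPlane_ne_zero (hslit w hw)
      rw [Complex.exp_sub, Complex.exp_sub, Complex.exp_log h0, ha w (hΓΩ hw), hb w (hΓΩ hw),
        div_self h0]) hx hy
  linear_combination key

lemma log_increment_eq_of_far {Ω Γ : Set ℂ} {x y a : ℂ} {La : ℂ → ℂ}
    (hLa : ContinuousOn La Ω) (ha : ∀ w ∈ Ω, Complex.exp (La w) = w - a)
    (hΓ : IsPreconnected Γ) (hΓΩ : Γ ⊆ Ω) (hx : x ∈ Γ) (hy : y ∈ Γ)
    (hfar : ∀ w ∈ Γ, ‖w - y‖ < ‖y - a‖) :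
    La x - La y = Complex.log ((x - a) / (y - a)) := by
  have hya : y - a ≠ 0 := norm_pos_iff.1 ((norm_nonneg _).trans_lt (hfar y hy))
  have hslit : ∀ w ∈ Γ, (w - a) / (y - a) ∈ Complex.slitPlane := fun w hw => by
    have := Complex.div_mem_slitPlane_of_norm_lt (x := a) (a := y) (b := w)
      (by rw [norm_sub_rev y w, norm_sub_rev a y]; exact hfar w hw)
    rwa [← neg_sub w a, ← neg_sub y a, neg_div_neg_eq] at this
  have key := hΓ.eqOn_of_exp_eq_one
    (φ := fun w => La w - La y - Complex.log ((w - a) / (y - a)))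
    (((hLa.mono hΓΩ).sub continuousOn_const).sub (ContinuousOn.clog
      (by fun_prop) hslit))
    (fun w hw => by
      have h0 := Complex.slitPlane_ne_zero (hslit w hw)
      rw [Complex.exp_sub, Complex.exp_sub, Complex.exp_log h0, ha w (hΓΩ hw), ha y (hΓΩ hy),
        div_self h0]) hx hy
  simp only [div_self hya, Complex.log_one] at key
  linear_combination key

/-- In a planar open set carrying logarithms of `w - a`, two points joined away from every
complementary point, at relative scale `b`, are joined in the set of points whose distance to
the complement is controlled from below by the distance to the two points. -/
theorem mem_connectedComponentIn_cigar {Ω : Set ℂ} (hΩ : IsOpen Ω) (hne : Ωᶜ.Nonempty)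
    {x y : ℂ} (hx : x ∈ Ω) (hy : y ∈ Ω) {b R : ℝ} (hb : 0 < b) (hb1 : b ≤ 1)
    (hxy : ‖x - y‖ < R)
    (hlog : ∀ a ∉ Ω, ∃ L : ℂ → ℂ, ContinuousOn L Ω ∧ ∀ w ∈ Ω, Complex.exp (L w) = w - a)
    (hΓ : ∀ a ∉ Ω, ∃ Γ : Set ℂ, IsPreconnected Γ ∧ Γ ⊆ Ω ∧ x ∈ Γ ∧ y ∈ Γ ∧
      ∀ w ∈ Γ, b * min ‖x - a‖ ‖y - a‖ ≤ ‖w - a‖)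
    (hΓ' : ∃ Γ : Set ℂ, IsPreconnected Γ ∧ Γ ⊆ Ω ∧ x ∈ Γ ∧ y ∈ Γ ∧ ∀ w ∈ Γ, ‖w - x‖ < R) :
    y ∈ connectedComponentIn
      {w | b / 32 * min ‖x - w‖ ‖y - w‖ < infDist w Ωᶜ ∧ ‖w - x‖ < 8 * R} x := by
  set m : ℂ → ℝ := fun a => min ‖x - a‖ ‖y - a‖ with hm
  have hmc : Continuous m := by fun_prop
  have hm0 : ∀ a, 0 ≤ m a := fun a => le_min (norm_nonneg _) (norm_nonneg _)
  have hmx : ∀ a, m a ≤ ‖x - a‖ := fun a => min_le_left _ _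
  have hmy : ∀ a, m a ≤ ‖y - a‖ := fun a => min_le_right _ _
  have hmL : ∀ a a', m a ≤ m a' + ‖a - a'‖ := by
    intro a a'
    rw [← sub_le_iff_le_add]
    refine le_min ?_ ?_
    · have := norm_sub_le_norm_sub_add_norm_sub x a' a
      rw [norm_sub_rev a' a] at this
      linarith [hmx a]
    · have := norm_sub_le_norm_sub_add_norm_sub y a' a
      rw [norm_sub_rev a' a] at this
      linarith [hmy a]
  have hR : 0 < R := (norm_nonneg _).trans_lt hxy
  set F₁ : Set ℂ := {w | infDist w Ωᶜ ≤ b / 32 * m w}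
  set F₂ : Set ℂ := {w | 8 * R ≤ ‖w - x‖}
  have hF₁ : IsClosed F₁ := isClosed_le (continuous_infDist_pt _) (by fun_prop)
  have hF₂ : IsClosed F₂ := isClosed_le (by fun_prop) (by fun_prop)
  have hpos : ∀ w ∈ Ω, 0 < infDist w Ωᶜ := fun w hw =>
    (hΩ.isClosed_compl.notMem_iff_infDist_pos hne).1 (fun h => h hw)
  have hxF₁ : x ∉ F₁ := fun h => by
    have h1 : infDist x Ωᶜ ≤ b / 32 * m x := h
    have h2 : m x = 0 := le_antisymm ((hmx x).trans (by simp)) (hm0 x)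
    rw [h2, mul_zero] at h1
    exact absurd (hpos x hx) (not_lt.2 h1)
  have hyF₁ : y ∉ F₁ := fun h => by
    have h1 : infDist y Ωᶜ ≤ b / 32 * m y := h
    have h2 : m y = 0 := le_antisymm ((hmy y).trans (by simp)) (hm0 y)
    rw [h2, mul_zero] at h1
    exact absurd (hpos y hy) (not_lt.2 h1)
  have hxF₂ : x ∉ F₂ := fun h => by
    have h1 : 8 * R ≤ ‖x - x‖ := h
    simp at h1; linarith
  have hyF₂ : y ∉ F₂ := fun h => by
    have h1 : 8 * R ≤ ‖y - x‖ := h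
    rw [norm_sub_rev] at h1; linarith
  have hmpos : ∀ a ∈ F₁, 0 < m a := fun a ha => by
    refine lt_min (norm_pos_iff.2 (sub_ne_zero.2 ?_)) (norm_pos_iff.2 (sub_ne_zero.2 ?_))
    · rintro rfl; exact hxF₁ ha
    · rintro rfl; exact hyF₁ ha
  choose! L hLc hLe using hlog
  have hnear : ∀ a, ∃ a', a' ∉ Ω ∧ infDist a Ωᶜ = dist a a' := fun a =>
    hΩ.isClosed_compl.exists_infDist_eq_dist hne a
  choose P hPΩ hPd using hnear
  have hP : ∀ a ∈ F₁, ‖a - P a‖ ≤ b / 32 * m a := fun a ha => by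
    rw [← dist_eq_norm, ← hPd]; exact ha
  set lg : ℂ → ℂ → ℂ → ℂ := fun w u v => Complex.log ((w - u) / (w - v)) with hlg
  set H₁ : ℂ → ℂ := fun a => L (P a) x - L (P a) y + lg x a (P a) - lg y a (P a) with hH₁
  have hxP : ∀ a, x - P a ≠ 0 := fun a h => hPΩ a (by rwa [← sub_eq_zero.1 h])
  have hyP : ∀ a, y - P a ≠ 0 := fun a h => hPΩ a (by rwa [← sub_eq_zero.1 h])
  have hH₁e : ∀ a ∈ F₁, Complex.exp (H₁ a) = (a - x) / (a - y) := by
    intro a ha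
    have hxa : x - a ≠ 0 := norm_pos_iff.1 ((hmpos a ha).trans_le (hmx a))
    have hya : y - a ≠ 0 := norm_pos_iff.1 ((hmpos a ha).trans_le (hmy a))
    have h1 := hxP a
    have h2 := hyP a
    simp only [hH₁, hlg]
    rw [Complex.exp_sub, Complex.exp_add, Complex.exp_sub, hLe _ (hPΩ a) x hx,
      hLe _ (hPΩ a) y hy, Complex.exp_log (div_ne_zero hxa h1),
      Complex.exp_log (div_ne_zero hya h2), ← neg_sub x a, ← neg_sub y a, neg_div_neg_eq]
    field_simp
  have hH₁c : ContinuousOn H₁ F₁ := by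
    intro a ha
    have hma := hmpos a ha
    have hxa : x - a ≠ 0 := norm_pos_iff.1 (hma.trans_le (hmx a))
    have hya : y - a ≠ 0 := norm_pos_iff.1 (hma.trans_le (hmy a))
    have hev : ∀ᶠ a1 in nhdsWithin a F₁, H₁ a1 = H₁ a + lg x a1 a - lg y a1 a := by
      filter_upwards [self_mem_nhdsWithin,
        mem_nhdsWithin_of_mem_nhds (ball_mem_nhds a (show 0 < b / 32 * m a by positivity))]
        with a1 ha1 hd
      rw [mem_ball, dist_eq_norm] at hd
      have hbm : b * m a ≤ m a := by nlinarith
      have hm1 : m a1 ≤ 2 * m a := by linarith [hmL a1 a]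
      have hm1pos := hmpos a1 ha1
      have hbm1 : b * m a1 ≤ 2 * (b * m a) := by nlinarith
      have hPa := hP a ha
      have hPa1 := hP a1 ha1
      have hPP : ‖P a - P a1‖ ≤ b / 8 * m a := by
        have h1 := norm_sub_le_norm_sub_add_norm_sub (P a) a (P a1)
        have h2 := norm_sub_le_norm_sub_add_norm_sub a a1 (P a1)
        rw [norm_sub_rev (P a) a] at h1
        rw [norm_sub_rev a a1] at h2
        linarith
      have hmP : 31 / 32 * m a ≤ m (P a) := by
        have := hmL a (P a)
        linarith
      have hmP1 : 3 / 4 * m a ≤ m (P a1) := by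
        have := hmL (P a) (P a1)
        linarith
      have hm1' : 31 / 32 * m a ≤ m a1 := by
        have := hmL a a1
        rw [norm_sub_rev] at this
        linarith
      obtain ⟨Γ, hΓ1, hΓ2, hΓ3, hΓ4, hΓ5⟩ := hΓ (P a) (hPΩ a)
      have hbmP : b * (31 / 32 * m a) ≤ b * m (P a) := mul_le_mul_of_nonneg_left hmP hb.le
      have hinc := log_increment_eq (hLc _ (hPΩ a)) (hLc _ (hPΩ a1)) (hLe _ (hPΩ a))
        (hLe _ (hPΩ a1)) hΓ1 hΓ2 hΓ3 hΓ4 (fun w hw => lt_of_lt_of_le (by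
          have : 0 < b * m a := by positivity
          change _ < b * m (P a)
          linarith) (hΓ5 w hw))
      have bd : ∀ u v, 0 < m v → 3 * ‖v - u‖ ≤ m v → ‖lg x u v‖ ≤ 1 / 2 ∧ ‖lg y u v‖ ≤ 1 / 2 :=
        fun u v hv h => ⟨Complex.norm_log_div_le_half (hv.trans_le (hmx v)) (h.trans (hmx v)),
          Complex.norm_log_div_le_half (hv.trans_le (hmy v)) (h.trans (hmy v))⟩
      obtain ⟨b1, b2⟩ := bd (P a1) (P a) (by linarith) (by linarith)
      obtain ⟨b3, b4⟩ := bd a1 (P a1) (by linarith) (by rw [norm_sub_rev]; linarith)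
      obtain ⟨b5, b6⟩ := bd a (P a) (by linarith) (by rw [norm_sub_rev]; linarith)
      obtain ⟨b7, b8⟩ := bd a1 a hma (by rw [norm_sub_rev]; linarith)
      have hH : H₁ a1 - (H₁ a + lg x a1 a - lg y a1 a) =
          (lg x (P a1) (P a) - lg y (P a1) (P a)) + (lg x a1 (P a1) - lg y a1 (P a1))
          - (lg x a (P a) - lg y a (P a)) - (lg x a1 a - lg y a1 a) := by
        simp only [hH₁, hlg] at hinc ⊢
        rw [hinc]; ring
      refine sub_eq_zero.1 (Complex.eq_zero_of_exp_eq_one ?_ ?_)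
      · have hxa1 : x - a1 ≠ 0 := norm_pos_iff.1 (hm1pos.trans_le (hmx a1))
        have hya1 : y - a1 ≠ 0 := norm_pos_iff.1 (hm1pos.trans_le (hmy a1))
        rw [Complex.exp_sub (H₁ a1), Complex.exp_sub (H₁ a + lg x a1 a), Complex.exp_add (H₁ a),
          hH₁e a1 ha1, hH₁e a ha,
          Complex.exp_log (div_ne_zero hxa1 hxa), Complex.exp_log (div_ne_zero hya1 hya),
          ← neg_sub x a, ← neg_sub y a, neg_div_neg_eq, ← neg_sub x a1, ← neg_sub y a1,
          neg_div_neg_eq]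
        field_simp
      · rw [hH]
        have e1 := norm_sub_le (lg x (P a1) (P a)) (lg y (P a1) (P a))
        have e2 := norm_sub_le (lg x a1 (P a1)) (lg y a1 (P a1))
        have e3 := norm_sub_le (lg x a (P a)) (lg y a (P a))
        have e4 := norm_sub_le (lg x a1 a) (lg y a1 a)
        refine lt_of_le_of_lt (norm_sub_le _ _) ?_
        have e5 := norm_sub_le ((lg x (P a1) (P a) - lg y (P a1) (P a)) +
          (lg x a1 (P a1) - lg y a1 (P a1))) (lg x a (P a) - lg y a (P a))
        have e6 := norm_add_le (lg x (P a1) (P a) - lg y (P a1) (P a))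
          (lg x a1 (P a1) - lg y a1 (P a1))
        linarith
    have hca : ContinuousAt (fun a1 => H₁ a + lg x a1 a - lg y a1 a) a := by
      have h1 : ContinuousAt (fun a1 => lg x a1 a) a :=
        ContinuousAt.clog (by fun_prop) (by rw [div_self hxa]; exact Complex.one_mem_slitPlane)
      have h2 : ContinuousAt (fun a1 => lg y a1 a) a :=
        ContinuousAt.clog (by fun_prop) (by rw [div_self hya]; exact Complex.one_mem_slitPlane)
      exact (continuousAt_const.add h1).sub h2
    refine (hca.continuousWithinAt).congr_of_eventuallyEq hev ?_
    simp [hlg]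
  set H₂ : ℂ → ℂ := fun a => Complex.log ((x - a) / (y - a)) with hH₂
  have hyF₂' : ∀ a ∈ F₂, 7 * R ≤ ‖y - a‖ := fun a ha => by
    have h1 : 8 * R ≤ ‖a - x‖ := ha
    have := norm_sub_le_norm_sub_add_norm_sub a y x
    rw [norm_sub_rev y x, norm_sub_rev a y] at this
    linarith
  have hslit₂ : ∀ a, ‖x - y‖ < ‖y - a‖ → (x - a) / (y - a) ∈ Complex.slitPlane := fun a ha => by
    have := Complex.div_mem_slitPlane_of_norm_lt (x := a) (a := y) (b := x)
      (by rwa [norm_sub_rev y x, norm_sub_rev a y])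
    rwa [← neg_sub x a, ← neg_sub y a, neg_div_neg_eq] at this
  have hbd₂ : ∀ a, 3 * R ≤ ‖y - a‖ → ‖Complex.log ((x - a) / (y - a))‖ ≤ 1 / 2 := fun a ha => by
    have := Complex.norm_log_div_le_half (x := a) (a := y) (b := x)
      (by rw [norm_sub_rev]; linarith) (by rw [norm_sub_rev y x, norm_sub_rev a y]; linarith)
    rwa [← neg_sub x a, ← neg_sub y a, neg_div_neg_eq] at this
  have hH₂c : ContinuousOn H₂ F₂ := by
    refine ContinuousOn.clog (ContinuousOn.div (by fun_prop) (by fun_prop) fun a ha => ?_)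
      fun a ha => hslit₂ a (by linarith [hyF₂' a ha])
    exact norm_pos_iff.1 (by linarith [hyF₂' a ha])
  have hH₂e : ∀ a ∈ F₂, Complex.exp (H₂ a) = (a - x) / (a - y) := fun a ha => by
    simp only [hH₂]
    rw [Complex.exp_log (Complex.slitPlane_ne_zero (hslit₂ a (by linarith [hyF₂' a ha]))),
      ← neg_sub x a, ← neg_sub y a, neg_div_neg_eq]
  have hagree : ∀ a ∈ F₁, a ∈ F₂ → H₁ a = H₂ a := by
    intro a ha ha2
    obtain ⟨Γ, hΓ1, hΓ2, hΓ3, hΓ4, hΓ5⟩ := hΓ'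
    have hma := hmpos a ha
    have hPa := hP a ha
    have hbm : b * m a ≤ m a := by nlinarith
    have hya := hyF₂' a ha2
    have hyPa : 6 * R ≤ ‖y - P a‖ := by
      have h1 := norm_sub_le_norm_sub_add_norm_sub y (P a) a
      rw [norm_sub_rev (P a) a] at h1
      have := hmy a
      linarith
    have hinc := log_increment_eq_of_far (hLc _ (hPΩ a)) (hLe _ (hPΩ a)) hΓ1 hΓ2 hΓ3 hΓ4
      (fun w hw => by
        have h1 := norm_sub_le_norm_sub_add_norm_sub w x y
        linarith [hΓ5 w hw])
    refine sub_eq_zero.1 (Complex.eq_zero_of_exp_eq_one ?_ ?_)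
    · have hxa' : a - x ≠ 0 := norm_pos_iff.1 (by
        have : 8 * R ≤ ‖a - x‖ := ha2
        linarith)
      have hya' : a - y ≠ 0 := norm_pos_iff.1 (by rw [norm_sub_rev]; linarith)
      rw [Complex.exp_sub, hH₁e a ha, hH₂e a ha2, div_self (div_ne_zero hxa' hya')]
    · have c1 := hbd₂ (P a) (by linarith)
      have c2 := hbd₂ a (by linarith)
      have hmP : 31 / 32 * m a ≤ m (P a) := by
        have := hmL a (P a)
        linarith
      have c3 : ‖lg x a (P a)‖ ≤ 1 / 2 := Complex.norm_log_div_le_half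
        (lt_of_lt_of_le (by linarith) (hmx _))
        (le_trans (by rw [norm_sub_rev]; linarith) (hmx (P a)))
      have c4 : ‖lg y a (P a)‖ ≤ 1 / 2 := Complex.norm_log_div_le_half
        (lt_of_lt_of_le (by linarith) (hmy _))
        (le_trans (by rw [norm_sub_rev]; linarith) (hmy (P a)))
      simp only [hH₁, hH₂]
      rw [hinc]
      have e1 := norm_sub_le (Complex.log ((x - P a) / (y - P a)) + lg x a (P a) - lg y a (P a))
        (Complex.log ((x - a) / (y - a)))
      have e2 := norm_sub_le (Complex.log ((x - P a) / (y - P a)) + lg x a (P a)) (lg y a (P a))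
      have e3 := norm_add_le (Complex.log ((x - P a) / (y - P a))) (lg x a (P a))
      linarith
  classical
  set h : ℂ → ℂ := fun a => if a ∈ F₁ then H₁ a else H₂ a with hh
  have h1 : EqOn h H₁ F₁ := fun a ha => by simp [hh, ha]
  have h2 : EqOn h H₂ F₂ := fun a ha => by
    by_cases haF : a ∈ F₁
    · simp only [hh, haF, if_true]; exact hagree a haF ha
    · simp [hh, haF]
  have hcont : ContinuousOn h (F₁ ∪ F₂) :=
    (hH₁c.congr h1).union_of_isClosed (hH₂c.congr h2) hF₁ hF₂
  have hexp : ∀ a ∈ F₁ ∪ F₂, Complex.exp (h a) = (a - x) / (a - y) := by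
    rintro a (ha | ha)
    · rw [h1 ha]; exact hH₁e a ha
    · rw [h2 ha]; exact hH₂e a ha
  have hcompl : (F₁ ∪ F₂)ᶜ =
      {w | b / 32 * min ‖x - w‖ ‖y - w‖ < infDist w Ωᶜ ∧ ‖w - x‖ < 8 * R} := by
    ext w
    simp only [F₁, F₂, mem_compl_iff, mem_union, mem_ofPred_eq, not_or, not_le, hm]
  rw [← hcompl]
  refine mem_connectedComponentIn_compl_of_log (hF₁.union hF₂) ?_
    (by rintro (h | h); exacts [hxF₁ h, hxF₂ h]) (by rintro (h | h); exacts [hyF₁ h, hyF₂ h])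
    hcont hexp
  refine isBounded_ball (x := x) (r := 8 * R) |>.subset fun w hw => ?_
  rw [hcompl] at hw
  rw [mem_ball, dist_eq_norm]
  exact hw.2

section Cutoff

variable {n : ℕ} {Ω V : Set (Euc n)} {ψ : Euc n → ℝ} {K : ℝ≥0}

lemma lipschitzOnWith_indicator_of_frontier (hV : IsOpen V) (hψ : LipschitzWith K ψ)
    (h0 : ∀ w ∈ frontier V ∩ Ω, ψ w = 0) {s : Set (Euc n)} (hs : Convex ℝ s) (hsΩ : s ⊆ Ω) :
    LipschitzOnWith K (V.indicator ψ) s := by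
  have key : ∀ a ∈ s, ∀ b ∈ s, a ∈ V → b ∉ V → |ψ a| ≤ K * dist a b := by
    intro a ha b hb haV hbV
    have hseg : segment ℝ a b ⊆ s := hs.segment_subset ha hb
    obtain ⟨c, hc, hcV⟩ : ∃ c ∈ segment ℝ a b, c ∈ frontier V := by
      by_contra! hcon
      refine hbV ((convex_segment a b).isPreconnected.subset_of_closure_inter_subset hV
        ⟨a, left_mem_segment ℝ a b, haV⟩ (fun c hc => ?_) (right_mem_segment ℝ a b))
      by_contra hcV
      exact hcon c hc.2 (hV.frontier_eq ▸ ⟨hc.1, hcV⟩)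
    have h1 := hψ.dist_le_mul a c
    rw [h0 c ⟨hcV, hsΩ (hseg hc)⟩, Real.dist_eq, sub_zero] at h1
    refine h1.trans (mul_le_mul_of_nonneg_left ?_ K.2)
    have := dist_add_dist_of_mem_segment hc
    linarith [dist_nonneg (x := c) (y := b)]
  refine LipschitzOnWith.of_dist_le_mul fun a ha b hb => ?_
  rw [Real.dist_eq]
  by_cases haV : a ∈ V <;> by_cases hbV : b ∈ V
  · rw [indicator_of_mem haV, indicator_of_mem hbV]; exact hψ.dist_le_mul a b
  · rw [indicator_of_mem haV, indicator_of_notMem hbV, sub_zero]; exact key a ha b hb haV hbV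
  · rw [indicator_of_notMem haV, indicator_of_mem hbV, zero_sub, abs_neg, dist_comm]
    exact key b hb a ha hbV haV
  · rw [indicator_of_notMem haV, indicator_of_notMem hbV, sub_zero, abs_zero]; positivity

lemma locallyLipschitzOnSet_indicator (hΩ : IsOpen Ω) (hV : IsOpen V) (hψ : LipschitzWith K ψ)
    (h0 : ∀ w ∈ frontier V ∩ Ω, ψ w = 0) : LocallyLipschitzOnSet (V.indicator ψ) Ω := by
  intro x hx
  obtain ⟨ρ, hρ, hb⟩ := Metric.isOpen_iff.1 hΩ x hx
  exact ⟨K, ball x ρ, mem_nhdsWithin_of_mem_nhds (ball_mem_nhds x hρ),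
    lipschitzOnWith_indicator_of_frontier hV hψ h0 (convex_ball x ρ) hb⟩

lemma norm_fderiv_indicator_le (hΩ : IsOpen Ω) (hV : IsOpen V) (hψ : LipschitzWith K ψ)
    (h0 : ∀ w ∈ frontier V ∩ Ω, ψ w = 0) {x : Euc n} (hx : x ∈ Ω) :
    ‖fderiv ℝ (V.indicator ψ) x‖ ≤ K := by
  obtain ⟨ρ, hρ, hb⟩ := Metric.isOpen_iff.1 hΩ x hx
  exact norm_fderiv_le_of_lipschitzOn ℝ (ball_mem_nhds x hρ)
    (lipschitzOnWith_indicator_of_frontier hV hψ h0 (convex_ball x ρ) hb)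

lemma fderiv_indicator_eq_zero (hV : IsOpen V) {x : Euc n} (hx : x ∉ frontier V)
    {c : ℝ} (hψ : x ∈ V → ∀ᶠ w in nhds x, ψ w = c) : fderiv ℝ (V.indicator ψ) x = 0 := by
  by_cases hxV : x ∈ V
  · have : V.indicator ψ =ᶠ[nhds x] fun _ => c := by
      filter_upwards [hV.mem_nhds hxV, hψ hxV] with w hw hw2
      rw [indicator_of_mem hw, hw2]
    rw [this.fderiv_eq, fderiv_fun_const]; rfl
  · have hxc : x ∉ closure V := fun h => hx (hV.frontier_eq ▸ ⟨h, hxV⟩)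
    have : V.indicator ψ =ᶠ[nhds x] fun _ => 0 := by
      filter_upwards [isClosed_closure.isOpen_compl.mem_nhds hxc] with w hw
      exact indicator_of_notMem (fun h => hw (subset_closure h)) _
    rw [this.fderiv_eq, fderiv_fun_const]; rfl

end Cutoff

/-- Piecewise linear ramp of the distance to `a`: equal to `0` up to distance `s` and to `1`
from distance `2 * s` on. -/
def ramp {n : ℕ} (a : Euc n) (s : ℝ) (w : Euc n) : ℝ := max 0 (min 1 (dist w a / s - 1))

lemma lipschitzWith_ramp {n : ℕ} (a : Euc n) {s : ℝ} (hs : 0 < s) :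
    LipschitzWith (Real.toNNReal (1 / s)) (ramp a s) := by
  refine LipschitzWith.const_max (LipschitzWith.const_min ?_ 1) 0
  refine LipschitzWith.of_dist_le_mul fun x y => ?_
  rw [Real.coe_toNNReal _ (by positivity), Real.dist_eq,
    show dist x a / s - 1 - (dist y a / s - 1) = 1 / s * (dist x a - dist y a) by ring, abs_mul,
    abs_of_pos (by positivity : 0 < 1 / s)]
  exact mul_le_mul_of_nonneg_left (by
    simpa [Real.dist_eq, dist_comm] using abs_dist_sub_le x y a) (by positivity)

lemma ramp_eq_zero {n : ℕ} {a w : Euc n} {s : ℝ} (hs : 0 < s) (h : dist w a ≤ s) :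
    ramp a s w = 0 := by
  refine max_eq_left ((min_le_right _ _).trans ?_)
  have := (div_le_one hs).2 h
  linarith

lemma ramp_eq_one {n : ℕ} {a w : Euc n} {s : ℝ} (hs : 0 < s) (h : 2 * s ≤ dist w a) :
    ramp a s w = 1 := by
  have : 2 ≤ dist w a / s := (le_div_iff₀ hs).2 h
  rw [ramp, min_eq_left (by linarith), max_eq_right zero_le_one]

section Capacity

variable {Ω : Set (Euc 2)} {p C lam : ℝ}

/-- The local Sobolev–Poincaré inequality of order `p` with given constants. -/
def SPWith (Ω : Set (Euc 2)) (p C lam : ℝ) : Prop :=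
  ∀ u : Euc 2 → ℝ, LocallyLipschitzOnSet u Ω →
    ∀ x ∈ Ω, ∀ r : ℝ, 0 < r → r < diam Ω →
      (⨅ c : ℝ, (∫⁻ y in ball x r ∩ Ω,
          ENNReal.ofReal |u y - c| ^ (2 * p / (2 - p)) ∂volume) ^ ((2 - p) / (2 * p)))
        ≤ ENNReal.ofReal C *
          (∫⁻ y in ball x (lam * r) ∩ Ω,
            ENNReal.ofReal ‖fderiv ℝ u y‖ ^ p ∂volume) ^ (1 / p)

lemma localSPLow_iff : LocalSPLow 2 Ω p ↔ ∃ C : ℝ, 1 ≤ C ∧ ∃ lam : ℝ, 1 ≤ lam ∧ SPWith Ω p C lam := by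
  simp only [LocalSPLow, SPWith, Nat.cast_ofNat]

lemma SPWith.capacity_le (h : SPWith Ω p C lam) (hΩ : IsOpen Ω) (hC : 1 ≤ C) (hp1 : 1 ≤ p)
    (hp2 : p < 2)
    {u : Euc 2 → ℝ} (hu : LocallyLipschitzOnSet u Ω) {x : Euc 2} (hx : x ∈ Ω) {r : ℝ}
    (hr : 0 < r) (hrd : r < diam Ω) {E₀ E₁ A : Set (Euc 2)} (hE₀m : MeasurableSet E₀)
    (hE₁m : MeasurableSet E₁)
    (hE₀ : E₀ ⊆ ball x r ∩ Ω) (hE₁ : E₁ ⊆ ball x r ∩ Ω) (hu₀ : ∀ w ∈ E₀, u w = 0)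
    (hu₁ : ∀ w ∈ E₁, u w = 1) {K : ℝ} (hK : ∀ w ∈ Ω, ‖fderiv ℝ u w‖ ≤ K)
    (hA : MeasurableSet A)
    (hA0 : ∀ w ∈ ball x (lam * r) ∩ Ω, w ∉ A → fderiv ℝ u w = 0) {α μ : ℝ} (hα : 0 ≤ α)
    (hAα : volume A ≤ ENNReal.ofReal α) (hμ : 0 ≤ μ) (hμ₀ : ENNReal.ofReal μ ≤ volume E₀)
    (hμ₁ : ENNReal.ofReal μ ≤ volume E₁) :
    μ ≤ ((2 * C * K) ^ p * α) ^ (2 / (2 - p)) := by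
  have hK0 : 0 ≤ K := (norm_nonneg _).trans (hK x hx)
  have hp0 : 0 < p := by linarith
  have h2p : 0 < 2 - p := by linarith
  set q := 2 * p / (2 - p) with hq
  have hq0 : 0 < q := by positivity
  have hqi : (2 - p) / (2 * p) = 1 / q := by rw [hq]; field_simp
  have hlow : ∀ c : ℝ, ENNReal.ofReal ((1 / 2) ^ q * μ) ≤
      ∫⁻ y in ball x r ∩ Ω, ENNReal.ofReal |u y - c| ^ q ∂volume := by
    intro c
    have aux : ∀ E : Set (Euc 2), MeasurableSet E → E ⊆ ball x r ∩ Ω →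
        ENNReal.ofReal μ ≤ volume E → (∀ w ∈ E, 1 / 2 ≤ |u w - c|) →
        ENNReal.ofReal ((1 / 2) ^ q * μ) ≤
          ∫⁻ y in ball x r ∩ Ω, ENNReal.ofReal |u y - c| ^ q ∂volume := by
      intro E hEm hE hμE hw
      calc ENNReal.ofReal ((1 / 2) ^ q * μ)
          = ENNReal.ofReal (1 / 2) ^ q * ENNReal.ofReal μ := by
            rw [ENNReal.ofReal_mul (by positivity), ENNReal.ofReal_rpow_of_nonneg (by norm_num) hq0.le]
        _ ≤ ENNReal.ofReal (1 / 2) ^ q * volume E := by gcongr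
        _ = ∫⁻ y in E, ENNReal.ofReal (1 / 2) ^ q ∂volume := by rw [setLIntegral_const]
        _ ≤ ∫⁻ y in E, ENNReal.ofReal |u y - c| ^ q ∂volume :=
            setLIntegral_mono' hEm fun y hy => by
              gcongr; exact hw y hy
        _ ≤ _ := lintegral_mono_set hE
    rcases le_total (1 / 2) c with hc | hc
    · refine aux E₀ hE₀m hE₀ hμ₀ fun w hw => ?_
      rw [hu₀ w hw, zero_sub, abs_neg]; exact hc.trans (le_abs_self c)
    · refine aux E₁ hE₁m hE₁ hμ₁ fun w hw => ?_
      rw [hu₁ w hw]; exact le_trans (by linarith) (le_abs_self _)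
  have hE : ∫⁻ y in ball x (lam * r) ∩ Ω, ENNReal.ofReal ‖fderiv ℝ u y‖ ^ p ∂volume ≤
      ENNReal.ofReal (K ^ p * α) := by
    calc ∫⁻ y in ball x (lam * r) ∩ Ω, ENNReal.ofReal ‖fderiv ℝ u y‖ ^ p ∂volume
        ≤ ∫⁻ y in ball x (lam * r) ∩ Ω, A.indicator (fun _ => ENNReal.ofReal K ^ p) y ∂volume := by
          refine setLIntegral_mono' (isOpen_ball.inter hΩ).measurableSet fun y hy => ?_
          by_cases hyA : y ∈ A
          · rw [indicator_of_mem hyA]; gcongr; exact hK y hy.2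
          · rw [indicator_of_notMem hyA, hA0 y hy hyA]; simp [hp0]
      _ ≤ ∫⁻ y, A.indicator (fun _ => ENNReal.ofReal K ^ p) y ∂volume := setLIntegral_le_lintegral _ _
      _ = ENNReal.ofReal K ^ p * volume A := by rw [lintegral_indicator hA, setLIntegral_const]
      _ ≤ ENNReal.ofReal K ^ p * ENNReal.ofReal α := by gcongr
      _ = _ := by
        rw [ENNReal.ofReal_rpow_of_nonneg hK0 hp0.le, ENNReal.ofReal_mul (by positivity)]
  have h1 : ENNReal.ofReal ((1 / 2) ^ q * μ) ^ (1 / q) ≤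
      ENNReal.ofReal C * ENNReal.ofReal (K ^ p * α) ^ (1 / p) := by
    refine le_trans ?_ ((h u hu x hx r hr hrd).trans (by gcongr))
    rw [hqi]
    exact le_iInf fun c => by gcongr; exact hlow c
  rw [ENNReal.ofReal_rpow_of_nonneg (by positivity) (by positivity),
    ENNReal.ofReal_rpow_of_nonneg (by positivity) (by positivity),
    ← ENNReal.ofReal_mul (by linarith), ENNReal.ofReal_le_ofReal_iff (by positivity)] at h1
  have h2 := Real.rpow_le_rpow (by positivity) h1 hq0.le
  rw [← Real.rpow_mul (by positivity), one_div_mul_cancel hq0.ne', Real.rpow_one,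
    Real.mul_rpow (by linarith) (by positivity), ← Real.rpow_mul (by positivity)] at h2
  have h3 : μ = 2 ^ q * ((1 / 2) ^ q * μ) := by
    rw [← mul_assoc, ← Real.mul_rpow (by norm_num) (by norm_num)]; norm_num
  have hpq : 1 / p * q = 2 / (2 - p) := by rw [hq]; field_simp
  have hpq' : q = p * (2 / (2 - p)) := by rw [hq]; field_simp
  rw [h3]
  refine (mul_le_mul_of_nonneg_left h2 (by positivity)).trans (le_of_eq ?_)
  have hpow : ∀ z : ℝ, 0 ≤ z → (z ^ p) ^ (2 / (2 - p)) = z ^ q := fun z hz => by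
    rw [← Real.rpow_mul hz, ← hpq']
  rw [hpq, Real.mul_rpow (by positivity) hα, Real.mul_rpow (by positivity) hα,
    Real.mul_rpow (by positivity) hK0, Real.mul_rpow (by positivity) (by positivity),
    Real.mul_rpow (by norm_num) (by linarith), Real.mul_rpow (by positivity) (by positivity),
    hpow _ hK0, hpow _ zero_le_two, hpow _ (by linarith)]
  ring

end Capacity

lemma lipschitzWith_one_sub_ramp {n : ℕ} (a : Euc n) {s : ℝ} (hs : 0 < s) :
    LipschitzWith (Real.toNNReal (1 / s)) fun w => 1 - ramp a s w :=
  LipschitzWith.of_dist_le_mul fun x y => by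
    rw [dist_sub_left]; exact (lipschitzWith_ramp a hs).dist_le_mul x y

lemma subset_ball_diam {Ω : Set (Euc 2)} (hΩ : IsOpen Ω) (hb : Bornology.IsBounded Ω)
    {x : Euc 2} (hx : x ∈ Ω) : Ω ⊆ ball x (diam Ω) := by
  intro w hw
  obtain ⟨ρ, hρ, hbρ⟩ := Metric.isOpen_iff.1 hΩ w hw
  by_cases hwx : w = x
  · subst hwx
    rw [mem_ball, dist_self]
    have : (w + (ρ / 2) • (EuclideanSpace.single 0 1 : Euc 2)) ∈ Ω := hbρ (by
      rw [mem_ball, dist_eq_norm, add_sub_cancel_left, norm_smul, PiLp.norm_single]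
      simpa [abs_of_pos hρ] using hρ)
    refine lt_of_lt_of_le ?_ (dist_le_diam_of_mem hb this hw)
    rw [dist_eq_norm, add_sub_cancel_left, norm_smul, PiLp.norm_single]
    simp [hρ.ne']
  · have hd : 0 < dist w x := dist_pos.2 hwx
    set t := ρ / (2 * dist w x)
    have ht : 0 < t := by positivity
    have hmem : w + t • (w - x) ∈ Ω := hbρ (by
      rw [mem_ball, dist_eq_norm, add_sub_cancel_left, norm_smul, ← dist_eq_norm,
        Real.norm_of_nonneg ht.le]
      simp only [t]
      field_simp
      norm_num)
    refine lt_of_lt_of_le ?_ (dist_le_diam_of_mem hb hmem hx)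
    rw [dist_eq_norm (w + t • (w - x)), show w + t • (w - x) - x = (1 + t) • (w - x) by module,
      norm_smul, ← dist_eq_norm, Real.norm_of_nonneg (by positivity)]
    nlinarith

lemma exists_radius_lt_measure {Ω E : Set (Euc 2)} (hΩ : IsOpen Ω) (hb : Bornology.IsBounded Ω)
    {x : Euc 2} (hx : x ∈ Ω) (hE : MeasurableSet E) (hEΩ : E ⊆ Ω) {μ : ℝ≥0∞}
    (h : μ < volume E) : ∃ r, 0 < r ∧ r < diam Ω ∧ μ < volume (E ∩ ball x r) := by
  obtain ⟨k, hkE, hk, hμ⟩ := hE.exists_lt_isCompact h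
  have hdiam : 0 < diam Ω := by
    have := subset_ball_diam hΩ hb hx hx
    rwa [mem_ball, dist_self] at this
  obtain ⟨r, hr, hkr⟩ := exists_pos_lt_subset_ball hdiam hk.isClosed
    ((hkE.trans hEΩ).trans (subset_ball_diam hΩ hb hx))
  exact ⟨r, hr.1, hr.2, hμ.trans_le (measure_mono (subset_inter hkE hkr))⟩

lemma volume_ball_inter_ne_top {Ω : Set (Euc 2)} (x : Euc 2) (r : ℝ) :
    volume (ball x r ∩ Ω) ≠ ∞ :=
  ((measure_mono inter_subset_left).trans_lt measure_ball_lt_top).ne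

section

variable {Ω : Set (Euc 2)} {p C lam : ℝ}

lemma SPWith.capacity_le_of_subset (h : SPWith Ω p C lam) (hΩ : IsOpen Ω)
    (hb : Bornology.IsBounded Ω) (hC : 1 ≤ C) (hp1 : 1 ≤ p) (hp2 : p < 2)
    {u : Euc 2 → ℝ} (hu : LocallyLipschitzOnSet u Ω) {x : Euc 2} (hx : x ∈ Ω)
    {E₀ E₁ A : Set (Euc 2)} (hE₀m : MeasurableSet E₀) (hE₁m : MeasurableSet E₁)
    (hE₀ : E₀ ⊆ Ω) (hE₁ : E₁ ⊆ Ω) (hu₀ : ∀ w ∈ E₀, u w = 0)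
    (hu₁ : ∀ w ∈ E₁, u w = 1) {K : ℝ} (hK : ∀ w ∈ Ω, ‖fderiv ℝ u w‖ ≤ K)
    (hA : MeasurableSet A) (hA0 : ∀ w ∈ Ω, w ∉ A → fderiv ℝ u w = 0) {α μ : ℝ} (hα : 0 ≤ α)
    (hAα : volume A ≤ ENNReal.ofReal α) (hμ₀ : ENNReal.ofReal μ ≤ volume E₀)
    (hμ₁ : ENNReal.ofReal μ ≤ volume E₁) :
    μ ≤ ((2 * C * K) ^ p * α) ^ (2 / (2 - p)) := by
  have hK0 : 0 ≤ K := (norm_nonneg _).trans (hK x hx)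
  refine le_of_forall_lt fun μ' hμ' => ?_
  rcases lt_or_ge μ' 0 with h0 | h0
  · exact h0.trans_le (by positivity)
  have hlt : ENNReal.ofReal ((μ + μ') / 2) < ENNReal.ofReal μ :=
    (ENNReal.ofReal_lt_ofReal_iff (by linarith)).2 (by linarith)
  obtain ⟨r₀, h00, h01, h02⟩ := exists_radius_lt_measure hΩ hb hx hE₀m hE₀ (hlt.trans_le hμ₀)
  obtain ⟨r₁, h10, h11, h12⟩ := exists_radius_lt_measure hΩ hb hx hE₁m hE₁ (hlt.trans_le hμ₁)
  refine lt_of_lt_of_le (show μ' < (μ + μ') / 2 by linarith) ?_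
  refine h.capacity_le hΩ hC hp1 hp2 hu hx (r := max r₀ r₁) (lt_max_of_lt_left h00) (max_lt h01 h11)
    (E₀ := E₀ ∩ ball x r₀) (E₁ := E₁ ∩ ball x r₁) (hE₀m.inter measurableSet_ball)
    (hE₁m.inter measurableSet_ball)
    (fun w hw => ⟨ball_subset_ball (le_max_left _ _) hw.2, hE₀ hw.1⟩)
    (fun w hw => ⟨ball_subset_ball (le_max_right _ _) hw.2, hE₁ hw.1⟩)
    (fun w hw => hu₀ w hw.1) (fun w hw => hu₁ w hw.1) hK hA (fun w hw => hA0 w hw.2) hα hAα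
    (by linarith) h02.le h12.le

lemma SPWith.llc₁ (h : SPWith Ω p C lam) (hΩ : IsOpen Ω) (hconn : IsConnected Ω)
    (hb : Bornology.IsBounded Ω) (hC : 1 ≤ C) (hlam : 1 ≤ lam) (hp1 : 1 ≤ p) (hp2 : p < 2)
    {x y : Euc 2} (hx : x ∈ Ω) (hy : y ∈ Ω) (hxy : x ≠ y) :
    y ∈ connectedComponentIn (Ω ∩ ball x (4 * lam * dist x y)) x := by
  have hd : 0 < dist x y := dist_pos.2 hxy
  set U := Ω ∩ ball x (4 * lam * dist x y) with hU
  have hxU : x ∈ U := ⟨hx, by rw [mem_ball, dist_self]; positivity⟩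
  have hyU : y ∈ U := ⟨hy, by rw [mem_ball, dist_comm]; nlinarith⟩
  rcases le_or_gt (diam Ω) (2 * dist x y) with hdiam | hdiam
  · have : U = Ω := inter_eq_left.2 fun w hw => by
      rw [mem_ball]
      have := dist_le_diam_of_mem hb hw hx
      nlinarith
    rw [this]
    exact hconn.isPreconnected.subset_connectedComponentIn hx subset_rfl hy
  by_contra hyV
  set V := connectedComponentIn U x with hV
  have hUo : IsOpen U := hΩ.inter isOpen_ball
  have hVo : IsOpen V := hUo.connectedComponentIn
  have hVU : V ⊆ U := connectedComponentIn_subset U x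
  have hfr : frontier V ⊆ Uᶜ := hUo.frontier_connectedComponentIn_subset x
  have hs : 0 < 2 * lam * dist x y := by positivity
  set ψ := fun w => 1 - ramp x (2 * lam * dist x y) w with hψ
  have hL : LipschitzWith _ ψ := lipschitzWith_one_sub_ramp x hs
  have h0 : ∀ w ∈ frontier V ∩ Ω, ψ w = 0 := by
    rintro w ⟨hw, hwΩ⟩
    have : ¬ dist w x < 4 * lam * dist x y := fun hlt => hfr hw ⟨hwΩ, hlt⟩
    simp only [hψ]
    rw [ramp_eq_one hs (by linarith), sub_self]
  obtain ⟨ρ, hρ, hρV⟩ := Metric.isOpen_iff.1 hVo x (mem_connectedComponentIn hxU)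
  obtain ⟨ρ', hρ', hρV'⟩ : ∃ ρ' > 0, ball y ρ' ⊆ U \ V := by
    have hyc : y ∉ closure V := fun hc => hfr (hVo.frontier_eq ▸ ⟨hc, hyV⟩) hyU
    obtain ⟨ρ', h1, h2⟩ := Metric.isOpen_iff.1 (hUo.inter isClosed_closure.isOpen_compl) y
      ⟨hyU, hyc⟩
    exact ⟨ρ', h1, fun w hw => ⟨(h2 hw).1, fun hwV => (h2 hw).2 (subset_closure hwV)⟩⟩
  set τ := min (min ρ ρ') (dist x y / 2) with hτ
  have hτ0 : 0 < τ := by positivity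
  have hτd : τ ≤ dist x y / 2 := min_le_right _ _
  have hτρ : τ ≤ ρ := (min_le_left _ _).trans (min_le_left _ _)
  have hτρ' : τ ≤ ρ' := (min_le_left _ _).trans (min_le_right _ _)
  have hvol : ∀ z : Euc 2, ENNReal.ofReal (τ ^ 2 * Real.pi) ≤ volume (ball z τ) := fun z => by
    rw [EuclideanSpace.volume_ball_fin_two, ENNReal.ofReal_mul (by positivity),
      ENNReal.ofReal_pow hτ0.le]
  have hcap := h.capacity_le hΩ hC hp1 hp2 (locallyLipschitzOnSet_indicator hΩ hVo hL h0) hx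
    (r := 2 * dist x y) (by positivity) hdiam (E₀ := ball y τ) (E₁ := ball x τ) (A := ∅)
    measurableSet_ball measurableSet_ball
    (fun w hw => ⟨by
      rw [mem_ball] at hw ⊢
      have := dist_triangle w y x
      rw [dist_comm y x] at this; linarith, (hρV' (ball_subset_ball hτρ' hw)).1.1⟩)
    (fun w hw => ⟨by
      rw [mem_ball] at hw ⊢; linarith, (hVU (hρV (ball_subset_ball hτρ hw))).1⟩)
    (fun w hw => indicator_of_notMem (hρV' (ball_subset_ball hτρ' hw)).2 _)
    (fun w hw => by
      rw [indicator_of_mem (hρV (ball_subset_ball hτρ hw))]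
      simp only [hψ]
      rw [ramp_eq_zero hs, sub_zero]
      rw [mem_ball] at hw; nlinarith)
    (fun w hw => norm_fderiv_indicator_le hΩ hVo hL h0 hw) MeasurableSet.empty
    (fun w hw _ => by
      have hwd : dist w x < 2 * lam * dist x y := by
        have := hw.1; rw [mem_ball] at this; linarith
      refine fderiv_indicator_eq_zero hVo (c := 1) (fun hwf => hfr hwf ⟨hw.2, ?_⟩) fun _ => ?_
      · rw [mem_ball]; linarith
      · filter_upwards [isOpen_ball.mem_nhds (show w ∈ ball x (2 * lam * dist x y) from hwd)]
          with v hv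
        simp only [hψ]
        rw [ramp_eq_zero hs (le_of_lt hv), sub_zero])
    (α := 0) (μ := τ ^ 2 * Real.pi) le_rfl (by simp) (by positivity) (hvol y) (hvol x)
  have hpos : 0 < 2 / (2 - p) := div_pos two_pos (by linarith)
  rw [mul_zero, Real.zero_rpow hpos.ne'] at hcap
  have : 0 < τ ^ 2 * Real.pi := by positivity
  linarith

lemma ramp_energy_eq (hp2 : p < 2) {a B t : ℝ} (ha : 0 ≤ a) (hB : 0 ≤ B) (ht : 0 < t) :
    ((a / t) ^ p * (B * t ^ 2)) ^ (2 / (2 - p)) =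
      a ^ (p * (2 / (2 - p))) * B ^ (2 / (2 - p)) * t ^ 2 := by
  have h2p : 2 - p ≠ 0 := by linarith
  rw [Real.mul_rpow (by positivity) (by positivity), Real.mul_rpow hB (by positivity),
    ← Real.rpow_mul (by positivity), Real.div_rpow ha ht.le, ← Real.rpow_natCast t 2,
    ← Real.rpow_mul ht.le]
  have : t ^ (((2 : ℕ) : ℝ) * (2 / (2 - p))) = t ^ (p * (2 / (2 - p))) * t ^ ((2 : ℕ) : ℝ) := by
    rw [← Real.rpow_add ht]
    congr 1
    push_cast
    field_simp
    ring
  rw [this]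
  have := (Real.rpow_pos_of_pos ht (p * (2 / (2 - p)))).ne'
  field_simp

lemma SPWith.exists_volume_ge (h : SPWith Ω p C lam) (hΩ : IsOpen Ω)
    (hb : Bornology.IsBounded Ω) (hC : 1 ≤ C) (hp1 : 1 ≤ p) (hp2 : p < 2) :
    ∃ η > 0, ∀ x ∈ Ω, ∀ ρ, 0 < ρ → 4 * ρ < diam Ω →
      ENNReal.ofReal (η * ρ ^ 2) ≤ volume (ball x ρ ∩ Ω) := by
  have h2p : 0 < 2 - p := by linarith
  set σ := 2 / (2 - p) with hσ
  have hσ2 : 2 ≤ σ := by rw [hσ, le_div_iff₀ h2p]; linarith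
  set Q := (4 * C) ^ (p * σ) with hQ
  have hQ1 : 1 ≤ Q := Real.one_le_rpow (by linarith) (by nlinarith)
  set η := 1 / (8 * Q) with hη
  have hη0 : 0 < η := by positivity
  have hη1 : η ≤ 1 := by rw [hη, div_le_one (by positivity)]; linarith
  -- the measure decays too fast below a scale with small density
  have step : ∀ x ∈ Ω, ∀ z ∈ Ω, ∀ ρ s θ : ℝ, 0 < s → s ≤ ρ → 2 * ρ ≤ dist z x → 0 < θ → θ ≤ η →
      volume (ball x ρ ∩ Ω) ≤ volume (ball z ρ ∩ Ω) →
      volume (ball x s ∩ Ω) ≤ ENNReal.ofReal (θ * s ^ 2) →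
      volume (ball x (s / 2) ∩ Ω) ≤ ENNReal.ofReal (θ / 2 * (s / 2) ^ 2) := by
    intro x hx z hz ρ s θ hs hsρ hzx hθ hθη hle hvol
    have hs2 : 0 < s / 2 := by positivity
    set ψ := fun w => 1 - ramp x (s / 2) w with hψ
    have hL : LipschitzWith _ ψ := lipschitzWith_one_sub_ramp x hs2
    have h0 : ∀ w ∈ frontier (univ : Set (Euc 2)) ∩ Ω, ψ w = 0 := by simp
    set μ := (volume (ball x (s / 2) ∩ Ω)).toReal with hμ
    have hμe : ENNReal.ofReal μ = volume (ball x (s / 2) ∩ Ω) :=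
      ENNReal.ofReal_toReal (volume_ball_inter_ne_top _ _)
    have hcap := h.capacity_le_of_subset hΩ hb hC hp1 hp2
      (locallyLipschitzOnSet_indicator hΩ isOpen_univ hL h0) hx (E₀ := ball z ρ ∩ Ω)
      (E₁ := ball x (s / 2) ∩ Ω) (A := ball x s ∩ Ω)
      (isOpen_ball.inter hΩ).measurableSet (isOpen_ball.inter hΩ).measurableSet
      inter_subset_right inter_subset_right
      (fun w hw => by
        rw [indicator_univ]
        simp only [hψ]
        rw [ramp_eq_one hs2, sub_self]
        have h1 := hw.1
        rw [mem_ball] at h1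
        have := dist_triangle_left z x w
        linarith)
      (fun w hw => by
        rw [indicator_univ]
        simp only [hψ]
        rw [ramp_eq_zero hs2 (le_of_lt hw.1), sub_zero])
      (fun w hw => norm_fderiv_indicator_le hΩ isOpen_univ hL h0 hw)
      (isOpen_ball.inter hΩ).measurableSet
      (fun w hw hwA => by
        have hws : s ≤ dist w x := not_lt.1 fun hlt => hwA ⟨hlt, hw⟩
        rw [indicator_univ]
        refine IsLocalMin.fderiv_eq_zero (Filter.Eventually.of_forall fun v => ?_)
        simp only [hψ]
        rw [ramp_eq_one hs2 (by linarith), sub_self, sub_nonneg]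
        exact max_le zero_le_one (min_le_left _ _))
      (α := θ * s ^ 2) (μ := μ) (by positivity) hvol
      (hμe.le.trans ((measure_mono (inter_subset_inter_left _
        (ball_subset_ball (by linarith)))).trans hle)) hμe.le
    rw [← hμe]
    refine ENNReal.ofReal_le_ofReal (hcap.trans ?_)
    rw [Real.coe_toNNReal _ (by positivity),
      show 2 * C * (1 / (s / 2)) = 4 * C / s by field_simp; norm_num,
      ramp_energy_eq hp2 (by linarith) hθ.le hs, ← hσ, ← hQ]
    have h1 : θ ^ σ ≤ θ * η := by
      calc θ ^ σ ≤ θ ^ (2 : ℝ) := Real.rpow_le_rpow_of_exponent_ge hθ (hθη.trans hη1) hσ2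
        _ = θ * θ := by rw [Real.rpow_two, sq]
        _ ≤ θ * η := by gcongr
    have h2 : Q * η = 1 / 8 := by rw [hη]; field_simp
    calc Q * θ ^ σ * s ^ 2 ≤ Q * (θ * η) * s ^ 2 := by gcongr
      _ = θ * (Q * η) * s ^ 2 := by ring
      _ = θ / 2 * (s / 2) ^ 2 := by rw [h2]; ring
  have main : ∀ x ∈ Ω, ∀ z ∈ Ω, ∀ ρ : ℝ, 0 < ρ → 2 * ρ ≤ dist z x →
      volume (ball x ρ ∩ Ω) ≤ volume (ball z ρ ∩ Ω) →
      ENNReal.ofReal (η * ρ ^ 2) ≤ volume (ball x ρ ∩ Ω) := by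
    intro x hx z hz ρ hρ hzx hle
    by_contra! hlt
    have hind : ∀ j : ℕ, volume (ball x (ρ / 2 ^ j) ∩ Ω) ≤
        ENNReal.ofReal (η / 2 ^ j * (ρ / 2 ^ j) ^ 2) := by
      intro j
      induction j with
      | zero => simpa using hlt.le
      | succ j ih =>
        have := step x hx z hz ρ (ρ / 2 ^ j) (η / 2 ^ j) (by positivity)
          (div_le_self hρ.le (one_le_pow₀ one_le_two)) hzx (by positivity)
          (div_le_self hη0.le (one_le_pow₀ one_le_two)) hle ih
        rwa [div_div, div_div, ← pow_succ] at this
    obtain ⟨δ, hδ, hδΩ⟩ := Metric.isOpen_iff.1 hΩ x hx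
    obtain ⟨j, hj⟩ := exists_pow_lt_of_lt_one (show 0 < δ / ρ by positivity)
      (show (1 / 2 : ℝ) < 1 by norm_num)
    have hj' : ρ / 2 ^ j < δ := by
      rw [lt_div_iff₀ hρ] at hj
      calc ρ / 2 ^ j = (1 / 2) ^ j * ρ := by rw [one_div, inv_pow]; field_simp
        _ < δ := hj
    have h1 := hind j
    rw [inter_eq_left.2 ((ball_subset_ball hj'.le).trans hδΩ),
      EuclideanSpace.volume_ball_fin_two, ← ENNReal.ofReal_pow (by positivity),
      ← ENNReal.ofReal_mul (by positivity), ENNReal.ofReal_le_ofReal_iff (by positivity)] at h1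
    have h2 : 0 < (ρ / 2 ^ j) ^ 2 := by positivity
    have h3 : η / 2 ^ j ≤ 1 := (div_le_self hη0.le (one_le_pow₀ one_le_two)).trans hη1
    nlinarith [Real.pi_gt_three]
  refine ⟨η, hη0, fun x hx ρ hρ hρd => ?_⟩
  obtain ⟨z, hz, hzx⟩ : ∃ z ∈ Ω, 2 * ρ ≤ dist z x := by
    by_contra! hcon
    have : diam Ω ≤ 4 * ρ := diam_le_of_forall_dist_le (by positivity) fun a ha c hc => by
      have := dist_triangle_right a c x
      linarith [hcon a ha, hcon c hc]
    linarith
  rcases le_total (volume (ball x ρ ∩ Ω)) (volume (ball z ρ ∩ Ω)) with hle | hle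
  · exact main x hx z hz ρ hρ hzx hle
  · exact (main z hz x hx ρ hρ (by rwa [dist_comm]) hle).trans hle

lemma SPWith.llc₂ (h : SPWith Ω p C lam) (hΩ : IsOpen Ω) (hconn : IsConnected Ω)
    (hb : Bornology.IsBounded Ω) (hC : 1 ≤ C) (hlam : 1 ≤ lam) (hp1 : 1 ≤ p) (hp2 : p < 2) :
    ∃ b, 0 < b ∧ b ≤ 1 ∧ ∀ x ∈ Ω, ∀ y ∈ Ω, ∀ a ∉ Ω,
      y ∈ connectedComponentIn (Ω \ closedBall a (b * min (dist x a) (dist y a))) x := by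
  have h2p : 0 < 2 - p := by linarith
  obtain ⟨η, hη0, hη⟩ := h.exists_volume_ge hΩ hb hC hp1 hp2
  set σ := 2 / (2 - p) with hσ
  set Q := (2 * C) ^ (p * σ) * (4 * Real.pi) ^ σ with hQ
  have hQ0 : 0 < Q := by positivity
  set c := 1 / (8 * lam) with hc
  have hc0 : 0 < c := by positivity
  have hc8 : c ≤ 1 / 8 := one_div_le_one_div_of_le (by norm_num) (by linarith)
  set b := min (1 / 4) (η * c ^ 2 / (2 * Q)) with hbdef
  have hb0 : 0 < b := by positivity
  have hb4 : b ≤ 1 / 4 := min_le_left _ _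
  have hbQ : Q * b ^ 2 < η * c ^ 2 := by
    have h1 : b ≤ η * c ^ 2 / (2 * Q) := min_le_right _ _
    rw [le_div_iff₀ (by positivity)] at h1
    have h2 : Q * b * b ≤ Q * b * (1 / 4) := by gcongr
    have h3 : 0 < η * c ^ 2 := by positivity
    nlinarith
  refine ⟨b, hb0, by linarith, fun x hx y hy a ha => ?_⟩
  set m := min (dist x a) (dist y a) with hm
  have hm0 : 0 < m := lt_min (dist_pos.2 fun h => ha (h ▸ hx)) (dist_pos.2 fun h => ha (h ▸ hy))
  have hmx : m ≤ dist x a := min_le_left _ _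
  have hmy : m ≤ dist y a := min_le_right _ _
  set U := Ω \ closedBall a (b * m) with hU
  have hUo : IsOpen U := hΩ.sdiff isClosed_closedBall
  have hxU : x ∈ U := ⟨hx, by rw [mem_closedBall, not_le]; nlinarith⟩
  have hyU : y ∈ U := ⟨hy, by rw [mem_closedBall, not_le]; nlinarith⟩
  rcases le_or_gt (2 * diam Ω) m with hbig | hsmall
  · have : U = Ω := sdiff_eq_left.2 <| disjoint_left.2 fun w hw hwa => by
      rw [mem_closedBall] at hwa
      have h1 := dist_le_diam_of_mem hb hx hw
      have h2 := dist_triangle x w a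
      nlinarith
    rw [this]
    exact hconn.isPreconnected.subset_connectedComponentIn hx subset_rfl hy
  by_contra hyV
  set V := connectedComponentIn U x with hV
  have hVo : IsOpen V := hUo.connectedComponentIn
  have hVU : V ⊆ U := connectedComponentIn_subset U x
  have hfr : frontier V ⊆ Uᶜ := hUo.frontier_connectedComponentIn_subset x
  have hs : 0 < b * m := by positivity
  have hfr' : ∀ w ∈ frontier V, w ∈ Ω → dist w a ≤ b * m := fun w hw hwΩ => by
    by_contra! hlt
    exact hfr hw ⟨hwΩ, by rwa [mem_closedBall, not_le]⟩
  have hL : LipschitzWith _ (ramp a (b * m)) := lipschitzWith_ramp a hs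
  have h0 : ∀ w ∈ frontier V ∩ Ω, ramp a (b * m) w = 0 := fun w hw =>
    ramp_eq_zero hs (hfr' w hw.1 hw.2)
  have hfar : ∀ z ∈ Ω, m ≤ dist z a → ∀ w ∈ ball z (c * m) ∩ Ω,
      m / 2 ≤ dist w a ∧ w ∈ connectedComponentIn U z := by
    rintro z hz hmz w ⟨hw, hwΩ⟩
    rw [mem_ball] at hw
    have hlw : 4 * lam * dist z w ≤ m / 2 := by
      have : 4 * lam * dist z w ≤ 4 * lam * (c * m) := by
        rw [dist_comm z w]; gcongr
      refine this.trans (le_of_eq ?_)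
      rw [hc]; field_simp; norm_num
    have hball : ball z (m / 2) ⊆ (closedBall a (b * m))ᶜ := fun v hv => by
      rw [mem_ball] at hv
      rw [mem_compl_iff, mem_closedBall, not_le]
      have := dist_triangle_left z a v
      nlinarith
    have hsub : Ω ∩ ball z (4 * lam * dist z w) ⊆ U := fun v hv =>
      ⟨hv.1, hball (ball_subset_ball hlw hv.2)⟩
    constructor
    · have := dist_triangle_left z a w
      nlinarith
    · rcases eq_or_ne z w with rfl | hzw
      · exact mem_connectedComponentIn ⟨hz, hball (mem_ball_self (by positivity))⟩
      · exact connectedComponentIn_mono z hsub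
          (h.llc₁ hΩ hconn hb hC hlam hp1 hp2 hz hwΩ hzw)
  have hcap := h.capacity_le_of_subset hΩ hb hC hp1 hp2
    (locallyLipschitzOnSet_indicator hΩ hVo hL h0) hx (E₀ := ball y (c * m) ∩ Ω)
    (E₁ := ball x (c * m) ∩ Ω) (A := ball a (4 * (b * m) / 2))
    (isOpen_ball.inter hΩ).measurableSet (isOpen_ball.inter hΩ).measurableSet
    inter_subset_right inter_subset_right
    (fun w hw => indicator_of_notMem (fun hwV => by
      have h1 := (hfar y hy hmy w hw).2
      have h2 := connectedComponentIn_eq hwV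
      have h3 := connectedComponentIn_eq h1
      exact hyV (by rw [hV, h2, ← h3]; exact mem_connectedComponentIn hyU)) _)
    (fun w hw => by
      obtain ⟨h1, h2⟩ := hfar x hx hmx w hw
      rw [indicator_of_mem h2, ramp_eq_one hs (by nlinarith)])
    (fun w hw => norm_fderiv_indicator_le hΩ hVo hL h0 hw) measurableSet_ball
    (fun w hw hwA => by
      rw [mem_ball, not_lt] at hwA
      by_cases hwV : w ∈ V
      · refine IsLocalMax.fderiv_eq_zero (Filter.Eventually.of_forall fun v => ?_)
        rw [indicator_of_mem hwV, ramp_eq_one hs (by linarith)]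
        refine indicator_apply_le' (fun _ => ?_) fun _ => zero_le_one
        exact max_le zero_le_one (min_le_left _ _)
      · exact fderiv_indicator_eq_zero hVo (c := 0)
          (fun hwf => by linarith [hfr' w hwf hw]) fun h => absurd h hwV)
    (α := 4 * Real.pi * (b * m) ^ 2) (μ := η * (c * m) ^ 2) (by positivity)
    (by
      rw [EuclideanSpace.volume_ball_fin_two, ← ENNReal.ofReal_pow (by positivity),
        ← ENNReal.ofReal_mul (by positivity)]
      exact ENNReal.ofReal_le_ofReal (le_of_eq (by ring)))
    (hη y hy _ (by positivity) (by nlinarith)) (hη x hx _ (by positivity) (by nlinarith))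
  rw [Real.coe_toNNReal _ (by positivity),
    show 2 * C * (1 / (b * m)) = 2 * C / (b * m) by ring,
    ramp_energy_eq hp2 (by linarith) (by positivity) hs, ← hσ, ← hQ] at hcap
  have : 0 < m ^ 2 := by positivity
  nlinarith

end

lemma lintegral_radial (z : Euc 2) {f : ℝ → ℝ} (hf0 : ∀ y, 0 ≤ f y)
    (hf : IntegrableOn (fun y => y * f y) (Ioi 0)) :
    ∫⁻ w : Euc 2, ENNReal.ofReal (f (dist w z)) =
      ENNReal.ofReal (2 * Real.pi * ∫ y in Ioi (0 : ℝ), y * f y) := by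
  have hinteg : Integrable (fun w : Euc 2 => f ‖w‖) := by
    rw [integrable_fun_norm_addHaar]
    simpa using hf
  calc ∫⁻ w : Euc 2, ENNReal.ofReal (f (dist w z))
      = ∫⁻ w : Euc 2, ENNReal.ofReal (f ‖w‖) := by
        rw [← lintegral_sub_right_eq_self (fun w : Euc 2 => ENNReal.ofReal (f ‖w‖)) z]
        simp only [dist_eq_norm]
    _ = ENNReal.ofReal (∫ w : Euc 2, f ‖w‖) :=
        (ofReal_integral_eq_lintegral_ofReal hinteg (Filter.Eventually.of_forall fun w => hf0 _)).symm
    _ = _ := by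
        rw [integral_fun_norm_addHaar]
        have : (volume : Measure (Euc 2)).real (ball 0 1) = Real.pi := by
          simp [Measure.real, EuclideanSpace.volume_ball_fin_two, ENNReal.toReal_ofReal Real.pi_pos.le]
        rw [this]
        simp [mul_assoc]

lemma lintegral_ball_inv_edist (z : Euc 2) {R : ℝ} (hR : 0 ≤ R) :
    ∫⁻ w in ball z R, (edist w z)⁻¹ = ENNReal.ofReal (2 * Real.pi * R) := by
  have key : EqOn (fun y => y * (Iio R).indicator (fun y => |y|⁻¹) y)
      ((Ioo 0 R).indicator fun _ => (1 : ℝ)) (Ioi 0) := fun y hy => by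
    have hy0 : (0 : ℝ) < y := hy
    by_cases h : y < R
    · simp [h, hy0, abs_of_pos hy0, hy0.ne']
    · simp [h]
  have h := lintegral_radial z (f := (Iio R).indicator fun y => |y|⁻¹)
    (fun y => indicator_nonneg (fun y _ => by positivity) y)
    ((integrableOn_congr_fun key measurableSet_Ioi).2
      ((integrable_indicator_iff measurableSet_Ioo).2
        (integrableOn_const (by simp) (by simp))).integrableOn)
  rw [setIntegral_congr_fun measurableSet_Ioi key, integral_indicator measurableSet_Ioo,
    Measure.restrict_restrict measurableSet_Ioo, inter_eq_left.2 Ioo_subset_Ioi_self,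
    setIntegral_const] at h
  simp only [Measure.real, Real.volume_Ioo, sub_zero, ENNReal.toReal_ofReal hR, smul_eq_mul,
    mul_one] at h
  rw [← h, ← lintegral_indicator measurableSet_ball]
  refine lintegral_congr_ae ?_
  filter_upwards [Measure.ae_ne volume z] with w hw
  have hd : 0 < dist w z := dist_pos.2 hw
  by_cases hwR : w ∈ ball z R
  · have : dist w z ∈ Iio R := hwR
    rw [indicator_of_mem hwR, indicator_of_mem this, abs_of_pos hd, edist_dist,
      ENNReal.ofReal_inv_of_pos hd]
  · have : dist w z ∉ Iio R := hwR
    rw [indicator_of_notMem hwR, indicator_of_notMem this, ENNReal.ofReal_zero]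

lemma lintegral_compl_ball_inv_edist_rpow (z : Euc 2) {R s : ℝ} (hR : 0 < R) (hs : 2 < s) :
    ∫⁻ w in (ball z R)ᶜ, (edist w z)⁻¹ ^ s =
      ENNReal.ofReal (2 * Real.pi / (s - 2) * R ^ (2 - s)) := by
  have key : EqOn (fun y => y * (Ici R).indicator (fun y => |y| ^ (-s)) y)
      ((Ici R).indicator fun y => y ^ (1 - s)) (Ioi 0) := fun y hy => by
    have hy0 : (0 : ℝ) < y := hy
    by_cases h : R ≤ y
    · simp only [mem_Ici, h, indicator_of_mem, abs_of_pos hy0]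
      rw [sub_eq_add_neg, Real.rpow_add hy0, Real.rpow_one]
    · simp [h]
  have hioi : Ici R ⊆ Ioi (0 : ℝ) := fun y hy => hR.trans_le hy
  have h := lintegral_radial z (f := (Ici R).indicator fun y => |y| ^ (-s))
    (fun y => indicator_nonneg (fun y _ => by positivity) y)
    ((integrableOn_congr_fun key measurableSet_Ioi).2
      ((integrable_indicator_iff measurableSet_Ici).2
        ((integrableOn_Ici_iff_integrableOn_Ioi (by simp)).2
          (integrableOn_Ioi_rpow_of_lt (by linarith) hR))).integrableOn)
  rw [setIntegral_congr_fun measurableSet_Ioi key, integral_indicator measurableSet_Ici,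
    Measure.restrict_restrict measurableSet_Ici, inter_eq_left.2 hioi, integral_Ici_eq_integral_Ioi,
    integral_Ioi_rpow_of_lt (by linarith) hR] at h
  rw [show 2 * Real.pi / (s - 2) * R ^ (2 - s) =
    2 * Real.pi * (-R ^ (1 - s + 1) / (1 - s + 1)) by
      rw [show 1 - s + 1 = 2 - s by ring, show s - 2 = -(2 - s) by ring, div_neg]; ring,
    ← h, ← lintegral_indicator measurableSet_ball.compl]
  refine lintegral_congr fun w => ?_
  by_cases hwR : w ∈ ball z R
  · have : dist w z ∉ Ici R := fun h => absurd (mem_ball.1 hwR) (not_lt.2 h)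
    rw [indicator_of_notMem (notMem_compl_iff.2 hwR), indicator_of_notMem this, ENNReal.ofReal_zero]
  · have h1 : R ≤ dist w z := not_lt.1 hwR
    have hd : 0 < dist w z := hR.trans_le h1
    rw [indicator_of_mem hwR, indicator_of_mem (mem_Ici.2 h1), abs_of_pos hd, edist_dist,
      Real.rpow_neg hd.le, ENNReal.ofReal_inv_of_pos (by positivity), ENNReal.inv_rpow,
      ENNReal.ofReal_rpow_of_pos hd]

/-- `a` and `b` are joined in `S` by a curve of length at most `l`. -/
def RectJoined (S : Set (Euc 2)) (l : ℝ≥0∞) (a b : Euc 2) : Prop :=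
  ∃ γ : ℝ → Euc 2, ContinuousOn γ (Icc 0 1) ∧ γ 0 = a ∧ γ 1 = b ∧ MapsTo γ (Icc 0 1) S ∧
    eVariationOn γ (Icc 0 1) ≤ l

lemma RectJoined.trans {S : Set (Euc 2)} {l l' : ℝ≥0∞} {a b c : Euc 2}
    (h : RectJoined S l a b) (h' : RectJoined S l' b c) : RectJoined S (l + l') a c := by
  obtain ⟨γ, hγ, h0, h1, hS, hl⟩ := h
  obtain ⟨γ', hγ', h0', h1', hS', hl'⟩ := h'
  set γ'' : ℝ → Euc 2 := fun t => if t ≤ 1 / 2 then γ (2 * t) else γ' (2 * t - 1) with hγ''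
  have hm : MapsTo (fun t : ℝ => 2 * t) (Icc 0 (1 / 2)) (Icc 0 1) := fun t ht =>
    ⟨by linarith [ht.1], by linarith [ht.2]⟩
  have hm' : MapsTo (fun t : ℝ => 2 * t - 1) (Icc (1 / 2) 1) (Icc 0 1) := fun t ht =>
    ⟨by linarith [ht.1], by linarith [ht.2]⟩
  have e1 : EqOn γ'' (γ ∘ fun t => 2 * t) (Icc 0 (1 / 2)) := fun t ht => if_pos ht.2
  have e2 : EqOn γ'' (γ' ∘ fun t => 2 * t - 1) (Icc (1 / 2) 1) := fun t ht => by
    rcases ht.1.eq_or_lt with rfl | hlt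
    · simp only [hγ'', le_refl, if_true, Function.comp]; norm_num [h1, h0']
    · exact if_neg (not_le.2 hlt)
  have hunion : Icc (0 : ℝ) 1 = Icc 0 (1 / 2) ∪ Icc (1 / 2) 1 :=
    (Icc_union_Icc_eq_Icc (by norm_num) (by norm_num)).symm
  refine ⟨γ'', ?_, by simp [hγ'', h0], ?_, ?_, ?_⟩
  · rw [hunion]
    exact ((hγ.comp (by fun_prop) hm).congr e1).union_of_isClosed
      ((hγ'.comp (by fun_prop) hm').congr e2) isClosed_Icc isClosed_Icc
  · simp only [hγ'']; norm_num [h1']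
  · rw [hunion]
    rintro t (ht | ht)
    · rw [e1 ht]; exact hS (hm ht)
    · rw [e2 ht]; exact hS' (hm' ht)
  · have := eVariationOn.Icc_add_Icc γ'' (s := univ) (a := 0) (b := 1 / 2) (c := 1)
      (by norm_num) (by norm_num) (mem_univ _)
    simp only [univ_inter] at this
    rw [← this, eVariationOn.congr e1, eVariationOn.congr e2]
    exact add_le_add
      ((eVariationOn.comp_le_of_monotoneOn γ _ (fun s _ t _ hst => show _ ≤ _ by linarith) hm).trans hl)
      ((eVariationOn.comp_le_of_monotoneOn γ' _ (fun s _ t _ hst => show _ ≤ _ by linarith) hm').trans hl')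

lemma RectJoined.segment {S : Set (Euc 2)} {a b : Euc 2} (h : segment ℝ a b ⊆ S) :
    RectJoined S (edist a b) a b := by
  refine ⟨AffineMap.lineMap a b, by fun_prop, by simp, by simp, fun t ht => h ?_, ?_⟩
  · rw [segment_eq_image_lineMap]; exact mem_image_of_mem _ ht
  · have hL : LipschitzWith (nndist a b) (AffineMap.lineMap a b : ℝ → Euc 2) :=
      lipschitzWith_lineMap a b
    refine (hL.lipschitzOnWith.comp_eVariationOn_le (g := id) (mapsTo_univ _ _)).trans ?_
    have hid : eVariationOn (id : ℝ → ℝ) (Icc 0 1) = 1 := by simp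
    rw [hid, mul_one, edist_nndist]

lemma RectJoined.polygon {S : Set (Euc 2)} (w : ℕ → Euc 2) (k : ℕ)
    (h : ∀ i < k, _root_.segment ℝ (w i) (w (i + 1)) ⊆ S) (h0 : w 0 ∈ S) :
    RectJoined S (∑ i ∈ Finset.range k, edist (w i) (w (i + 1))) (w 0) (w k) := by
  induction k with
  | zero =>
    have := RectJoined.segment (S := S) (a := w 0) (b := w 0) (by simpa using h0)
    simpa using this
  | succ k ih =>
    rw [Finset.sum_range_succ]
    exact (ih fun i hi => h i (hi.trans k.lt_succ_self)).trans
      (RectJoined.segment (h k k.lt_succ_self))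

/-- A chain of minimal length for a relation: non-consecutive members are not related. -/
lemma exists_minimal_chain {X : Type*} (r : X → X → Prop) {x y : X}
    (h : Relation.ReflTransGen r x y) :
    ∃ (k : ℕ) (w : ℕ → X), w 0 = x ∧ w k = y ∧ (∀ i < k, r (w i) (w (i + 1))) ∧
      ∀ i j, i + 1 < j → j ≤ k → ¬ r (w i) (w j) := by
  classical
  have hex : ∃ k, ∃ w : ℕ → X, w 0 = x ∧ w k = y ∧ ∀ i < k, r (w i) (w (i + 1)) := by
    induction h with
    | refl => exact ⟨0, fun _ => x, rfl, rfl, by simp⟩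
    | @tail b c _ hbc ih =>
      obtain ⟨k, w, h0, hk, hw⟩ := ih
      refine ⟨k + 1, fun t => if t ≤ k then w t else c, by simp [h0], by simp, fun i hi => ?_⟩
      rcases (Nat.lt_succ_iff.1 hi).eq_or_lt with rfl | hlt
      · simpa [hk] using hbc
      · simpa [hlt.le, Nat.succ_le_of_lt hlt] using hw i hlt
  obtain ⟨w, h0, hk, hw⟩ := Nat.find_spec hex
  refine ⟨Nat.find hex, w, h0, hk, hw, fun i j hij hjk hr => ?_⟩
  have hlt : Nat.find hex - (j - i - 1) < Nat.find hex := by omega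
  refine Nat.find_min hex hlt ⟨fun t => if t ≤ i then w t else w (t + (j - i - 1)), by simp [h0],
    ?_, fun t ht => ?_⟩
  · dsimp only
    rw [if_neg (by omega), show Nat.find hex - (j - i - 1) + (j - i - 1) = Nat.find hex by omega, hk]
  · dsimp only
    rcases lt_trichotomy t i with hti | rfl | hti
    · rw [if_pos hti.le, if_pos (by omega)]; exact hw t (by omega)
    · rw [if_pos le_rfl, if_neg (by omega), show t + 1 + (j - t - 1) = j by omega]; exact hr
    · rw [if_neg (by omega), if_neg (by omega),
        show t + 1 + (j - i - 1) = t + (j - i - 1) + 1 by omega]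
      exact hw _ (by omega)

lemma IsPreconnected.reflTransGen_of_dist_lt {X : Type*} [PseudoMetricSpace X] {G : Set X}
    (hG : IsPreconnected G) {d : X → ℝ} (hd : ContinuousOn d G) (hpos : ∀ a ∈ G, 0 < d a)
    {x y : X} (hx : x ∈ G) (hy : y ∈ G) :
    Relation.ReflTransGen (fun a b => a ∈ G ∧ b ∈ G ∧ dist a b < min (d a) (d b)) x y := by
  refine hG.induction₂ _ (fun a ha => ?_) (fun _ _ _ _ _ _ => Relation.ReflTransGen.trans)
    (fun a b _ _ h => ?_) hx hy
  · have h1 : ∀ᶠ b in nhdsWithin a G, d a / 2 < d b :=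
      (hd a ha).eventually_const_lt (by linarith [hpos a ha])
    filter_upwards [h1, self_mem_nhdsWithin, mem_nhdsWithin_of_mem_nhds
      (ball_mem_nhds a (half_pos (hpos a ha)))] with b hb hbG hbd
    rw [mem_ball, dist_comm] at hbd
    exact Relation.ReflTransGen.single ⟨ha, hbG, lt_min (by linarith [hpos a ha]) (hbd.trans hb)⟩
  · have : Std.Symm fun a b => a ∈ G ∧ b ∈ G ∧ dist a b < min (d a) (d b) :=
      ⟨fun a b h => ⟨h.2.1, h.1, by rw [dist_comm, min_comm]; exact h.2.2⟩⟩
    exact Relation.ReflTransGen.stdSymm.symm _ _ h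

/-- If balls centred at the points `w i` with radii proportional to `d i` are pairwise disjoint and
the points satisfy a cigar condition with respect to `x` and `y`, then the sum of the `d i` is
controlled by the size of a ball containing everything. -/
lemma sum_le_of_pairwiseDisjoint_ball {x y : Euc 2} {ε M : ℝ} (hε : 0 < ε) (hε1 : ε ≤ 1)
    (hM : 1 ≤ M) (I : Finset ℕ) (w : ℕ → Euc 2) (d : ℕ → ℝ) (hd : ∀ i ∈ I, 0 < d i)
    (hdisj : (I : Set ℕ).PairwiseDisjoint fun i => ball (w i) (d i / 32))
    (hcig : ∀ i ∈ I, ε * min (dist x (w i)) (dist y (w i)) ≤ d i)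
    (hR : ∀ i ∈ I, dist (w i) x + d i / 32 ≤ 2 * M * dist x y) :
    ∑ i ∈ I, d i ≤ 20480 * M * dist x y / ε := by
  set D := dist x y with hD
  have hD0 : 0 ≤ D := dist_nonneg
  set f : Euc 2 → ℝ≥0∞ := fun u => (edist u x)⁻¹ + (edist u y)⁻¹ with hf
  have hsub : (⋃ i ∈ I, ball (w i) (d i / 32)) ⊆ ball x (2 * M * D) := by
    refine iUnion₂_subset fun i hi u hu => ?_
    rw [mem_ball] at hu ⊢
    linarith [dist_triangle u (w i) x, hR i hi]
  have hsub' : ball x (2 * M * D) ⊆ ball y (3 * M * D) := fun u hu => by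
    rw [mem_ball] at hu ⊢
    nlinarith [dist_triangle u x y]
  have hupper : ∫⁻ u in ⋃ i ∈ I, ball (w i) (d i / 32), f u ≤
      ENNReal.ofReal (10 * Real.pi * M * D) := by
    refine (lintegral_mono_set hsub).trans ?_
    rw [hf, lintegral_add_left (by fun_prop)]
    calc _ ≤ ENNReal.ofReal (2 * Real.pi * (2 * M * D)) +
          ENNReal.ofReal (2 * Real.pi * (3 * M * D)) := by
          refine add_le_add (lintegral_ball_inv_edist x (by positivity)).le ?_
          exact (lintegral_mono_set hsub').trans (lintegral_ball_inv_edist y (by positivity)).le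
      _ = _ := by rw [← ENNReal.ofReal_add (by positivity) (by positivity)]; congr 1; ring
  have hlower : ∀ i ∈ I, ENNReal.ofReal (ε * Real.pi / 2048 * d i) ≤
      ∫⁻ u in ball (w i) (d i / 32), f u := fun i hi => by
    have hdi := hd i hi
    calc ENNReal.ofReal (ε * Real.pi / 2048 * d i)
        = ENNReal.ofReal (ε / (2 * d i)) * volume (ball (w i) (d i / 32)) := by
          rw [EuclideanSpace.volume_ball_fin_two, ← ENNReal.ofReal_pow (by positivity),
            ← ENNReal.ofReal_mul (by positivity), ← ENNReal.ofReal_mul (by positivity)]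
          congr 1
          field_simp
          norm_num
      _ = ∫⁻ _ in ball (w i) (d i / 32), ENNReal.ofReal (ε / (2 * d i)) := by
          rw [setLIntegral_const]
      _ ≤ _ := by
          refine setLIntegral_mono' measurableSet_ball fun u hu => ?_
          rw [mem_ball] at hu
          have key : ∀ a : Euc 2, ε * dist a (w i) ≤ d i →
              ENNReal.ofReal (ε / (2 * d i)) ≤ (edist u a)⁻¹ := fun a ha => by
            have h1 : dist u a ≤ (ε / (2 * d i))⁻¹ := by
              rw [inv_div, le_div_iff₀ hε]
              have := dist_triangle u (w i) a
              rw [dist_comm (w i) a] at this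
              nlinarith
            rw [edist_dist, ENNReal.le_inv_iff_le_inv, ← ENNReal.ofReal_inv_of_pos (by positivity)]
            exact ENNReal.ofReal_le_ofReal h1
          rcases min_cases (dist x (w i)) (dist y (w i)) with ⟨h, -⟩ | ⟨h, -⟩
          · exact (key x (h ▸ hcig i hi)).trans le_self_add
          · exact (key y (h ▸ hcig i hi)).trans le_add_self
  have hsum : ENNReal.ofReal (∑ i ∈ I, ε * Real.pi / 2048 * d i) ≤
      ENNReal.ofReal (10 * Real.pi * M * D) := by
    rw [ENNReal.ofReal_sum_of_nonneg fun i hi => by have := hd i hi; positivity]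
    refine (Finset.sum_le_sum hlower).trans ?_
    rw [← lintegral_biUnion_finset hdisj fun i _ => measurableSet_ball]
    exact hupper
  rw [ENNReal.ofReal_le_ofReal_iff (by positivity), ← Finset.mul_sum] at hsum
  rw [le_div_iff₀ hε]
  have hpi := Real.pi_pos
  have : Real.pi * (ε * ∑ i ∈ I, d i) ≤ Real.pi * (20480 * M * D) := by linarith
  linarith [le_of_mul_le_mul_left this hpi]

/-- A connected set of points satisfying a cigar condition can be replaced by a short polygon. -/
theorem rectJoined_of_cigar {Ω : Set (Euc 2)} (hΩ : IsOpen Ω) (hne : Ωᶜ.Nonempty) {x y : Euc 2}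
    {ε M : ℝ} (hε : 0 < ε) (hε1 : ε ≤ 1) (hM : 1 ≤ M) {G : Set (Euc 2)} (hG : IsPreconnected G)
    (hxG : x ∈ G) (hyG : y ∈ G) (hGΩ : G ⊆ Ω)
    (hcig : ∀ w ∈ G, ε * min (dist x w) (dist y w) ≤ infDist w Ωᶜ)
    (hR : ∀ w ∈ G, dist w x ≤ M * dist x y) :
    RectJoined {z ∈ Ω | ε / (5120 * M) * (dist x z * dist y z) ≤ dist x y * infDist z Ωᶜ}
      (ENNReal.ofReal (dist x y / (ε / (5120 * M)))) x y := by
  set D := dist x y with hD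
  have hD0 : 0 ≤ D := dist_nonneg
  set d : Euc 2 → ℝ := fun w => infDist w Ωᶜ with hdef
  have hlip : ∀ a b, d a ≤ d b + dist a b := fun a b => infDist_le_infDist_add_dist
  have hmem : ∀ a, 0 < d a → a ∈ Ω := fun a ha => by
    by_contra h
    exact ha.ne' (infDist_zero_of_mem h)
  have hpos : ∀ a ∈ Ω, 0 < d a := fun a ha =>
    (hΩ.isClosed_compl.notMem_iff_infDist_pos hne).1 (not_not.2 ha)
  have hc1 : ε / (5120 * M) ≤ 1 := by rw [div_le_one (by positivity)]; linarith
  have hc0 : 0 < ε / (5120 * M) := by positivity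
  by_cases hcase : 2 * D ≤ d x
  · have hseg : segment ℝ x y ⊆
        {z ∈ Ω | ε / (5120 * M) * (dist x z * dist y z) ≤ D * d z} := fun z hz => by
      have hzx : dist x z ≤ D := by
        have := dist_add_dist_of_mem_segment hz
        linarith [dist_nonneg (x := z) (y := y)]
      have hzy : dist y z ≤ D := by
        have := dist_add_dist_of_mem_segment hz
        rw [dist_comm y z]
        linarith [dist_nonneg (x := x) (y := z)]
      have hdz : D ≤ d z := by linarith [hlip x z]
      refine ⟨?_, ?_⟩
      · rcases hD0.eq_or_lt with h0 | h0
        · have : z = x := by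
            rw [← h0] at hzx; exact (dist_le_zero.1 hzx).symm
          rw [this]; exact hGΩ hxG
        · exact hmem z (h0.trans_le hdz)
      · calc _ ≤ 1 * (D * D) := by gcongr
          _ ≤ D * d z := by rw [one_mul]; gcongr
    obtain ⟨γ, h1, h2, h3, h4, h5⟩ := RectJoined.segment hseg
    refine ⟨γ, h1, h2, h3, h4, h5.trans ?_⟩
    rw [edist_dist]
    exact ENNReal.ofReal_le_ofReal (le_div_self hD0 hc0 hc1)
  push Not at hcase
  have hup : ∀ w ∈ G, d w ≤ (M + 2) * D := fun w hw => by
    nlinarith [hlip w x, hR w hw]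
  have hcont : Continuous d := continuous_infDist_pt _
  obtain ⟨k, w, hw0, hwk, hchain, hmin⟩ := exists_minimal_chain _
    (IsPreconnected.reflTransGen_of_dist_lt (d := fun a => d a / 8) hG
      (by fun_prop) (fun a ha => by have := hpos a (hGΩ ha); positivity) hxG hyG)
  have hwG : ∀ i ≤ k, w i ∈ G := fun i hi => by
    rcases hi.eq_or_lt with rfl | h
    · rwa [hwk]
    · exact (hchain i h).1
  have hDpos : 0 < D := by
    have := hpos x (hGΩ hxG)
    linarith
  have hsum : ∀ I : Finset ℕ, (∀ i ∈ I, i < k) → (∀ i ∈ I, ∀ j ∈ I, i < j → i + 1 < j) →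
      ∑ i ∈ I, d (w i) ≤ 20480 * M * D / ε := fun I hI hgap => by
    refine sum_le_of_pairwiseDisjoint_ball hε hε1 hM I w (fun i => d (w i))
      (fun i hi => hpos _ (hGΩ (hwG i (hI i hi).le))) ?_ (fun i hi => hcig _ (hwG i (hI i hi).le)) ?_
    · have main : ∀ i ∈ I, ∀ j ∈ I, i < j →
          Disjoint (ball (w i) (d (w i) / 32)) (ball (w j) (d (w j) / 32)) := by
        intro i hi j hj hij
        have hn := hmin i j (hgap i hi j hj hij) (hI j hj).le
        rw [Set.disjoint_left]
        intro u hu hu'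
        rw [mem_ball] at hu hu'
        refine hn ⟨hwG i (hI i hi).le, hwG j (hI j hj).le, ?_⟩
        have h1 := dist_triangle_left (w i) (w j) u
        have h2 := hlip (w i) (w j)
        have h3 := hlip (w j) (w i)
        rw [dist_comm (w j) (w i)] at h3
        rw [lt_min_iff]
        have h4 := hpos _ (hGΩ (hwG i (hI i hi).le))
        have h5 := hpos _ (hGΩ (hwG j (hI j hj).le))
        constructor <;> linarith
      intro i hi j hj hij
      rcases lt_or_gt_of_ne hij with h | h
      · exact main i hi j hj h
      · exact (main j hj i hi h).symm
    · intro i hi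
      have h1 := hup _ (hwG i (hI i hi).le)
      have h2 := hR _ (hwG i (hI i hi).le)
      nlinarith
  have htot : ∑ i ∈ Finset.range k, d (w i) ≤ 40960 * M * D / ε := by
    rw [← Finset.sum_filter_add_sum_filter_not (Finset.range k) (fun i => Even i)]
    have h1 := hsum ((Finset.range k).filter fun i => Even i) (by simp +contextual)
      (by simp only [Finset.mem_filter, Finset.mem_range, Nat.even_iff]; intros; omega)
    have h2 := hsum ((Finset.range k).filter fun i => ¬ Even i) (by simp +contextual)
      (by simp only [Finset.mem_filter, Finset.mem_range, Nat.even_iff]; intros; omega)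
    calc _ ≤ _ := add_le_add h1 h2
      _ = _ := by ring
  have hseg : ∀ i < k, segment ℝ (w i) (w (i + 1)) ⊆
      {z ∈ Ω | ε / (5120 * M) * (dist x z * dist y z) ≤ D * d z} := by
    intro i hi z hz
    have hdi := hpos _ (hGΩ (hwG i hi.le))
    have hzi : dist (w i) z ≤ d (w i) / 8 := by
      have := dist_add_dist_of_mem_segment hz
      have h2 := lt_min_iff.1 (hchain i hi).2.2
      linarith [dist_nonneg (x := z) (y := w (i + 1)), h2.1]
    have hdz : 7 / 8 * d (w i) ≤ d z := by linarith [hlip (w i) z]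
    refine ⟨hmem z (by linarith), ?_⟩
    have hcw := hcig _ (hwG i hi.le)
    have hRw := hR _ (hwG i hi.le)
    have huw := hup _ (hwG i hi.le)
    have hx1 : dist x z ≤ 3 * M * D := by
      have := dist_triangle x (w i) z
      rw [dist_comm x (w i)] at this
      nlinarith
    have hy1 : dist y z ≤ 3 * M * D := by
      have h1 := dist_triangle y x z
      have h2 := dist_triangle x (w i) z
      rw [dist_comm y x] at h1
      rw [dist_comm x (w i)] at h2
      nlinarith
    have key : ∀ a b : Euc 2, ε * dist a (w i) ≤ d (w i) → dist b z ≤ 3 * M * D →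
        ε / (5120 * M) * (dist a z * dist b z) ≤ D * d z := fun a b ha hb => by
      have h1 : ε * dist a z ≤ 9 / 8 * d (w i) := by
        have := dist_triangle a (w i) z
        nlinarith
      calc ε / (5120 * M) * (dist a z * dist b z)
          = (ε * dist a z) * dist b z / (5120 * M) := by ring
        _ ≤ (9 / 8 * d (w i)) * (3 * M * D) / (5120 * M) := by gcongr
        _ = 27 / 40960 * (D * d (w i)) := by field_simp; norm_num
        _ ≤ D * d z := by nlinarith [mul_pos hDpos hdi]
    rcases min_cases (dist x (w i)) (dist y (w i)) with ⟨h, -⟩ | ⟨h, -⟩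
    · exact key x y (h ▸ hcw) hy1
    · rw [mul_comm (dist x z)]
      exact key y x (h ▸ hcw) hx1
  obtain ⟨γ, h1, h2, h3, h4, h5⟩ := RectJoined.polygon w k hseg (by
    rw [hw0]
    refine ⟨hGΩ hxG, ?_⟩
    rw [dist_self, zero_mul, mul_zero]
    exact mul_nonneg hD0 infDist_nonneg)
  rw [hw0] at h2
  rw [hwk] at h3
  refine ⟨γ, h1, h2, h3, h4, h5.trans ?_⟩
  simp only [edist_dist]
  rw [← ENNReal.ofReal_sum_of_nonneg fun _ _ => dist_nonneg]
  refine ENNReal.ofReal_le_ofReal ?_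
  calc ∑ i ∈ Finset.range k, dist (w i) (w (i + 1))
      ≤ ∑ i ∈ Finset.range k, d (w i) / 8 := Finset.sum_le_sum fun i hi =>
        ((lt_min_iff.1 (hchain i (Finset.mem_range.1 hi)).2.2).1).le
    _ = (∑ i ∈ Finset.range k, d (w i)) / 8 := by rw [Finset.sum_div]
    _ ≤ (40960 * M * D / ε) / 8 := by gcongr
    _ = D / (ε / (5120 * M)) := by field_simp; norm_num

/-- The identification of the Euclidean plane with `ℂ`. -/
def planeEquiv : Euc 2 ≃ₗᵢ[ℝ] ℂ := Complex.orthonormalBasisOneI.repr.symm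

lemma isUniformDomain_of_rectJoined {Ω : Set (Euc 2)} (hΩ : IsOpen Ω) (hne : Ωᶜ.Nonempty)
    {c : ℝ} (hc : 0 < c) (hc1 : c ≤ 1)
    (h : ∀ x ∈ Ω, ∀ y ∈ Ω, x ≠ y → RectJoined
      {z ∈ Ω | c * (dist x z * dist y z) ≤ dist x y * infDist z Ωᶜ}
      (ENNReal.ofReal (dist x y / c)) x y) : IsUniformDomain Ω := by
  refine ⟨c, hc, hc1, fun x hx y hy => ?_⟩
  rcases eq_or_ne x y with rfl | hxy
  · refine ⟨fun _ => x, continuousOn_const, rfl, rfl, fun _ _ => hx, ?_, fun t _ => ?_⟩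
    · rw [eVariationOn.constant_on (by rintro _ ⟨_, _, rfl⟩ _ ⟨_, _, rfl⟩; rfl)]
      exact zero_le
    · simpa using infDist_nonneg
  · obtain ⟨γ, h1, h2, h3, h4, h5⟩ := h x hx y hy hxy
    refine ⟨γ, h1, h2, h3, fun t ht => (h4 ht).1, h5, fun t ht => ?_⟩
    have hd : 0 < dist x y := dist_pos.2 hxy
    rw [div_le_iff₀ hd, mul_comm (infDist _ _)]
    refine (h4 ht).2.trans (mul_le_mul_of_nonneg_left ?_ hd.le)
    have hfr : frontier Ω ⊆ Ωᶜ := by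
      rw [← frontier_compl]; exact hΩ.isClosed_compl.frontier_subset
    refine infDist_le_infDist_of_subset hfr (nonempty_frontier_iff.2 ⟨⟨x, hx⟩, ?_⟩)
    rwa [← nonempty_compl]

/-- In a bounded simply connected planar domain a local Sobolev–Poincaré inequality forces
uniformity. -/
theorem SPWith.isUniformDomain {Ω : Set (Euc 2)} {p C lam : ℝ} (h : SPWith Ω p C lam)
    (hΩ : IsOpen Ω) (hconn : IsConnected Ω) (hb : Bornology.IsBounded Ω)
    (hsc : SimplyConnectedSpace Ω) (hC : 1 ≤ C) (hlam : 1 ≤ lam) (hp1 : 1 ≤ p) (hp2 : p < 2) :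
    IsUniformDomain Ω := by
  have hne : Ωᶜ.Nonempty := by
    rw [nonempty_compl]
    rintro rfl
    exact NormedSpace.unbounded_univ ℝ (Euc 2) hb
  obtain ⟨b, hb0, hb1, hllc⟩ := h.llc₂ hΩ hconn hb hC hlam hp1 hp2
  set e := planeEquiv with he
  set Ω' : Set ℂ := e.symm ⁻¹' Ω with hΩ'
  have hΩ'open : IsOpen Ω' := hΩ.preimage e.symm.continuous
  have hne' : Ω'ᶜ.Nonempty := by
    obtain ⟨a, ha⟩ := hne
    exact ⟨e a, by simpa [hΩ'] using ha⟩
  have hnorm : ∀ z w : Euc 2, ‖e z - e w‖ = dist z w := fun z w => by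
    rw [← e.dist_map z w, dist_eq_norm]
  have hsurj : ∀ a : ℂ, ∃ a' : Euc 2, e a' = a := fun a => ⟨e.symm a, e.apply_symm_apply a⟩
  have himg : ∀ {z}, e z ∈ Ω' ↔ z ∈ Ω := fun {z} => by simp [hΩ']
  have himage : ∀ {S : Set (Euc 2)}, S ⊆ Ω → e '' S ⊆ Ω' := by
    rintro S hS _ ⟨w, hw, rfl⟩
    exact himg.2 (hS hw)
  set M := 8 * (5 * lam) with hM
  set ε := b / 32 with hε
  refine isUniformDomain_of_rectJoined (c := ε / (5120 * M)) hΩ hne (by positivity)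
    (by rw [div_le_one (by positivity)]; linarith) fun x hx y hy hxy => ?_
  have hd : 0 < dist x y := dist_pos.2 hxy
  have key := mem_connectedComponentIn_cigar (Ω := Ω') (x := e x) (y := e y) (b := b)
    (R := 5 * lam * dist x y) hΩ'open hne' (himg.2 hx) (himg.2 hy) hb0 hb1
    (by rw [hnorm]; nlinarith) ?_ ?_ ?_
  · set T : Set ℂ := {w | b / 32 * min ‖e x - w‖ ‖e y - w‖ < infDist w Ω'ᶜ ∧
      ‖w - e x‖ < 8 * (5 * lam * dist x y)} with hT
    have hcomp : ∀ w, e w ∈ T → w ∈ Ω ∧ ε * min (dist x w) (dist y w) ≤ infDist w Ωᶜ ∧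
        dist w x ≤ M * dist x y := by
      rintro w ⟨h1, h2⟩
      have hinf : infDist (e w) Ω'ᶜ = infDist w Ωᶜ := by
        have : Ω'ᶜ = e '' Ωᶜ := by
          rw [LinearIsometryEquiv.image_eq_preimage_symm, hΩ', preimage_compl]
        rw [this, infDist_image e.isometry]
      rw [hnorm, hnorm, hinf] at h1
      rw [hnorm] at h2
      refine ⟨?_, h1.le, by rw [hM]; linarith⟩
      by_contra hw
      rw [infDist_zero_of_mem (mem_compl hw)] at h1
      exact absurd h1 (not_lt.2 (by positivity))
    have hxT : e x ∈ T := by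
      by_contra hx'
      rw [connectedComponentIn_eq_empty hx'] at key
      exact key
    have hsub := connectedComponentIn_subset T (e x)
    refine rectJoined_of_cigar hΩ hne (by positivity) (by linarith) (by linarith)
      (G := e.symm '' connectedComponentIn T (e x))
      (isPreconnected_connectedComponentIn.image _ e.symm.continuous.continuousOn)
      ⟨e x, mem_connectedComponentIn hxT, e.symm_apply_apply x⟩
      ⟨e y, key, e.symm_apply_apply y⟩ ?_ ?_ ?_
    all_goals
      rintro _ ⟨w, hw, rfl⟩
      have := hcomp (e.symm w) (by rw [e.apply_symm_apply]; exact hsub hw)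
    exacts [this.1, this.2.1, this.2.2]
  · intro a ha
    obtain ⟨a, rfl⟩ := hsurj a
    rw [himg] at ha
    obtain ⟨f, hf, hfe⟩ := Complex.exists_continuousOn_eqOn_exp_comp (U := Ω) hsc hΩ
      (g := fun w => e w - e a) (by fun_prop) (by
        rintro ⟨w, hw, h0⟩
        exact ha (e.injective (sub_eq_zero.1 h0) ▸ hw))
    refine ⟨f ∘ e.symm, hf.comp e.symm.continuous.continuousOn fun w hw => hw, fun w hw => ?_⟩
    have := hfe (show e.symm w ∈ Ω from hw)
    simpa using this
  · intro a ha
    obtain ⟨a, rfl⟩ := hsurj a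
    rw [himg] at ha
    have hy' := hllc x hx y hy a ha
    set U := Ω \ closedBall a (b * min (dist x a) (dist y a)) with hU
    have hxU : x ∈ U := by
      by_contra hx'
      rw [connectedComponentIn_eq_empty hx'] at hy'
      exact hy'
    refine ⟨e '' connectedComponentIn U x,
      isPreconnected_connectedComponentIn.image _ e.continuous.continuousOn,
      himage ((connectedComponentIn_subset _ _).trans sdiff_subset),
      mem_image_of_mem _ (mem_connectedComponentIn hxU), mem_image_of_mem _ hy', ?_⟩
    rintro _ ⟨w, hw, rfl⟩
    rw [hnorm, hnorm, hnorm]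
    have := (connectedComponentIn_subset _ _ hw).2
    rw [mem_closedBall, not_le] at this
    exact this.le
  · have hy' := h.llc₁ hΩ hconn hb hC hlam hp1 hp2 hx hy hxy
    refine ⟨e '' connectedComponentIn (Ω ∩ ball x (4 * lam * dist x y)) x,
      isPreconnected_connectedComponentIn.image _ e.continuous.continuousOn,
      himage ((connectedComponentIn_subset _ _).trans inter_subset_left),
      mem_image_of_mem _ (mem_connectedComponentIn ⟨hx, mem_ball_self (by positivity)⟩),
      mem_image_of_mem _ hy', ?_⟩
    rintro _ ⟨w, hw, rfl⟩
    rw [hnorm]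
    have := (connectedComponentIn_subset _ _ hw).2
    rw [mem_ball] at this
    nlinarith

lemma LocallyLipschitzOn.comp_lipschitzWith {X Y Z : Type*} [PseudoEMetricSpace X]
    [PseudoEMetricSpace Y] [PseudoEMetricSpace Z] {u : Y → Z} {S : Set Y} {T : Set X} {γ : X → Y}
    {K : ℝ≥0} (hu : LocallyLipschitzOn S u) (hγ : LipschitzWith K γ) (hm : MapsTo γ T S) :
    LocallyLipschitzOn T (u ∘ γ) := fun t ht => by
  obtain ⟨K', s, hs, hL⟩ := hu (hm ht)
  exact ⟨K' * K, γ ⁻¹' s, hγ.continuous.continuousWithinAt.tendsto_nhdsWithin hm hs,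
    hL.comp hγ.lipschitzOnWith (mapsTo_preimage _ _)⟩

/-- Rademacher's theorem for locally Lipschitz functions on an open set. -/
lemma LocallyLipschitzOnSet.ae_differentiableAt {Ω : Set (Euc 2)} {u : Euc 2 → ℝ}
    (hu : LocallyLipschitzOnSet u Ω) (hΩ : IsOpen Ω) :
    volume {z | z ∈ Ω ∧ ¬ DifferentiableAt ℝ u z} = 0 := by
  refine measure_null_of_locally_null _ fun x hx => ?_
  obtain ⟨K, s, hs, hL⟩ := hu x hx.1
  rw [hΩ.nhdsWithin_eq hx.1] at hs
  obtain ⟨V, hVs, hV, hxV⟩ := _root_.mem_nhds_iff.1 hs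
  refine ⟨{z | z ∈ V ∧ ¬ DifferentiableAt ℝ u z}, ?_, ?_⟩
  · filter_upwards [self_mem_nhdsWithin, mem_nhdsWithin_of_mem_nhds (hV.mem_nhds hxV)] with z hz hzV
    exact ⟨hzV, hz.2⟩
  · have := (hL.mono hVs).ae_differentiableWithinAt_of_mem (μ := volume)
    rw [ae_iff] at this
    refine measure_mono_null (fun z (hz : z ∈ V ∧ _) => ?_) this
    exact fun h => hz.2 ((h hz.1).differentiableAt (hV.mem_nhds hz.1))

lemma LocallyLipschitzOnSet.enorm_sub_le_lintegral {Ω : Set (Euc 2)} {u : Euc 2 → ℝ}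
    (hu : LocallyLipschitzOnSet u Ω) {a v : Euc 2} (hm : ∀ t ∈ Icc (0 : ℝ) 1, a + t • v ∈ Ω)
    (hd : ∀ᵐ t : ℝ, t ∈ Ioc (0 : ℝ) 1 → DifferentiableAt ℝ u (a + t • v)) :
    ‖u (a + v) - u a‖ₑ ≤ ∫⁻ t in Ioc (0 : ℝ) 1, ‖v‖ₑ * ‖fderiv ℝ u (a + t • v)‖ₑ := by
  set γ : ℝ → Euc 2 := fun t => a + t • v with hγ
  have hL : LipschitzWith ‖v‖₊ γ := LipschitzWith.of_dist_le_mul fun s t => by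
    rw [hγ, dist_add_left, dist_eq_norm, ← sub_smul, norm_smul, mul_comm, coe_nnnorm,
      Real.dist_eq, Real.norm_eq_abs]
  obtain ⟨K, hK⟩ := (LocallyLipschitzOn.comp_lipschitzWith (u := u) hu hL
    (T := Icc 0 1) hm).exists_lipschitzOnWith_of_compact isCompact_Icc
  rw [← uIcc_of_le zero_le_one] at hK
  have hftc := hK.absolutelyContinuousOnInterval.integral_deriv_eq_sub
  have h1 : (u ∘ γ) 1 - (u ∘ γ) 0 = u (a + v) - u a := by simp [hγ]
  rw [← h1, ← hftc, intervalIntegral.integral_of_le zero_le_one]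
  refine (enorm_integral_le_lintegral_enorm _).trans (lintegral_mono_ae ?_)
  rw [ae_restrict_iff' measurableSet_Ioc]
  filter_upwards [hd] with t ht htm
  have hγ' : HasDerivAt γ v t := by
    have := ((hasDerivAt_id t).smul_const v).const_add a
    simpa [hγ] using this
  rw [((ht htm).hasFDerivAt.comp_hasDerivAt t hγ').deriv, mul_comm]
  exact (fderiv ℝ u (γ t)).le_opENorm v

lemma lintegral_ball_comp_smul {g : Euc 2 → ℝ≥0∞} (hg : Measurable g) (w : Euc 2) {ρ : ℝ}
    (hρ : 0 < ρ) : ∫⁻ h in ball (0 : Euc 2) 1, g (w + ρ • h) =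
      ENNReal.ofReal (ρ ^ 2)⁻¹ * ∫⁻ z in ball w ρ, g z := by
  rw [← lintegral_indicator measurableSet_ball, ← lintegral_indicator measurableSet_ball]
  set F : Euc 2 → ℝ≥0∞ := (ball w ρ).indicator g with hF
  have hFm : Measurable F := hg.indicator measurableSet_ball
  have h1 : (ball (0 : Euc 2) 1).indicator (fun h => g (w + ρ • h)) =
      fun h => F (w + ρ • h) := by
    funext h
    by_cases hh : h ∈ ball (0 : Euc 2) 1
    · rw [indicator_of_mem hh, hF, indicator_of_mem]
      rw [mem_ball_zero_iff] at hh
      rw [mem_ball, dist_self_add_left, norm_smul, Real.norm_of_nonneg hρ.le]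
      nlinarith
    · rw [indicator_of_notMem hh, hF, indicator_of_notMem]
      rw [mem_ball_zero_iff] at hh
      rw [mem_ball, dist_self_add_left, norm_smul, Real.norm_of_nonneg hρ.le]
      nlinarith
  rw [h1, ← lintegral_add_left_eq_self F w]
  have h2 : ∫⁻ h, F (w + ρ • h) = ∫⁻ h, F (w + h) ∂(Measure.map (ρ • ·) volume) :=
    (lintegral_map (f := fun h => F (w + h)) (by fun_prop) (by fun_prop)).symm
  rw [h2, Measure.map_addHaar_smul _ hρ.ne', lintegral_smul_measure]
  simp [abs_of_pos hρ]

lemma LocallyLipschitzOnSet.ae_differentiableAt_comp {Ω : Set (Euc 2)} {u : Euc 2 → ℝ}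
    (hu : LocallyLipschitzOnSet u Ω) (hΩ : IsOpen Ω) {w : Euc 2} {ρ : ℝ} (hρ : 0 < ρ)
    (h : ball w ρ ⊆ Ω) :
    ∀ᵐ h : Euc 2, h ∈ ball (0 : Euc 2) 1 → DifferentiableAt ℝ u (w + ρ • h) := by
  set N : Set (Euc 2) := {z | z ∈ Ω ∧ ¬ DifferentiableAt ℝ u z} with hN
  have hNm : MeasurableSet N := hΩ.measurableSet.inter (measurableSet_of_differentiableAt ℝ u).compl
  have hind : Measurable (N.indicator (1 : Euc 2 → ℝ≥0∞)) := measurable_one.indicator hNm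
  have h0 := lintegral_ball_comp_smul hind w hρ
  have h1 : ∫⁻ z in ball w ρ, N.indicator (1 : Euc 2 → ℝ≥0∞) z = 0 := by
    rw [← nonpos_iff_eq_zero]
    refine (setLIntegral_le_lintegral _ _).trans ?_
    rw [lintegral_indicator_one hNm, hu.ae_differentiableAt hΩ]
  have hind' : Measurable fun h : Euc 2 => N.indicator (1 : Euc 2 → ℝ≥0∞) (w + ρ • h) :=
    hind.comp (by fun_prop)
  rw [h1, mul_zero, lintegral_eq_zero_iff hind', Filter.EventuallyEq,
    ae_restrict_iff' measurableSet_ball] at h0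
  filter_upwards [h0] with z hz hzb
  by_contra hcon
  refine one_ne_zero (α := ℝ≥0∞) ?_
  refine Eq.trans ?_ (hz hzb)
  rw [indicator_of_mem, Pi.one_apply]
  refine ⟨h ?_, hcon⟩
  rw [mem_ball_zero_iff] at hzb
  rw [mem_ball, dist_self_add_left, norm_smul, Real.norm_of_nonneg hρ.le]
  nlinarith

/-- The (unnormalised) average of `u` over the ball `B(w, ρ)`. -/
def ballAvg (u : Euc 2 → ℝ) (w : Euc 2) (ρ : ℝ) : ℝ := ∫ h in ball (0 : Euc 2) 1, u (w + ρ • h)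

lemma integrableOn_ballAvg {Ω : Set (Euc 2)} {u : Euc 2 → ℝ} (hu : ContinuousOn u Ω) {w : Euc 2}
    {ρ : ℝ} (hρ : 0 ≤ ρ) (h : closedBall w ρ ⊆ Ω) :
    IntegrableOn (fun h : Euc 2 => u (w + ρ • h)) (ball 0 1) := by
  refine IntegrableOn.mono_set ?_ (ball_subset_closedBall)
  refine ContinuousOn.integrableOn_compact (isCompact_closedBall _ _)
    (hu.comp (by fun_prop) fun z hz => h ?_)
  rw [mem_closedBall_zero_iff] at hz
  rw [mem_closedBall, dist_self_add_left, norm_smul, Real.norm_of_nonneg hρ]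
  nlinarith

/-- Moving the centre and the radius of a ball linearly changes the average in a controlled way. -/
lemma enorm_ballAvg_sub_le {Ω S : Set (Euc 2)} (hΩ : IsOpen Ω) {u : Euc 2 → ℝ}
    (hu : LocallyLipschitzOnSet u Ω) {w w' : Euc 2} {ρ ρ' ρ₀ : ℝ} (hρ₀ : 0 < ρ₀) (hρ : ρ₀ ≤ ρ)
    (hρ' : ρ₀ ≤ ρ')
    (hball : ∀ t ∈ Icc (0 : ℝ) 1,
      closedBall (w + t • (w' - w)) (ρ + t * (ρ' - ρ)) ⊆ Ω ∩ S) :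
    ‖ballAvg u w' ρ' - ballAvg u w ρ‖ₑ ≤
      ENNReal.ofReal ((dist w w' + |ρ' - ρ|) / ρ₀ ^ 2) *
        ∫⁻ z in S ∩ Ω, ‖fderiv ℝ u z‖ₑ := by
  have hcont : ContinuousOn u Ω := LocallyLipschitzOn.continuousOn (s := Ω) (f := u) hu
  have h0 := hball 0 (by simp)
  have h1 := hball 1 (by simp)
  simp only [zero_smul, add_zero, zero_mul, one_smul, add_sub_cancel, one_mul] at h0 h1
  have hrt : ∀ t ∈ Icc (0 : ℝ) 1, ρ₀ ≤ ρ + t * (ρ' - ρ) := fun t ht => by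
    nlinarith [ht.1, ht.2]
  set L : ℝ := dist w w' + |ρ' - ρ| with hL
  set v : Euc 2 → Euc 2 := fun h => (w' - w) + (ρ' - ρ) • h with hv
  have hpt : ∀ (h : Euc 2) (t : ℝ), (w + ρ • h) + t • v h =
      (w + t • (w' - w)) + (ρ + t * (ρ' - ρ)) • h := fun h t => by
    simp only [hv]; module
  have hmeas : Measurable fun q : Euc 2 × ℝ => ‖fderiv ℝ u ((w + ρ • q.1) + q.2 • v q.1)‖ₑ :=
    ((measurable_fderiv ℝ u).enorm).comp (by fun_prop)
  have hdiff : ∀ᵐ h : Euc 2, h ∈ ball (0 : Euc 2) 1 → ∀ᵐ t : ℝ, t ∈ Ioc (0 : ℝ) 1 →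
      DifferentiableAt ℝ u ((w + ρ • h) + t • v h) := by
    have hm : MeasurableSet {q : Euc 2 × ℝ | q.1 ∈ ball (0 : Euc 2) 1 → q.2 ∈ Ioc (0 : ℝ) 1 →
        DifferentiableAt ℝ u ((w + ρ • q.1) + q.2 • v q.1)} := by
      refine (measurableSet_ball.preimage measurable_fst).imp
        ((measurableSet_Ioc.preimage measurable_snd).imp ?_)
      exact (measurableSet_of_differentiableAt ℝ u).preimage
        (f := fun q : Euc 2 × ℝ => (w + ρ • q.1) + q.2 • v q.1) (by fun_prop)
    have hae : ∀ᵐ t : ℝ, ∀ᵐ h : Euc 2, h ∈ ball (0 : Euc 2) 1 → t ∈ Ioc (0 : ℝ) 1 →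
        DifferentiableAt ℝ u ((w + ρ • h) + t • v h) := by
      refine Filter.Eventually.of_forall fun t => ?_
      by_cases ht : t ∈ Ioc (0 : ℝ) 1
      swap
      · exact Filter.Eventually.of_forall fun h _ h' => absurd h' ht
      have ht' : t ∈ Icc (0 : ℝ) 1 := ⟨ht.1.le, ht.2⟩
      have hr := hρ₀.trans_le (hrt t ht')
      filter_upwards [hu.ae_differentiableAt_comp hΩ hr
        (ball_subset_closedBall.trans ((hball t ht').trans inter_subset_left))] with h hh hb _
      rw [hpt]
      exact hh hb
    filter_upwards [(Measure.ae_ae_comm hm).2 hae] with h hh hb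
    filter_upwards [hh] with t ht htm
    exact ht hb htm
  calc ‖ballAvg u w' ρ' - ballAvg u w ρ‖ₑ
      = ‖∫ h in ball (0 : Euc 2) 1, (u (w' + ρ' • h) - u (w + ρ • h))‖ₑ := by
        rw [integral_sub (integrableOn_ballAvg hcont (hρ₀.le.trans hρ') (h1.trans inter_subset_left))
          (integrableOn_ballAvg hcont (hρ₀.le.trans hρ) (h0.trans inter_subset_left))]
        rfl
    _ ≤ ∫⁻ h in ball (0 : Euc 2) 1, ‖u (w' + ρ' • h) - u (w + ρ • h)‖ₑ :=
        enorm_integral_le_lintegral_enorm _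
    _ ≤ ∫⁻ h in ball (0 : Euc 2) 1, ∫⁻ t in Ioc (0 : ℝ) 1,
          ENNReal.ofReal L * ‖fderiv ℝ u ((w + ρ • h) + t • v h)‖ₑ := by
        refine lintegral_mono_ae ?_
        rw [ae_restrict_iff' measurableSet_ball]
        filter_upwards [hdiff] with h hd hh
        have hvh : ‖v h‖ₑ ≤ ENNReal.ofReal L := by
          rw [← ofReal_norm]
          refine ENNReal.ofReal_le_ofReal ((norm_add_le _ _).trans ?_)
          rw [norm_smul, Real.norm_eq_abs, hL, dist_comm, dist_eq_norm]
          rw [mem_ball_zero_iff] at hh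
          nlinarith [abs_nonneg (ρ' - ρ)]
        have := hu.enorm_sub_le_lintegral (a := w + ρ • h) (v := v h) (fun t ht => ?_) (hd hh)
        · rw [show w + ρ • h + v h = w' + ρ' • h by simp only [hv]; module] at this
          exact this.trans (lintegral_mono fun t => mul_le_mul_left hvh _)
        · rw [hpt]
          refine (hball t ht ?_).1
          rw [mem_closedBall, dist_self_add_left, norm_smul,
            Real.norm_of_nonneg (hρ₀.le.trans (hrt t ht))]
          rw [mem_ball_zero_iff] at hh
          nlinarith [hrt t ht]
    _ = ∫⁻ t in Ioc (0 : ℝ) 1, ∫⁻ h in ball (0 : Euc 2) 1,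
          ENNReal.ofReal L * ‖fderiv ℝ u ((w + ρ • h) + t • v h)‖ₑ :=
        lintegral_lintegral_swap (hmeas.const_mul _).aemeasurable
    _ ≤ ∫⁻ t in Ioc (0 : ℝ) 1, ENNReal.ofReal (L / ρ₀ ^ 2) * ∫⁻ z in S ∩ Ω, ‖fderiv ℝ u z‖ₑ := by
        refine setLIntegral_mono' measurableSet_Ioc fun t ht => ?_
        have ht' : t ∈ Icc (0 : ℝ) 1 := ⟨ht.1.le, ht.2⟩
        have hr := hrt t ht'
        simp_rw [hpt]
        rw [lintegral_const_mul _ (by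
          exact ((measurable_fderiv ℝ u).enorm).comp (by fun_prop)),
          lintegral_ball_comp_smul (measurable_fderiv ℝ u).enorm _ (hρ₀.trans_le hr), ← mul_assoc,
          ← ENNReal.ofReal_mul (by positivity)]
        refine mul_le_mul' (ENNReal.ofReal_le_ofReal ?_) (lintegral_mono_set ?_)
        · rw [div_eq_mul_inv]
          gcongr
        · rw [inter_comm]
          exact ball_subset_closedBall.trans (hball t ht')
    _ = _ := by simp

lemma ball_infDist_frontier_subset {Ω : Set (Euc 2)} {z : Euc 2} (hz : z ∈ Ω) :
    ball z (infDist z (frontier Ω)) ⊆ Ω := by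
  rcases (infDist_nonneg (x := z) (s := frontier Ω)).eq_or_lt with h0 | hpos
  · simp [← h0]
  have hfr : ∀ v ∈ ball z (infDist z (frontier Ω)), v ∉ frontier Ω := fun v hv hvf => by
    have := infDist_le_dist_of_mem (x := z) hvf
    rw [mem_ball, dist_comm] at hv
    linarith
  have hinteg : ∀ v ∈ ball z (infDist z (frontier Ω)), v ∈ closure Ω → v ∈ interior Ω :=
    fun v hv hvc => by
      by_contra hvi
      exact hfr v hv ⟨hvc, hvi⟩
  refine ((convex_ball z _).isPreconnected.subset_left_of_subset_union isOpen_interior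
    isClosed_closure.isOpen_compl
    (disjoint_compl_right_iff_subset.2 (interior_subset.trans subset_closure))
    (fun v hv => ?_) ⟨z, mem_ball_self hpos, hinteg z (mem_ball_self hpos) (subset_closure hz)⟩).trans
    interior_subset
  by_cases hvc : v ∈ closure Ω
  · exact Or.inl (hinteg v hv hvc)
  · exact Or.inr hvc

lemma exists_dist_eq_of_curve {γ : ℝ → Euc 2} (hγ : ContinuousOn γ (Icc 0 1)) {s : ℝ} (hs : 0 ≤ s)
    (h : s ≤ dist (γ 0) (γ 1)) : ∃ t ∈ Icc (0 : ℝ) 1, dist (γ 0) (γ t) = s :=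
  intermediate_value_Icc zero_le_one (f := fun t => dist (γ 0) (γ t)) (by fun_prop)
    ⟨by simpa using hs, h⟩

lemma IsUniformWith.exists_point {Ω : Set (Euc 2)} {ε : ℝ} (hε : 0 < ε) (hU : IsUniformWith Ω ε)
    {y b : Euc 2} (hy : y ∈ Ω) (hb : b ∈ Ω) {s : ℝ} (hs : 0 < s) (hsb : 2 * s ≤ dist y b) :
    ∃ z ∈ Ω, dist y z = s ∧ ε * s / 2 ≤ infDist z (frontier Ω) := by
  obtain ⟨γ, hγ, h0, h1, hm, -, hc⟩ := hU y hy b hb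
  obtain ⟨t, ht, hts⟩ := exists_dist_eq_of_curve hγ hs.le (by rw [h0, h1]; linarith)
  rw [h0] at hts
  refine ⟨γ t, hm ht, hts, le_trans ?_ (hc t ht)⟩
  have hd : 0 < dist y b := by linarith
  rw [hts, le_div_iff₀ hd]
  have := dist_triangle_right y b (γ t)
  have : dist y b / 2 ≤ dist b (γ t) := by linarith
  nlinarith [mul_pos hε hs]

/-- In a uniform domain the averages over two comparable Whitney balls are comparable. -/
lemma IsUniformWith.enorm_ballAvg_sub_le {Ω : Set (Euc 2)} {ε : ℝ} (hε : 0 < ε) (hε1 : ε ≤ 1)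
    (hU : IsUniformWith Ω ε) (hΩ : IsOpen Ω) {u : Euc 2 → ℝ} (hu : LocallyLipschitzOnSet u Ω)
    {a b : Euc 2} (ha : a ∈ Ω) (hb : b ∈ Ω) {ρ : ℝ} (hρ : 0 < ρ) (hab : dist a b ≤ 3 * ρ)
    (hda : ε * ρ / 32 ≤ infDist a (frontier Ω)) (hdb : ε * ρ / 32 ≤ infDist b (frontier Ω)) :
    ‖ballAvg u b (ε ^ 2 / 512 * ρ) - ballAvg u a (ε ^ 2 / 512 * ρ)‖ₑ ≤
      ENNReal.ofReal (3 * ρ / ε / (ε ^ 2 / 512 * ρ) ^ 2) *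
        ∫⁻ z in ball a (4 * ρ / ε) ∩ Ω, ‖fderiv ℝ u z‖ₑ := by
  set κ := ε ^ 2 / 512 with hκ
  have hκ0 : 0 < κ := by positivity
  have hκρ : 0 < κ * ρ := by positivity
  obtain ⟨γ, hγ, h0, h1, hm, hl, hc⟩ := hU a ha b hb
  have hdist : ∀ t ∈ Icc (0 : ℝ) 1, dist a (γ t) ≤ dist a b / ε := fun t ht => by
    have := (eVariationOn.edist_le γ (left_mem_Icc.2 zero_le_one) ht).trans hl
    rw [h0, edist_dist, ENNReal.ofReal_le_ofReal_iff (by positivity)] at this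
    exact this
  have hd : ∀ t ∈ Icc (0 : ℝ) 1, 4 * (κ * ρ) ≤ infDist (γ t) (frontier Ω) := by
    intro t ht
    have hε2 : ε ^ 2 * ρ ≤ ε * ρ := by
      have := mul_pos hε hρ
      nlinarith
    have hk4 : 4 * (κ * ρ) = ε ^ 2 * ρ / 128 := by rw [hκ]; ring
    rw [hk4]
    have near : ∀ e : Euc 2, ε * ρ / 32 ≤ infDist e (frontier Ω) → dist e (γ t) ≤ ε * ρ / 64 →
        ε ^ 2 * ρ / 128 ≤ infDist (γ t) (frontier Ω) := fun e he hle => by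
      have := infDist_le_infDist_add_dist (s := frontier Ω) (x := e) (y := γ t)
      have hp := mul_pos hε hρ
      linarith
    rcases le_or_gt (dist a (γ t)) (ε * ρ / 64) with h | h
    · exact near a hda h
    rcases le_or_gt (dist b (γ t)) (ε * ρ / 64) with h' | h'
    · exact near b hdb h'
    rcases eq_or_ne a b with rfl | hne
    · have := hdist t ht
      rw [dist_self, zero_div] at this
      have hp := mul_pos hε hρ
      linarith
    · have hD : 0 < dist a b := dist_pos.2 hne
      refine le_trans ?_ (hc t ht)
      rw [le_div_iff₀ hD]
      have htri := dist_triangle_right a b (γ t)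
      have hp : 0 < ε * ρ / 64 := by positivity
      have : ε * ρ / 64 * (dist a b / 2) ≤ dist a (γ t) * dist b (γ t) := by
        rcases le_total (dist a (γ t)) (dist b (γ t)) with hle | hle
        · exact mul_le_mul h.le (by linarith) (by linarith) (by linarith)
        · rw [mul_comm (dist a (γ t))]
          exact mul_le_mul h'.le (by linarith) (by linarith) (by linarith)
      calc ε ^ 2 * ρ / 128 * dist a b = ε * (ε * ρ / 64 * (dist a b / 2)) := by ring
        _ ≤ _ := by gcongr
  set I := ∫⁻ z in ball a (4 * ρ / ε) ∩ Ω, ‖fderiv ℝ u z‖ₑ with hI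
  have hstep : ∀ s ∈ Icc (0 : ℝ) 1, ∀ t ∈ Icc (0 : ℝ) 1, dist (γ s) (γ t) < κ * ρ →
      edist (ballAvg u (γ s) (κ * ρ)) (ballAvg u (γ t) (κ * ρ)) ≤
        ENNReal.ofReal ((κ * ρ) ^ 2)⁻¹ * I * edist (γ s) (γ t) := by
    intro s hs t ht hst
    have := _root_.enorm_ballAvg_sub_le (S := ball a (4 * ρ / ε)) hΩ hu (w := γ s) (w' := γ t)
      (ρ := κ * ρ) (ρ' := κ * ρ) hκρ le_rfl le_rfl ?_
    · rw [edist_comm, edist_eq_enorm_sub]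
      refine this.trans_eq ?_
      rw [sub_self, abs_zero, add_zero, div_eq_mul_inv, ENNReal.ofReal_mul dist_nonneg, edist_dist]
      ring
    · intro τ hτ v hv
      rw [sub_self, mul_zero, add_zero, mem_closedBall] at hv
      have h2 : dist (γ s + τ • (γ t - γ s)) (γ s) ≤ κ * ρ := by
        rw [dist_self_add_left, norm_smul, Real.norm_of_nonneg hτ.1, ← dist_eq_norm, dist_comm]
        nlinarith [hτ.1, hτ.2, dist_nonneg (x := γ s) (y := γ t)]
      have h3 : dist v (γ s) ≤ 2 * (κ * ρ) := by
        linarith [dist_triangle v (γ s + τ • (γ t - γ s)) (γ s)]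
      refine ⟨ball_infDist_frontier_subset (hm hs) ?_, ?_⟩
      · rw [mem_ball]
        linarith [hd s hs]
      · rw [mem_ball]
        have h4 := hdist s hs
        have h5 : dist a b / ε ≤ 3 * ρ / ε := by gcongr
        have h6 : 2 * (κ * ρ) < ρ / ε := by
          rw [lt_div_iff₀ hε, hκ]
          have : ε ^ 2 * ε ≤ 1 := by
            have := pow_le_one₀ (n := 3) hε.le hε1
            linarith [pow_succ ε 2]
          nlinarith
        have h7 := dist_triangle v (γ s) a
        rw [dist_comm (γ s) a] at h7
        have h8 : 4 * ρ / ε = 3 * ρ / ε + ρ / ε := by ring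
        linarith
  obtain ⟨δ, hδ, hδγ⟩ := Metric.uniformContinuousOn_iff.1
    (isCompact_Icc.uniformContinuousOn_of_continuous hγ) (κ * ρ) hκρ
  obtain ⟨n, hn⟩ := exists_nat_one_div_lt hδ
  set τ : ℕ → ℝ := fun i => min 1 ((i : ℝ) / ((n : ℝ) + 1)) with hτ
  have hτm : Monotone τ := fun i j hij => by
    simp only [hτ]
    gcongr
  have hτI : ∀ i, τ i ∈ Icc (0 : ℝ) 1 := fun i => ⟨le_min zero_le_one (by positivity), min_le_left _ _⟩
  have hτs : ∀ i, dist (τ i) (τ (i + 1)) < δ := fun i => by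
    refine lt_of_le_of_lt ?_ hn
    have h1 := abs_min_sub_min_le_max 1 ((i : ℝ) / ((n : ℝ) + 1)) 1 (((i + 1 : ℕ) : ℝ) / ((n : ℝ) + 1))
    rw [Real.dist_eq]
    refine h1.trans ?_
    have h2 : (i : ℝ) / ((n : ℝ) + 1) - ((i + 1 : ℕ) : ℝ) / ((n : ℝ) + 1) = -(1 / ((n : ℝ) + 1)) := by
      push_cast
      ring
    rw [sub_self, abs_zero, h2, abs_neg, abs_of_nonneg (by positivity)]
    exact max_le (by positivity) le_rfl
  have hτ0 : τ 0 = 0 := by simp [hτ]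
  have hτ1 : τ (n + 1) = 1 := by
    simp only [hτ]; push_cast; rw [div_self (by positivity), min_self]
  have hsum := eVariationOn.sum_le (f := γ) (s := Icc 0 1) (n := n + 1) hτm hτI
  calc ‖ballAvg u b (κ * ρ) - ballAvg u a (κ * ρ)‖ₑ
      = edist (ballAvg u (γ (τ 0)) (κ * ρ)) (ballAvg u (γ (τ (n + 1))) (κ * ρ)) := by
        rw [hτ0, hτ1, h0, h1, edist_comm, edist_eq_enorm_sub]
    _ ≤ ∑ i ∈ Finset.range (n + 1),
          edist (ballAvg u (γ (τ i)) (κ * ρ)) (ballAvg u (γ (τ (i + 1))) (κ * ρ)) :=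
        edist_le_range_sum_edist (fun i => ballAvg u (γ (τ i)) (κ * ρ)) _
    _ ≤ ∑ i ∈ Finset.range (n + 1),
          ENNReal.ofReal ((κ * ρ) ^ 2)⁻¹ * I * edist (γ (τ (i + 1))) (γ (τ i)) :=
        Finset.sum_le_sum fun i _ => by
          rw [edist_comm (γ (τ (i + 1)))]
          exact hstep _ (hτI i) _ (hτI (i + 1)) (hδγ _ (hτI i) _ (hτI (i + 1)) (hτs i))
    _ ≤ ENNReal.ofReal ((κ * ρ) ^ 2)⁻¹ * I * ENNReal.ofReal (3 * ρ / ε) := by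
        rw [← Finset.mul_sum]
        gcongr
        exact hsum.trans (hl.trans (ENNReal.ofReal_le_ofReal (by gcongr)))
    _ = _ := by
        rw [div_eq_mul_inv (3 * ρ / ε), ENNReal.ofReal_mul (by positivity)]
        ring

section

lemma sum_two_pow_ite_le (n : ℕ) {B : ℝ} (hB : 0 ≤ B) :
    ∑ j ∈ Finset.range n, (if (2 : ℝ) ^ j < B then (2 : ℝ) ^ j else 0) ≤ 2 * B := by
  suffices h : ∑ j ∈ Finset.range n, (if (2 : ℝ) ^ j < B then (2 : ℝ) ^ j else 0) ≤ 2 ^ n ∧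
      ∑ j ∈ Finset.range n, (if (2 : ℝ) ^ j < B then (2 : ℝ) ^ j else 0) ≤ 2 * B from h.2
  induction n with
  | zero => simpa using hB
  | succ n ih =>
    rw [Finset.sum_range_succ, pow_succ]
    have := pow_pos (two_pos : (0 : ℝ) < 2) n
    split_ifs with h
    · constructor <;> linarith
    · constructor <;> linarith

lemma tendsto_ballAvg {Ω : Set (Euc 2)} (hΩ : IsOpen Ω) {u : Euc 2 → ℝ} (hu : ContinuousOn u Ω)
    {y : Euc 2} (hy : y ∈ Ω) {w : ℕ → Euc 2} {ρ : ℕ → ℝ}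
    (hw : Filter.Tendsto w Filter.atTop (nhds y)) (hρ : Filter.Tendsto ρ Filter.atTop (nhds 0))
    (hρ0 : ∀ n, 0 ≤ ρ n) :
    Filter.Tendsto (fun n => ballAvg u (w n) (ρ n)) Filter.atTop (nhds (Real.pi * u y)) := by
  rw [Metric.tendsto_atTop]
  intro δ hδ
  have hcont := hu.continuousAt (hΩ.mem_nhds hy)
  obtain ⟨η, hη, hηu⟩ := Metric.continuousAt_iff.1 hcont (δ / 4) (by positivity)
  obtain ⟨σ, hσ, hσΩ⟩ := Metric.isOpen_iff.1 hΩ y hy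
  set m := min η σ with hm
  have hm0 : 0 < m := lt_min hη hσ
  obtain ⟨N₁, hN₁⟩ := Metric.tendsto_atTop.1 hw (m / 2) (by positivity)
  obtain ⟨N₂, hN₂⟩ := Metric.tendsto_atTop.1 hρ (m / 2) (by positivity)
  refine ⟨max N₁ N₂, fun n hn => ?_⟩
  have h1 := hN₁ n (le_of_max_le_left hn)
  have h2 := hN₂ n (le_of_max_le_right hn)
  rw [Real.dist_eq, sub_zero, abs_of_nonneg (hρ0 n)] at h2
  have hvol : volume.real (ball (0 : Euc 2) 1) = Real.pi := by
    simp [Measure.real, EuclideanSpace.volume_ball_fin_two, Real.pi_nonneg]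
  have hsub : closedBall (w n) (ρ n) ⊆ ball y m := fun v hv => by
    rw [mem_ball]
    rw [mem_closedBall] at hv
    linarith [dist_triangle v (w n) y]
  have hinteg := integrableOn_ballAvg hu (hρ0 n)
    (hsub.trans ((ball_subset_ball (min_le_right _ _)).trans hσΩ))
  have hconst : ∫ _ in ball (0 : Euc 2) 1, u y = Real.pi * u y := by
    rw [setIntegral_const, hvol, smul_eq_mul]
  rw [dist_eq_norm, ballAvg, ← hconst, ← integral_sub hinteg (integrableOn_const (by simp))]
  refine (norm_setIntegral_le_of_norm_le_const (C := δ / 4) (by simp) fun h hh => ?_).trans_lt ?_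
  · refine (hηu ?_).le
    have : w n + ρ n • h ∈ closedBall (w n) (ρ n) := by
      rw [mem_closedBall, dist_self_add_left, norm_smul, Real.norm_of_nonneg (hρ0 n)]
      rw [mem_ball_zero_iff] at hh
      nlinarith [hρ0 n]
    exact (mem_ball.1 (hsub this)).trans_le (min_le_left _ _)
  · rw [hvol]
    nlinarith [Real.pi_lt_four]

variable {Ω : Set (Euc 2)} {ε : ℝ} {u : Euc 2 → ℝ}

lemma IsUniformWith.enorm_ballAvg_half_sub_le (hε : 0 < ε) (hε1 : ε ≤ 1)
    (hU : IsUniformWith Ω ε) (hΩ : IsOpen Ω) (hu : LocallyLipschitzOnSet u Ω)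
    {a b : Euc 2} (ha : a ∈ Ω) (hb : b ∈ Ω) {ρ : ℝ} (hρ : 0 < ρ) (hab : dist a b ≤ 3 * ρ)
    (hda : ε * ρ / 32 ≤ infDist a (frontier Ω)) (hdb : ε * ρ / 32 ≤ infDist b (frontier Ω)) :
    ‖ballAvg u b (ε ^ 2 / 512 * (ρ / 2)) - ballAvg u a (ε ^ 2 / 512 * ρ)‖ₑ ≤
      ENNReal.ofReal ((3 / ε / (ε ^ 2 / 512) ^ 2 + 2 / (ε ^ 2 / 512)) * ρ⁻¹) *
        ∫⁻ z in ball a (4 * ρ / ε) ∩ Ω, ‖fderiv ℝ u z‖ₑ := by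
  have h1 := hU.enorm_ballAvg_sub_le hε hε1 hΩ hu ha hb hρ hab hda hdb
  set κ := ε ^ 2 / 512 with hκ
  have hκ0 : 0 < κ := by positivity
  have hκε : κ < ε / 64 := by rw [hκ]; nlinarith
  have hε4 : 4 * ρ ≤ 4 * ρ / ε := by rw [le_div_iff₀ hε]; nlinarith
  have hκρ : κ * ρ < ε * ρ / 64 := by nlinarith
  have h2 := _root_.enorm_ballAvg_sub_le (S := ball a (4 * ρ / ε)) hΩ hu (w := b) (w' := b)
    (ρ₀ := κ * (ρ / 2)) (ρ := κ * ρ) (ρ' := κ * (ρ / 2)) (by positivity)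
    (by nlinarith [mul_pos hκ0 hρ]) le_rfl (by
      intro t ht v hv
      rw [sub_self, smul_zero, add_zero, mem_closedBall] at hv
      have hv' : dist v b ≤ κ * ρ := by nlinarith [mul_pos hκ0 hρ, ht.1]
      refine ⟨ball_infDist_frontier_subset hb ?_, ?_⟩
      · rw [mem_ball]
        nlinarith [mul_pos hε hρ]
      · rw [mem_ball]
        have := dist_triangle v b a
        rw [dist_comm b a] at this
        nlinarith)
  calc ‖ballAvg u b (κ * (ρ / 2)) - ballAvg u a (κ * ρ)‖ₑ
      ≤ ‖ballAvg u b (κ * (ρ / 2)) - ballAvg u b (κ * ρ)‖ₑ +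
          ‖ballAvg u b (κ * ρ) - ballAvg u a (κ * ρ)‖ₑ := by
        rw [← sub_add_sub_cancel]
        exact enorm_add_le _ _
    _ ≤ _ := add_le_add h2 h1
    _ = _ := by
        rw [← add_mul, ← ENNReal.ofReal_add (by positivity) (by positivity)]
        congr 2
        rw [dist_self, show κ * (ρ / 2) - κ * ρ = -(κ * (ρ / 2)) by ring, abs_neg,
          abs_of_pos (by positivity)]
        field_simp
        ring

lemma IsUniformWith.exists_seq (hε : 0 < ε) (hU : IsUniformWith Ω ε) {y x₀ : Euc 2}
    (hy : y ∈ Ω) (hx₀ : x₀ ∈ Ω) {r : ℝ} (hr : 0 < r) (hyx : dist y x₀ ≤ 2 * r)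
    (hd : ε * r / 16 ≤ infDist x₀ (frontier Ω)) :
    ∃ Y : ℕ → Euc 2, Y 0 = x₀ ∧ ∀ j, Y j ∈ Ω ∧ dist y (Y j) ≤ 2 * (r / 2 ^ j) ∧
      ε * (r / 2 ^ j) / 16 ≤ infDist (Y j) (frontier Ω) := by
  have key : ∀ j : ℕ, ∃ z, (j = 0 → z = x₀) ∧ z ∈ Ω ∧ dist y z ≤ 2 * (r / 2 ^ j) ∧
      ε * (r / 2 ^ j) / 16 ≤ infDist z (frontier Ω) := by
    intro j
    rcases le_or_gt (dist y x₀) (2 * (r / 2 ^ j)) with h | h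
    · refine ⟨x₀, fun _ => rfl, hx₀, h, le_trans ?_ hd⟩
      gcongr
      exact div_le_self hr.le (one_le_pow₀ one_le_two)
    · obtain ⟨z, hz, hyz, hdz⟩ := hU.exists_point hε hy hx₀ (s := r / 2 ^ j) (by positivity) h.le
      have hp : 0 < r / 2 ^ j := by positivity
      refine ⟨z, fun hj => ?_, hz, by linarith, by nlinarith⟩
      subst hj
      simp only [pow_zero, div_one] at h
      linarith
  choose Y hY0 hY using key
  exact ⟨Y, hY0 0 rfl, hY⟩

/-- In a uniform domain a function is controlled by the Riesz potential of its gradient. -/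
lemma IsUniformWith.exists_enorm_sub_le_potential (hε : 0 < ε) (hε1 : ε ≤ 1)
    (hU : IsUniformWith Ω ε) (hΩ : IsOpen Ω) :
    ∃ C : ℝ, 0 < C ∧ ∃ lam : ℝ, 1 ≤ lam ∧ ∀ u : Euc 2 → ℝ, LocallyLipschitzOnSet u Ω →
      ∀ x ∈ Ω, ∀ r : ℝ, 0 < r → r < diam Ω → ∃ c : ℝ, ∀ y ∈ ball x r ∩ Ω,
        ‖u y - c‖ₑ ≤ ENNReal.ofReal C *
          ∫⁻ z in ball x (lam * r) ∩ Ω, ‖fderiv ℝ u z‖ₑ * (edist z y)⁻¹ := by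
  set κ := ε ^ 2 / 512 with hκ
  have hκ0 : 0 < κ := by positivity
  set M := 3 / ε / κ ^ 2 + 2 / κ with hM
  have hM0 : 0 < M := by positivity
  refine ⟨12 * M / ε, by positivity, 7 / ε, (one_le_div hε).2 (by linarith), ?_⟩
  intro u hu x hx r hr hrd
  obtain ⟨x', hx', hxx'⟩ : ∃ x' ∈ Ω, r / 4 ≤ dist x x' := by
    by_contra! hcon
    refine absurd (diam_le_of_forall_dist_le (C := r) hr.le fun a ha b hb => ?_) hrd.not_ge
    linarith [dist_triangle_left a b x, hcon a ha, hcon b hb]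
  obtain ⟨x₀, hx₀, hxx₀, hd₀⟩ := hU.exists_point hε hx hx' (s := r / 8) (by positivity)
    (by linarith)
  refine ⟨ballAvg u x₀ (κ * r) / Real.pi, fun y hy => ?_⟩
  obtain ⟨Y, hY0, hY⟩ := hU.exists_seq hε hy.2 hx₀ hr
    (by linarith [dist_triangle y x x₀, mem_ball.1 hy.1]) (by linarith)
  have hG : Measurable fun z => ‖fderiv ℝ u z‖ₑ := (measurable_fderiv ℝ u).enorm
  have hstep : ∀ j, edist (ballAvg u (Y j) (κ * (r / 2 ^ j)))
      (ballAvg u (Y (j + 1)) (κ * (r / 2 ^ (j + 1)))) ≤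
      ENNReal.ofReal (M * (r / 2 ^ j)⁻¹) *
        ∫⁻ z in ball y (6 * (r / 2 ^ j) / ε) ∩ Ω, ‖fderiv ℝ u z‖ₑ := by
    intro j
    have hj : 0 < r / 2 ^ j := by positivity
    have hj1 : r / 2 ^ (j + 1) = r / 2 ^ j / 2 := by rw [pow_succ]; field_simp
    obtain ⟨ha, hda, hfa⟩ := hY j
    obtain ⟨hb, hdb, hfb⟩ := hY (j + 1)
    rw [hj1] at hdb hfb ⊢
    rw [edist_comm, edist_eq_enorm_sub]
    have hp := mul_pos hε hj
    refine (hU.enorm_ballAvg_half_sub_le hε hε1 hΩ hu ha hb hj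
      (by linarith [dist_triangle_left (Y j) (Y (j + 1)) y]) (by linarith) (by linarith)).trans ?_
    gcongr
    refine ball_subset_ball' ?_
    rw [dist_comm]
    have h2 : 2 * (r / 2 ^ j) ≤ 2 * (r / 2 ^ j) / ε := by
      rw [le_div_iff₀ hε]
      nlinarith
    have h6 : 6 * (r / 2 ^ j) / ε = 4 * (r / 2 ^ j) / ε + 2 * (r / 2 ^ j) / ε := by ring
    linarith
  set P := ENNReal.ofReal (12 * M / ε) *
    ∫⁻ z in ball x (7 / ε * r) ∩ Ω, ‖fderiv ℝ u z‖ₑ * (edist z y)⁻¹ with hP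
  have hbound : ∀ n, edist (ballAvg u (Y n) (κ * (r / 2 ^ n))) (ballAvg u x₀ (κ * r)) ≤ P := by
    intro n
    calc edist (ballAvg u (Y n) (κ * (r / 2 ^ n))) (ballAvg u x₀ (κ * r))
        = edist (ballAvg u (Y 0) (κ * (r / 2 ^ 0))) (ballAvg u (Y n) (κ * (r / 2 ^ n))) := by
          rw [hY0, pow_zero, div_one, edist_comm]
      _ ≤ ∑ j ∈ Finset.range n, edist (ballAvg u (Y j) (κ * (r / 2 ^ j)))
            (ballAvg u (Y (j + 1)) (κ * (r / 2 ^ (j + 1)))) :=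
          edist_le_range_sum_edist (fun j => ballAvg u (Y j) (κ * (r / 2 ^ j))) n
      _ ≤ ∑ j ∈ Finset.range n, ENNReal.ofReal (M * (r / 2 ^ j)⁻¹) *
            ∫⁻ z in ball y (6 * (r / 2 ^ j) / ε) ∩ Ω, ‖fderiv ℝ u z‖ₑ :=
          Finset.sum_le_sum fun j _ => hstep j
      _ = ∑ j ∈ Finset.range n, ∫⁻ z in ball x (7 / ε * r) ∩ Ω, ENNReal.ofReal (M * (r / 2 ^ j)⁻¹) *
            (ball y (6 * (r / 2 ^ j) / ε)).indicator (fun z => ‖fderiv ℝ u z‖ₑ) z := by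
          refine Finset.sum_congr rfl fun j _ => ?_
          rw [lintegral_const_mul _ (hG.indicator measurableSet_ball),
            lintegral_indicator measurableSet_ball, Measure.restrict_restrict measurableSet_ball]
          suffices hsub : ball y (6 * (r / 2 ^ j) / ε) ⊆ ball x (7 / ε * r) by
            rw [← inter_assoc, inter_eq_left.2 hsub]
          refine ball_subset_ball' ?_
          have h1 : r / 2 ^ j ≤ r := div_le_self hr.le (one_le_pow₀ one_le_two)
          have h2 : 6 * (r / 2 ^ j) / ε ≤ 6 * r / ε := by gcongr
          have h3 : r ≤ r / ε := by rw [le_div_iff₀ hε]; nlinarith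
          have h4 : 7 / ε * r = 6 * r / ε + r / ε := by ring
          linarith [mem_ball.1 hy.1]
      _ = ∫⁻ z in ball x (7 / ε * r) ∩ Ω, ∑ j ∈ Finset.range n, ENNReal.ofReal (M * (r / 2 ^ j)⁻¹) *
            (ball y (6 * (r / 2 ^ j) / ε)).indicator (fun z => ‖fderiv ℝ u z‖ₑ) z :=
          (lintegral_finsetSum _ fun j _ =>
            (hG.indicator measurableSet_ball).const_mul _).symm
      _ ≤ ∫⁻ z in ball x (7 / ε * r) ∩ Ω, ENNReal.ofReal (12 * M / ε) *
            (‖fderiv ℝ u z‖ₑ * (edist z y)⁻¹) := by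
          refine lintegral_mono fun z => ?_
          rcases eq_or_ne ‖fderiv ℝ u z‖ₑ 0 with h0 | h0
          · simp [indicator, h0]
          rcases eq_or_ne z y with rfl | hzy
          · rw [edist_self, ENNReal.inv_zero, ENNReal.mul_top h0, ENNReal.mul_top]
            · exact le_top
            · rw [Ne, ENNReal.ofReal_eq_zero, not_le]
              positivity
          have ha : 0 < dist z y := dist_pos.2 hzy
          have hterm : ∀ j, ENNReal.ofReal (M * (r / 2 ^ j)⁻¹) *
              (ball y (6 * (r / 2 ^ j) / ε)).indicator (fun z => ‖fderiv ℝ u z‖ₑ) z =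
              ENNReal.ofReal (M / r * (if (2 : ℝ) ^ j < 6 * r / (ε * dist z y) then 2 ^ j else 0)) *
                ‖fderiv ℝ u z‖ₑ := by
            intro j
            have hiff : z ∈ ball y (6 * (r / 2 ^ j) / ε) ↔ (2 : ℝ) ^ j < 6 * r / (ε * dist z y) := by
              rw [mem_ball, lt_div_iff₀ hε, lt_div_iff₀ (by positivity), ← mul_div_assoc,
                lt_div_iff₀ (by positivity)]
              ring_nf
            by_cases hz : z ∈ ball y (6 * (r / 2 ^ j) / ε)
            · rw [indicator_of_mem hz, if_pos (hiff.1 hz)]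
              congr 2
              field_simp
            · rw [indicator_of_notMem hz, if_neg (hiff.not.1 hz)]
              simp
          simp_rw [hterm]
          rw [← Finset.sum_mul, ← ENNReal.ofReal_sum_of_nonneg
            (fun j _ => by split_ifs <;> positivity), ← Finset.mul_sum, mul_comm ‖fderiv ℝ u z‖ₑ,
            ← mul_assoc, edist_dist, ← ENNReal.ofReal_inv_of_pos ha,
            ← ENNReal.ofReal_mul (by positivity)]
          refine mul_le_mul_left (ENNReal.ofReal_le_ofReal ?_) _
          calc M / r * _ ≤ M / r * (2 * (6 * r / (ε * dist z y))) := by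
                gcongr
                exact sum_two_pow_ite_le n (by positivity)
            _ = _ := by
              field_simp
              ring
      _ = P := lintegral_const_mul _ (hG.mul (by fun_prop))
  have hpow : Filter.Tendsto (fun n : ℕ => r / (2 : ℝ) ^ n) Filter.atTop (nhds 0) :=
    tendsto_const_nhds.div_atTop (tendsto_pow_atTop_atTop_of_one_lt one_lt_two)
  have hlim := tendsto_ballAvg hΩ (LocallyLipschitzOn.continuousOn hu) hy.2
    (w := Y) (ρ := fun n => κ * (r / 2 ^ n)) ?_ ?_ (fun n => by positivity)
  · have h := le_of_tendsto (hlim.edist tendsto_const_nhds) (Filter.Eventually.of_forall hbound)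
    refine le_trans ?_ h
    have hpi := Real.pi_pos
    rw [edist_eq_enorm_sub, show Real.pi * u y - ballAvg u x₀ (κ * r) =
      Real.pi * (u y - ballAvg u x₀ (κ * r) / Real.pi) by field_simp, enorm_mul]
    refine le_mul_of_one_le_left' ?_
    rw [← ofReal_norm, Real.norm_of_nonneg hpi.le, ENNReal.one_le_ofReal]
    linarith [Real.pi_gt_three]
  · have h2 := hpow.const_mul 2
    rw [mul_zero] at h2
    exact tendsto_iff_dist_tendsto_zero.2
      (squeeze_zero (fun _ => dist_nonneg) (fun n => (dist_comm _ _).trans_le (hY n).2.1) h2)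
  · simpa using hpow.const_mul κ

end

lemma exists_lintegral_compl_ball_mul_inv_edist_le {p : ℝ} (hp1 : 1 ≤ p) (hp2 : p < 2) :
    ∃ A : ℝ, 0 < A ∧ ∀ f : Euc 2 → ℝ≥0∞, Measurable f → ∀ (y : Euc 2) (R : ℝ), 0 < R →
      ∫⁻ z in (ball y R)ᶜ, f z * (edist z y)⁻¹ ≤
        ENNReal.ofReal (A * R ^ (1 - 2 / p)) * (∫⁻ z, f z ^ p) ^ (1 / p) := by
  rcases hp1.eq_or_lt with rfl | hp1'
  · refine ⟨1, one_pos, fun f hf y R hR => ?_⟩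
    rw [show (1 : ℝ) - 2 / 1 = -1 by norm_num, Real.rpow_neg_one, one_mul, one_div_one,
      ENNReal.rpow_one]
    simp_rw [ENNReal.rpow_one]
    calc ∫⁻ z in (ball y R)ᶜ, f z * (edist z y)⁻¹
        ≤ ∫⁻ z in (ball y R)ᶜ, ENNReal.ofReal R⁻¹ * f z := by
          refine setLIntegral_mono (by fun_prop) fun z hz => ?_
          rw [mul_comm, edist_dist, ENNReal.ofReal_inv_of_pos hR]
          gcongr
          simpa using hz
      _ ≤ ∫⁻ z, ENNReal.ofReal R⁻¹ * f z := setLIntegral_le_lintegral _ _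
      _ = _ := lintegral_const_mul _ hf
  · have hconj := Real.HolderConjugate.conjExponent hp1'
    set s := p.conjExponent with hs
    have hs0 : 0 < s := hconj.symm.pos
    have hinv : s⁻¹ = 1 - p⁻¹ := by linarith [hconj.inv_add_inv_eq_one]
    have hs2 : 2 < s := by
      have : s⁻¹ < 2⁻¹ := by
        rw [hinv]
        have : 2⁻¹ < p⁻¹ := by gcongr
        linarith
      exact (inv_lt_inv₀ hs0 two_pos).1 this
    refine ⟨(2 * Real.pi / (s - 2)) ^ (1 / s), ?_, fun f hf y R hR => ?_⟩
    · have := sub_pos.2 hs2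
      positivity
    have h0 : 0 ≤ 2 * Real.pi / (s - 2) := by
      have := sub_pos.2 hs2
      positivity
    refine (ENNReal.lintegral_mul_le_Lp_mul_Lq _ hconj hf.aemeasurable
      (g := fun z => (edist z y)⁻¹) (by fun_prop)).trans ?_
    rw [lintegral_compl_ball_inv_edist_rpow y hR hs2, mul_comm,
      ENNReal.ofReal_rpow_of_nonneg (by positivity) (by positivity),
      Real.mul_rpow h0 (by positivity), ← Real.rpow_mul hR.le]
    have : (2 - s) * (1 / s) = 1 - 2 / p := by
      rw [sub_mul, mul_one_div_cancel hs0.ne', one_div, hinv]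
      ring
    rw [this]
    gcongr
    exact Measure.restrict_le_self

/-- The kernel of the truncated Riesz potential. -/
def rieszKernel (R : ℝ) (z y : Euc 2) : ℝ≥0∞ := (ball y R).indicator (fun z => (edist z y)⁻¹) z

lemma measurable_rieszKernel (R : ℝ) :
    Measurable (Function.uncurry (rieszKernel R)) := by
  classical
  have : Function.uncurry (rieszKernel R) =
      {q : Euc 2 × Euc 2 | dist q.1 q.2 < R}.indicator fun q => (edist q.1 q.2)⁻¹ := by
    ext q
    simp [Function.uncurry, rieszKernel, indicator_apply]
  rw [this]
  exact Measurable.indicator (by fun_prop) (measurableSet_lt (by fun_prop) (by fun_prop))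

lemma measurable_rieszKernel_left (R : ℝ) (y : Euc 2) : Measurable fun z => rieszKernel R z y :=
  (measurable_rieszKernel R).of_uncurry_right

lemma measurable_rieszKernel_right (R : ℝ) (z : Euc 2) : Measurable (rieszKernel R z) :=
  (measurable_rieszKernel R).of_uncurry_left

lemma lintegral_rieszKernel_left (y : Euc 2) {R : ℝ} (hR : 0 ≤ R) :
    ∫⁻ z, rieszKernel R z y = ENNReal.ofReal (2 * Real.pi * R) := by
  rw [← lintegral_ball_inv_edist y hR, ← lintegral_indicator measurableSet_ball]
  rfl

lemma lintegral_rieszKernel_right (z : Euc 2) {R : ℝ} (hR : 0 ≤ R) :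
    ∫⁻ y, rieszKernel R z y = ENNReal.ofReal (2 * Real.pi * R) := by
  rw [← lintegral_rieszKernel_left z hR]
  refine lintegral_congr fun y => ?_
  classical
  simp only [rieszKernel, indicator_apply, mem_ball, dist_comm y z, edist_comm y z]

lemma rpow_lintegral_mul_le {α : Type*} [MeasurableSpace α] {μ : Measure α} {f k : α → ℝ≥0∞}
    (hf : Measurable f) (hk : Measurable k) {p : ℝ} (hp : 1 ≤ p) :
    (∫⁻ z, f z * k z ∂μ) ^ p ≤ (∫⁻ z, f z ^ p * k z ∂μ) * (∫⁻ z, k z ∂μ) ^ (p - 1) := by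
  have hp0 : 0 < p := by linarith
  have h := eLpNorm'_le_eLpNorm'_mul_rpow_measure_univ (μ := μ.withDensity k) (f := f) one_pos hp
    hf.aestronglyMeasurable
  simp only [eLpNorm', enorm_eq_self, ENNReal.rpow_one, div_one] at h
  rw [lintegral_withDensity_eq_lintegral_mul _ hk hf,
    lintegral_withDensity_eq_lintegral_mul _ hk (hf.pow_const p),
    withDensity_apply _ MeasurableSet.univ, Measure.restrict_univ] at h
  have h2 := ENNReal.rpow_le_rpow h hp0.le
  rw [ENNReal.mul_rpow_of_nonneg _ _ hp0.le, ← ENNReal.rpow_mul, ← ENNReal.rpow_mul,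
    one_div_mul_cancel hp0.ne', ENNReal.rpow_one, sub_mul, one_div_mul_cancel hp0.ne', one_mul] at h2
  simpa [mul_comm] using h2

lemma lintegral_rpow_truncated_potential_le {f : Euc 2 → ℝ≥0∞} (hf : Measurable f) {p : ℝ}
    (hp : 1 ≤ p) {R : ℝ} (hR : 0 ≤ R) :
    ∫⁻ y, (∫⁻ z, f z * rieszKernel R z y) ^ p ≤
      ENNReal.ofReal (2 * Real.pi * R) ^ p * ∫⁻ z, f z ^ p := by
  have hk := measurable_rieszKernel R
  calc ∫⁻ y, (∫⁻ z, f z * rieszKernel R z y) ^ p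
      ≤ ∫⁻ y, (∫⁻ z, f z ^ p * rieszKernel R z y) *
          ENNReal.ofReal (2 * Real.pi * R) ^ (p - 1) := by
        refine lintegral_mono fun y => ?_
        rw [← lintegral_rieszKernel_left y hR]
        exact rpow_lintegral_mul_le hf (measurable_rieszKernel_left R y) hp
    _ = (∫⁻ z, f z ^ p * ENNReal.ofReal (2 * Real.pi * R)) *
          ENNReal.ofReal (2 * Real.pi * R) ^ (p - 1) := by
        rw [lintegral_mul_const', lintegral_lintegral_swap]
        · congr 1
          refine lintegral_congr fun z => ?_
          rw [lintegral_const_mul _ (measurable_rieszKernel_right R z),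
            lintegral_rieszKernel_right z hR]
        · have hfk : Measurable (((fun z => f z ^ p) ∘ Prod.snd) *
              (Function.uncurry (rieszKernel R) ∘ Prod.swap)) :=
            ((hf.pow_const p).comp measurable_snd).mul (hk.comp measurable_swap)
          exact hfk.aemeasurable
        · exact ENNReal.rpow_ne_top_of_nonneg (by linarith) ENNReal.ofReal_ne_top
    _ = _ := by
        rw [lintegral_mul_const _ (hf.pow_const p), mul_assoc, mul_comm]
        congr 1
        nth_rw 1 [← ENNReal.rpow_one (ENNReal.ofReal _)]
        rw [← ENNReal.rpow_add_of_nonneg _ _ zero_le_one (by linarith)]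
        ring_nf

/-- The weak type estimate for the Riesz potential of order one in the plane. -/
lemma exists_volume_potential_gt_le {p q : ℝ} (hp1 : 1 ≤ p) (hp2 : p < 2)
    (hq : q = 2 * p / (2 - p)) :
    ∃ K : ℝ, 0 < K ∧ ∀ f : Euc 2 → ℝ≥0∞, Measurable f → ∀ t : ℝ, 0 < t →
      volume {y | ENNReal.ofReal t < ∫⁻ z, f z * (edist z y)⁻¹} ≤
        ENNReal.ofReal (K / t ^ q) * (∫⁻ z, f z ^ p) ^ (q / p) := by
  obtain ⟨A, hA, hlarge⟩ := exists_lintegral_compl_ball_mul_inv_edist_le hp1 hp2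
  have hp0 : 0 < p := by linarith
  have h2p : 0 < 2 - p := by linarith
  have hq0 : 0 < q := hq ▸ by positivity
  refine ⟨(4 * Real.pi) ^ p * (2 * A) ^ (q / 2 * p), by positivity, fun f hf t ht => ?_⟩
  set E := ∫⁻ z, f z ^ p with hE
  rcases eq_or_ne E ⊤ with htop | htop
  · rw [htop, ENNReal.top_rpow_of_pos (by positivity), ENNReal.mul_top]
    · exact le_top
    · rw [Ne, ENNReal.ofReal_eq_zero, not_le]
      positivity
  rcases eq_or_ne E 0 with hzero | hzero
  · have hf0 : f =ᵐ[volume] 0 := by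
      have := (lintegral_eq_zero_iff (hf.pow_const p)).1 hzero
      filter_upwards [this] with z hz
      simpa [hp0, hp0.le, hp0.not_gt] using hz
    have : {y | ENNReal.ofReal t < ∫⁻ z, f z * (edist z y)⁻¹} = ∅ := by
      refine eq_empty_of_forall_notMem fun y hy => ?_
      rw [mem_ofPred_eq, lintegral_congr_ae (g := fun _ => 0)] at hy
      · simp at hy
      · filter_upwards [hf0] with z hz
        simp [hz]
    simp [this]
  obtain ⟨e, he, hEe⟩ : ∃ e : ℝ, 0 < e ∧ E = ENNReal.ofReal e :=
    ⟨E.toReal, ENNReal.toReal_pos hzero htop, (ENNReal.ofReal_toReal htop).symm⟩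
  set R := (2 * A * e ^ (1 / p) / t) ^ (q / 2) with hR
  have hR0 : 0 < R := by positivity
  have hlarge' : ∀ y, ∫⁻ z in (ball y R)ᶜ, f z * (edist z y)⁻¹ ≤ ENNReal.ofReal (t / 2) := by
    intro y
    refine (hlarge f hf y R hR0).trans ?_
    rw [← hE, hEe, ENNReal.ofReal_rpow_of_pos he, ← ENNReal.ofReal_mul (by positivity)]
    refine ENNReal.ofReal_le_ofReal (le_of_eq ?_)
    have : q / 2 * (1 - 2 / p) = -1 := by
      rw [hq]
      field_simp
      ring
    rw [hR, ← Real.rpow_mul (by positivity), this, Real.rpow_neg_one]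
    field_simp
  have hT : Measurable fun y => ∫⁻ z, f z * rieszKernel R z y :=
    Measurable.lintegral_prod_left'
      (f := (f ∘ Prod.fst) * Function.uncurry (rieszKernel R))
      ((hf.comp measurable_fst).mul (measurable_rieszKernel R))
  have hsub : {y | ENNReal.ofReal t < ∫⁻ z, f z * (edist z y)⁻¹} ⊆
      {y | ENNReal.ofReal (t / 2) ^ p ≤ (∫⁻ z, f z * rieszKernel R z y) ^ p} := by
    intro y hy
    rw [mem_ofPred_eq] at hy ⊢
    refine ENNReal.rpow_le_rpow ?_ hp0.le
    by_contra! hcon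
    refine hy.not_ge ?_
    rw [← lintegral_add_compl _ (measurableSet_ball (x := y) (ε := R)), ← add_halves t,
      ENNReal.ofReal_add (by positivity) (by positivity)]
    refine add_le_add (le_of_eq_of_le ?_ hcon.le) (hlarge' y)
    rw [← lintegral_indicator measurableSet_ball]
    refine lintegral_congr fun z => ?_
    by_cases hz : z ∈ ball y R <;> simp [rieszKernel, hz]
  calc volume _ ≤ _ := measure_mono hsub
    _ ≤ (∫⁻ y, (∫⁻ z, f z * rieszKernel R z y) ^ p) / ENNReal.ofReal (t / 2) ^ p :=
      meas_ge_le_lintegral_div (hT.pow_const p).aemeasurable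
        (by simp [ht, hp0.not_gt]) (ENNReal.rpow_ne_top_of_nonneg hp0.le ENNReal.ofReal_ne_top)
    _ ≤ ENNReal.ofReal (2 * Real.pi * R) ^ p * E / ENNReal.ofReal (t / 2) ^ p := by
      gcongr
      exact lintegral_rpow_truncated_potential_le hf hp1 hR0.le
    _ = _ := by
      rw [hEe, ENNReal.ofReal_rpow_of_pos (by positivity), ENNReal.ofReal_rpow_of_pos (by positivity),
        ENNReal.ofReal_rpow_of_pos (by positivity), ← ENNReal.ofReal_mul (by positivity),
        ← ENNReal.ofReal_div_of_pos (by positivity), ← ENNReal.ofReal_mul (by positivity)]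
      congr 1
      have h1 : R ^ p = (2 * A) ^ (q / 2 * p) * e ^ (q / 2) / t ^ (q / 2 * p) := by
        rw [hR, ← Real.rpow_mul (by positivity), Real.div_rpow (by positivity) ht.le,
          Real.mul_rpow (by positivity) (by positivity), ← Real.rpow_mul he.le]
        congr 3
        field_simp
      have h2 : t ^ q = t ^ (q / 2 * p) * t ^ p := by
        rw [← Real.rpow_add ht]
        congr 1
        rw [hq]
        field_simp
        ring
      have h3 : e ^ (q / p) = e ^ (q / 2) * e := by
        rw [← Real.rpow_add_one he.ne']
        congr 1
        rw [hq]
        field_simp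
        ring
      rw [Real.mul_rpow (by positivity) hR0.le, h1, h2, h3, Real.div_rpow ht.le two_pos.le,
        show 4 * Real.pi = 2 * Real.pi * 2 by ring, Real.mul_rpow (by positivity) two_pos.le]
      field_simp

/-- The truncation of `|s - c|` between the levels `t` and `2 * t`, shifted to start at `0`. -/
def levelTrunc (c t s : ℝ) : ℝ := min (max (|s - c| - t) 0) t

lemma lipschitzWith_levelTrunc (c t : ℝ) : LipschitzWith 1 (levelTrunc c t) := by
  refine LipschitzWith.min_const (LipschitzWith.max_const ?_ 0) t
  refine LipschitzWith.of_dist_le_mul fun a b => ?_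
  rw [NNReal.coe_one, one_mul, Real.dist_eq, Real.dist_eq, sub_sub_sub_cancel_right]
  refine (abs_abs_sub_abs_le _ _).trans_eq ?_
  rw [sub_sub_sub_cancel_right]

lemma levelTrunc_eq_zero {c t s : ℝ} (ht : 0 ≤ t) (h : |s - c| ≤ t) : levelTrunc c t s = 0 := by
  rw [levelTrunc, max_eq_right (by linarith), min_eq_left ht]

lemma levelTrunc_eq_self {c t s : ℝ} (h : 2 * t ≤ |s - c|) : levelTrunc c t s = t := by
  rw [levelTrunc, min_eq_right]
  exact le_max_of_le_left (by linarith)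

lemma LocallyLipschitzOnSet.lipschitzWith_comp {n : ℕ} {Ω : Set (Euc n)} {u : Euc n → ℝ}
    (hu : LocallyLipschitzOnSet u Ω) {φ : ℝ → ℝ} {L : ℝ≥0} (hφ : LipschitzWith L φ) :
    LocallyLipschitzOnSet (φ ∘ u) Ω := fun x hx =>
  let ⟨K, s, hs, hK⟩ := hu x hx
  ⟨L * K, s, hs, hφ.comp_lipschitzOnWith hK⟩

lemma fderiv_levelTrunc_comp_eq_zero {u : Euc 2 → ℝ} {c t : ℝ} (ht : 0 ≤ t) {y : Euc 2}
    (h : |u y - c| ≤ t ∨ 2 * t ≤ |u y - c|) : fderiv ℝ (levelTrunc c t ∘ u) y = 0 := by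
  rcases h with h | h
  · refine IsLocalMin.fderiv_eq_zero (Filter.Eventually.of_forall fun z => ?_)
    rw [Function.comp_apply, levelTrunc_eq_zero ht h]
    exact le_min (le_max_right _ _) ht
  · refine IsLocalMax.fderiv_eq_zero (Filter.Eventually.of_forall fun z => ?_)
    rw [Function.comp_apply, Function.comp_apply, levelTrunc_eq_self h]
    exact min_le_right _ _

lemma enorm_fderiv_levelTrunc_comp {u : Euc 2 → ℝ} {c t : ℝ} (ht : 0 ≤ t) {y : Euc 2}
    (hu : ContinuousAt u y) (h : t < |u y - c|) (h' : |u y - c| < 2 * t) :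
    ‖fderiv ℝ (levelTrunc c t ∘ u) y‖ₑ = ‖fderiv ℝ u y‖ₑ := by
  have hc : ContinuousAt (fun z => |u z - c|) y := (hu.sub continuousAt_const).abs
  have hev : levelTrunc c t ∘ u =ᶠ[nhds y] fun z => |u z - c| - t := by
    filter_upwards [hc.eventually_lt_const h', hc.eventually_const_lt h] with z hz hz'
    rw [Function.comp_apply, levelTrunc, max_eq_left (by linarith), min_eq_left (by linarith)]
  rw [hev.fderiv_eq, fderiv_sub_const]
  have hne : u y - c ≠ 0 := abs_pos.1 (ht.trans_lt h)
  rcases hne.lt_or_gt with hneg | hpos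
  · have : (fun z => |u z - c|) =ᶠ[nhds y] fun z => -(u z - c) := by
      filter_upwards [(hu.sub continuousAt_const).eventually_lt_const hneg] with z hz
      exact abs_of_neg hz
    rw [this.fderiv_eq, fderiv_fun_neg, fderiv_sub_const, enorm_neg]
  · have : (fun z => |u z - c|) =ᶠ[nhds y] fun z => u z - c := by
      filter_upwards [(hu.sub continuousAt_const).eventually_const_lt hpos] with z hz
      exact abs_of_pos hz
    rw [this.fderiv_eq, fderiv_sub_const]

lemma tsum_enorm_fderiv_levelTrunc_le {u : Euc 2 → ℝ} {c t p : ℝ} (ht : 0 < t) (hp : 0 < p)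
    {y : Euc 2} (hu : ContinuousAt u y) :
    ∑' k : ℕ, ‖fderiv ℝ (levelTrunc c (t * 2 ^ k) ∘ u) y‖ₑ ^ p ≤ ‖fderiv ℝ u y‖ₑ ^ p := by
  have hzero : ∀ k : ℕ, ¬ (t * 2 ^ k < |u y - c| ∧ |u y - c| < 2 * (t * 2 ^ k)) →
      ‖fderiv ℝ (levelTrunc c (t * 2 ^ k) ∘ u) y‖ₑ ^ p = 0 := fun k hk => by
    have : |u y - c| ≤ t * 2 ^ k ∨ 2 * (t * 2 ^ k) ≤ |u y - c| := by
      by_contra! hcon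
      exact hk hcon
    rw [fderiv_levelTrunc_comp_eq_zero (by positivity) this, ← ofReal_norm, norm_zero,
      ENNReal.ofReal_zero, ENNReal.zero_rpow_of_pos hp]
  by_cases hex : ∃ k : ℕ, t * 2 ^ k < |u y - c| ∧ |u y - c| < 2 * (t * 2 ^ k)
  · obtain ⟨k, hk, hk'⟩ := hex
    rw [tsum_eq_single k, enorm_fderiv_levelTrunc_comp (by positivity) hu hk hk']
    intro j hj
    refine hzero j fun ⟨h1, h2⟩ => ?_
    have hstep : ∀ {a b : ℕ}, a < b → 2 * (t * 2 ^ a) ≤ t * (2 : ℝ) ^ b := fun {a b} hab => by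
      have := pow_le_pow_right₀ (one_le_two (α := ℝ)) (Nat.succ_le_of_lt hab)
      rw [Nat.succ_eq_add_one, pow_succ] at this
      nlinarith
    rcases hj.lt_or_gt with hlt | hlt
    · linarith [hstep hlt]
    · linarith [hstep hlt]
  · push Not at hex
    rw [ENNReal.tsum_eq_zero.2 fun k => hzero k fun h => (hex k h.1).not_gt h.2]
    exact zero_le

lemma rpow_le_add_tsum_indicator {v t q : ℝ} (ht : 0 < t) (hq : 0 < q) :
    ENNReal.ofReal v ^ q ≤ ENNReal.ofReal (2 * t) ^ q +
      ∑' k : ℕ, ENNReal.ofReal (4 * (t * 2 ^ k)) ^ q *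
        {s : ℝ | 2 * (t * 2 ^ k) ≤ s}.indicator (fun _ => 1) v := by
  rcases lt_or_ge v (2 * t) with h | h
  · exact le_add_right (by gcongr)
  · obtain ⟨k, hk, hk'⟩ := exists_nat_pow_near (x := v / (2 * t)) (y := 2)
      ((one_le_div (by positivity)).2 h) one_lt_two
    rw [le_div_iff₀ (by positivity)] at hk
    rw [div_lt_iff₀ (by positivity), pow_succ] at hk'
    refine le_add_left (le_trans ?_ (ENNReal.le_tsum k))
    rw [indicator_of_mem (by rw [mem_ofPred_eq]; linarith), mul_one]
    gcongr
    linarith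

lemma tsum_rpow_le_rpow {a : ℕ → ℝ≥0∞} {E : ℝ≥0∞} (h : ∑' k, a k ≤ E) {s : ℝ} (hs : 1 ≤ s) :
    ∑' k, a k ^ s ≤ E ^ s := by
  have hpow : ∀ x : ℝ≥0∞, x ^ s = x * x ^ (s - 1) := fun x => by
    nth_rw 2 [← ENNReal.rpow_one x]
    rw [← ENNReal.rpow_add_of_nonneg _ _ zero_le_one (by linarith), add_sub_cancel]
  calc ∑' k, a k ^ s ≤ ∑' k, a k * E ^ (s - 1) := by
        refine ENNReal.tsum_le_tsum fun k => ?_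
        rw [hpow]
        have := (ENNReal.le_tsum k).trans h
        gcongr
    _ = (∑' k, a k) * E ^ (s - 1) := ENNReal.tsum_mul_right
    _ ≤ E * E ^ (s - 1) := by gcongr
    _ = E ^ s := (hpow E).symm

/-- Maz'ya's truncation argument: a weak type Sobolev–Poincaré inequality valid for all locally
Lipschitz functions implies the strong type inequality. -/
lemma exists_lintegral_rpow_sub_le_of_weak {Ω D S : Set (Euc 2)} (hΩ : IsOpen Ω) (hD : IsOpen D)
    (hDΩ : D ⊆ Ω) (hDne : D.Nonempty) (hDfin : volume D ≠ ⊤) (hSΩ : S ⊆ Ω)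
    {K p q : ℝ} (hK : 0 < K) (hp : 0 < p) (hpq : p ≤ q)
    (hW : ∀ u : Euc 2 → ℝ, LocallyLipschitzOnSet u Ω → ∃ c : ℝ, ∀ t : ℝ, 0 < t →
      volume {y ∈ D | t < |u y - c|} ≤
        ENNReal.ofReal (K / t ^ q) * (∫⁻ z in S, ‖fderiv ℝ u z‖ₑ ^ p) ^ (q / p))
    {u : Euc 2 → ℝ} (hu : LocallyLipschitzOnSet u Ω) :
    ∃ c : ℝ, ∫⁻ y in D, ENNReal.ofReal |u y - c| ^ q ≤
      ENNReal.ofReal (2 ^ q * (2 * K) + 2 * 12 ^ q * K) *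
        (∫⁻ z in S, ‖fderiv ℝ u z‖ₑ ^ p) ^ (q / p) := by
  have hq : 0 < q := hp.trans_le hpq
  have hs : 1 ≤ q / p := (one_le_div hp).2 hpq
  have hcont : ContinuousOn u Ω := LocallyLipschitzOn.continuousOn hu
  obtain ⟨c, hc⟩ := hW u hu
  refine ⟨c, ?_⟩
  set E := ∫⁻ z in S, ‖fderiv ℝ u z‖ₑ ^ p with hE
  rcases eq_or_ne (E ^ (q / p)) ⊤ with htop | htop
  · rw [htop, ENNReal.mul_top]
    · exact le_top
    · rw [Ne, ENNReal.ofReal_eq_zero, not_le]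
      positivity
  rcases eq_or_ne (E ^ (q / p)) 0 with hzero | hzero
  · rw [hzero, mul_zero, nonpos_iff_eq_zero]
    refine (setLIntegral_congr_fun_ae (g := fun _ => 0) hD.measurableSet ?_).trans (by simp)
    have hnull : volume (⋃ n : ℕ, {y ∈ D | 1 / ((n : ℝ) + 1) < |u y - c|}) = 0 := by
      refine measure_iUnion_null fun n => ?_
      have := hc (1 / ((n : ℝ) + 1)) (by positivity)
      rwa [hzero, mul_zero, nonpos_iff_eq_zero] at this
    filter_upwards [compl_mem_ae_iff.2 hnull] with y hy hyD
    have : |u y - c| = 0 := by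
      by_contra hne
      obtain ⟨n, hn⟩ := exists_nat_one_div_lt ((abs_nonneg _).lt_of_ne' hne)
      exact hy (mem_iUnion.2 ⟨n, hyD, hn⟩)
    simp [this, hq]
  obtain ⟨e, he, hEe⟩ : ∃ e : ℝ, 0 < e ∧ E ^ (q / p) = ENNReal.ofReal e :=
    ⟨_, ENNReal.toReal_pos hzero htop, (ENNReal.ofReal_toReal htop).symm⟩
  obtain ⟨μ, hμ, hDμ⟩ : ∃ μ : ℝ, 0 < μ ∧ volume D = ENNReal.ofReal μ :=
    ⟨_, ENNReal.toReal_pos (hD.measure_pos volume hDne).ne' hDfin, (ENNReal.ofReal_toReal hDfin).symm⟩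
  set t₀ := (2 * K * e / μ) ^ (1 / q) with ht₀
  have ht₀0 : 0 < t₀ := by positivity
  have ht₀q : t₀ ^ q = 2 * K * e / μ := by
    rw [ht₀, ← Real.rpow_mul (by positivity), one_div_mul_cancel hq.ne', Real.rpow_one]
  have hhalf : volume D / 2 ≤ volume {y ∈ D | |u y - c| ≤ t₀} := by
    have h1 : volume {y ∈ D | t₀ < |u y - c|} ≤ volume D / 2 := by
      refine (hc t₀ ht₀0).trans_eq ?_
      rw [hEe, ht₀q, ← ENNReal.ofReal_mul (by positivity), hDμ, ← ENNReal.ofReal_ofNat 2,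
        ← ENNReal.ofReal_div_of_pos two_pos]
      congr 1
      field_simp
    have h2 : volume D ≤ volume {y ∈ D | |u y - c| ≤ t₀} + volume {y ∈ D | t₀ < |u y - c|} := by
      refine (measure_mono fun y hy => ?_).trans (measure_union_le _ _)
      rcases le_or_gt |u y - c| t₀ with h | h
      · exact Or.inl ⟨hy, h⟩
      · exact Or.inr ⟨hy, h⟩
    have h3 : volume D / 2 ≠ ⊤ := (ENNReal.div_lt_top hDfin two_ne_zero).ne
    refine ENNReal.le_of_add_le_add_right h3 ?_
    rw [ENNReal.add_halves]
    exact h2.trans (by gcongr)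
  set E' : ℕ → ℝ≥0∞ := fun k => ∫⁻ z in S, ‖fderiv ℝ (levelTrunc c (t₀ * 2 ^ k) ∘ u) z‖ₑ ^ p
    with hE'
  have hlevel : ∀ k : ℕ, volume {y ∈ D | 2 * (t₀ * 2 ^ k) ≤ |u y - c|} ≤
      2 * (ENNReal.ofReal (K / (t₀ * 2 ^ k / 3) ^ q) * E' k ^ (q / p)) := by
    intro k
    have htk : 0 < t₀ * 2 ^ k := by positivity
    obtain ⟨b, hb⟩ := hW _ (hu.lipschitzWith_comp (lipschitzWith_levelTrunc c (t₀ * 2 ^ k)))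
    refine le_trans ?_ (mul_le_mul_right (hb (t₀ * 2 ^ k / 3) (by positivity)) 2)
    rcases le_or_gt |b| (t₀ * 2 ^ k / 2) with hbk | hbk
    · refine le_trans (measure_mono ?_) (le_mul_of_one_le_left' one_le_two)
      rintro y ⟨hyD, hy⟩
      refine ⟨hyD, ?_⟩
      rw [Function.comp_apply, levelTrunc_eq_self hy]
      have := le_abs_self (t₀ * 2 ^ k - b)
      have := le_abs_self b
      linarith
    · calc volume {y ∈ D | 2 * (t₀ * 2 ^ k) ≤ |u y - c|} ≤ volume D :=
            measure_mono (sep_subset _ _)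
        _ = 2 * (volume D / 2) := (ENNReal.mul_div_cancel two_ne_zero ENNReal.ofNat_ne_top).symm
        _ ≤ 2 * volume {y ∈ D | |u y - c| ≤ t₀} := by gcongr
        _ ≤ _ := by
          refine mul_le_mul_right (measure_mono ?_) 2
          rintro y ⟨hyD, hy⟩
          refine ⟨hyD, ?_⟩
          have : t₀ ≤ t₀ * 2 ^ k := le_mul_of_one_le_right ht₀0.le (one_le_pow₀ one_le_two)
          rw [Function.comp_apply, levelTrunc_eq_zero htk.le (hy.trans this), zero_sub, abs_neg]
          linarith
  have hmeas : ∀ s : ℝ, MeasurableSet {y ∈ D | s ≤ |u y - c|} := by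
    intro s
    have : {y ∈ D | s ≤ |u y - c|} = D \ (D ∩ (fun y => |u y - c|) ⁻¹' Iio s) := by
      ext y
      simp
    rw [this]
    exact hD.measurableSet.diff (((hcont.mono hDΩ).sub continuousOn_const).abs.isOpen_inter_preimage
      hD isOpen_Iio).measurableSet
  have hsumE : ∑' k, E' k ≤ E := by
    rw [← lintegral_tsum fun k => (measurable_fderiv ℝ _).enorm.pow_const p |>.aemeasurable]
    exact setLIntegral_mono ((measurable_fderiv ℝ u).enorm.pow_const p) fun y hy =>
      tsum_enorm_fderiv_levelTrunc_le ht₀0 hp (hcont.continuousAt (hΩ.mem_nhds (hSΩ hy)))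
  calc ∫⁻ y in D, ENNReal.ofReal |u y - c| ^ q
      ≤ ∫⁻ y in D, (ENNReal.ofReal (2 * t₀) ^ q + ∑' k : ℕ, ENNReal.ofReal (4 * (t₀ * 2 ^ k)) ^ q *
          {y ∈ D | 2 * (t₀ * 2 ^ k) ≤ |u y - c|}.indicator (fun _ => 1) y) := by
        refine setLIntegral_mono' hD.measurableSet fun y hy => ?_
        refine (rpow_le_add_tsum_indicator ht₀0 hq).trans_eq ?_
        classical
        simp only [indicator_apply, mem_ofPred_eq, hy, true_and]
    _ = ENNReal.ofReal (2 * t₀) ^ q * volume D + ∑' k : ℕ, ENNReal.ofReal (4 * (t₀ * 2 ^ k)) ^ q *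
          volume {y ∈ D | 2 * (t₀ * 2 ^ k) ≤ |u y - c|} := by
        rw [lintegral_add_left measurable_const, setLIntegral_const, lintegral_tsum fun k =>
          ((measurable_const.indicator (hmeas _)).const_mul _).aemeasurable]
        congr 2 with k
        rw [lintegral_const_mul _ (measurable_const.indicator (hmeas _)),
          lintegral_indicator_const (hmeas _), one_mul, Measure.restrict_apply (hmeas _),
          inter_eq_left.2 (sep_subset _ _)]
    _ ≤ ENNReal.ofReal (2 ^ q * (2 * K)) * E ^ (q / p) +
          ∑' k : ℕ, ENNReal.ofReal (2 * 12 ^ q * K) * E' k ^ (q / p) := by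
        refine add_le_add (le_of_eq ?_) (ENNReal.tsum_le_tsum fun k => ?_)
        · rw [hEe, hDμ, ENNReal.ofReal_rpow_of_pos (by positivity), ← ENNReal.ofReal_mul (by positivity),
            ← ENNReal.ofReal_mul (by positivity), Real.mul_rpow two_pos.le ht₀0.le, ht₀q]
          congr 1
          field_simp
        · refine (mul_le_mul_right (hlevel k) _).trans_eq ?_
          rw [← ENNReal.ofReal_ofNat 2, ← mul_assoc, ← mul_assoc,
            ENNReal.ofReal_rpow_of_pos (by positivity), ← ENNReal.ofReal_mul (by positivity),
            ← ENNReal.ofReal_mul (by positivity)]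
          congr 2
          have h12 : (12 : ℝ) ^ q = 4 ^ q * 3 ^ q := by
            rw [← Real.mul_rpow (by norm_num) (by norm_num)]
            norm_num
          rw [h12, Real.mul_rpow (by positivity) (by positivity),
            Real.div_rpow (by positivity) (by positivity)]
          field_simp
    _ ≤ ENNReal.ofReal (2 ^ q * (2 * K)) * E ^ (q / p) +
          ENNReal.ofReal (2 * 12 ^ q * K) * E ^ (q / p) := by
        rw [ENNReal.tsum_mul_left]
        gcongr
        exact tsum_rpow_le_rpow hsumE hs
    _ = _ := by rw [← add_mul, ← ENNReal.ofReal_add (by positivity) (by positivity)]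

lemma IsUniformWith.exists_spWith {Ω : Set (Euc 2)} {ε : ℝ} (hε : 0 < ε) (hε1 : ε ≤ 1)
    (hU : IsUniformWith Ω ε) (hΩ : IsOpen Ω) {p : ℝ} (hp1 : 1 ≤ p) (hp2 : p < 2) :
    ∃ C : ℝ, 1 ≤ C ∧ ∃ lam : ℝ, 1 ≤ lam ∧ SPWith Ω p C lam := by
  have hp0 : 0 < p := by linarith
  have h2p : 0 < 2 - p := by linarith
  obtain ⟨C₁, hC₁, lam, hlam, hpot⟩ := hU.exists_enorm_sub_le_potential hε hε1 hΩ
  set q := 2 * p / (2 - p) with hq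
  have hq0 : 0 < q := by positivity
  have hpq : p ≤ q := by
    rw [hq, le_div_iff₀ h2p]
    nlinarith
  obtain ⟨K, hK, hweak⟩ := exists_volume_potential_gt_le hp1 hp2 hq
  set K' := K * C₁ ^ q with hK'
  have hK'0 : 0 < K' := by positivity
  set B := 2 ^ q * (2 * K') + 2 * 12 ^ q * K' with hB
  have hB0 : 0 < B := by positivity
  refine ⟨max 1 (B ^ (1 / q)), le_max_left _ _, lam, hlam, fun u hu x hx r hr hrd => ?_⟩
  have hbl : MeasurableSet (ball x (lam * r) ∩ Ω) := (isOpen_ball.inter hΩ).measurableSet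
  have hW : ∀ v : Euc 2 → ℝ, LocallyLipschitzOnSet v Ω → ∃ c : ℝ, ∀ t : ℝ, 0 < t →
      volume {y ∈ ball x r ∩ Ω | t < |v y - c|} ≤ ENNReal.ofReal (K' / t ^ q) *
        (∫⁻ z in ball x (lam * r) ∩ Ω, ‖fderiv ℝ v z‖ₑ ^ p) ^ (q / p) := by
    intro v hv
    obtain ⟨c, hc⟩ := hpot v hv x hx r hr hrd
    refine ⟨c, fun t ht => ?_⟩
    have hf : Measurable ((ball x (lam * r) ∩ Ω).indicator fun z => ‖fderiv ℝ v z‖ₑ) :=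
      (measurable_fderiv ℝ v).enorm.indicator hbl
    have h := hweak _ hf (t / C₁) (by positivity)
    refine (measure_mono ?_).trans (h.trans_eq ?_)
    · rintro y ⟨hyD, hy⟩
      have h1 := hc y hyD
      rw [mem_ofPred_eq, ENNReal.ofReal_div_of_pos hC₁]
      refine ENNReal.div_lt_of_lt_mul' (((ENNReal.ofReal_lt_ofReal_iff (ht.trans hy)).2 hy).trans_le ?_)
      rw [← Real.enorm_eq_ofReal_abs]
      refine h1.trans_eq ?_
      rw [← lintegral_indicator hbl]
      simp only [indicator_mul_left]
    · rw [← lintegral_indicator hbl]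
      congr 2
      · rw [Real.div_rpow ht.le hC₁.le, hK']
        field_simp
      · refine lintegral_congr fun z => ?_
        by_cases hz : z ∈ ball x (lam * r) ∩ Ω <;> simp [hz, hp0]
  obtain ⟨c, hc⟩ := exists_lintegral_rpow_sub_le_of_weak hΩ (isOpen_ball.inter hΩ)
    inter_subset_right ⟨x, mem_ball_self hr, hx⟩
    ((measure_mono inter_subset_left).trans_lt measure_ball_lt_top).ne inter_subset_right
    hK'0 hp0 hpq hW hu
  have hinv : (2 - p) / (2 * p) = 1 / q := by rw [hq, one_div_div]
  rw [hinv]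
  simp_rw [ofReal_norm]
  calc (⨅ c : ℝ, (∫⁻ y in ball x r ∩ Ω, ENNReal.ofReal |u y - c| ^ q) ^ (1 / q))
      ≤ (∫⁻ y in ball x r ∩ Ω, ENNReal.ofReal |u y - c| ^ q) ^ (1 / q) := iInf_le _ c
    _ ≤ (ENNReal.ofReal B *
          (∫⁻ z in ball x (lam * r) ∩ Ω, ‖fderiv ℝ u z‖ₑ ^ p) ^ (q / p)) ^ (1 / q) := by
        gcongr
    _ = ENNReal.ofReal (B ^ (1 / q)) *
          (∫⁻ z in ball x (lam * r) ∩ Ω, ‖fderiv ℝ u z‖ₑ ^ p) ^ (1 / p) := by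
        rw [ENNReal.mul_rpow_of_nonneg _ _ (by positivity), ENNReal.ofReal_rpow_of_pos hB0,
          ← ENNReal.rpow_mul]
        congr 2
        field_simp
    _ ≤ _ := by
        gcongr
        exact le_max_right _ _

/-- a bounded simply connected planar domain is a local
Sobolev–Poincaré imbedding domain of order `p`, `1 ≤ p < 2`, iff it is uniform. -/
theorem stmt7 (p : ℝ) (hp1 : 1 ≤ p) (hp2 : p < 2)
    (Ω : Set (Euc 2)) (hOpen : IsOpen Ω)
    (hConn : IsConnected Ω) (hBdd : Bornology.IsBounded Ω)
    (hSC : SimplyConnectedSpace Ω) :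
    LocalSPLow 2 Ω p ↔ IsUniformDomain Ω := by
  exact ⟨fun h => by
    obtain ⟨C, hC, lam, hlam, hSP⟩ := localSPLow_iff.1 h
    exact hSP.isUniformDomain hOpen hConn hBdd hSC hC hlam hp1 hp2,
  fun ⟨_, hε, hε1, hU⟩ => localSPLow_iff.2 (hU.exists_spWith hε hε1 hOpen hp1 hp2)⟩
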